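/- arXiv:2510.20765 — 2 statements merged into one kernel-verified Lean document; each statement's English description precedes it below -/
import Mathlib

section
/- There is n₀ ∈ ℕ such that for all n ≥ n₀ and every d with n^{0.99} ≤ d ≤ n−1 and dn even, the following holds: for all but at most e^{−n}·|𝒦_d(n)| graphs K ∈ 𝒦_d(n), for every pair of sets U, V ⊆ [n] with |U| ≥ n^{0.98} and |V| ≥ n^{0.98}, (1 − n^{−0.01})·(d/n)·|U|·|V| ≤ e_K(U,V) ≤ (1 + n^{−0.01})·(d/n)·|U|·|V|. (Lemma 8.2, edge distribution in random regular graphs for large degree.) -/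
open scoped Classical ENNReal

noncomputable section

namespace Sandwich

variable {n : ℕ}

/-- The degree of the vertex `v` in the graph `G`. -/
def deg (G : SimpleGraph (Fin n)) (v : Fin n) : ℕ := Nat.card (G.neighborSet v)

/-- `G` is a `d`-regular graph. -/
def IsRegularGraph (G : SimpleGraph (Fin n)) (d : ℕ) : Prop := ∀ v, deg G v = d

/-- The number of edges of `G`. -/
def edgeCount (G : SimpleGraph (Fin n)) : ℕ := G.edgeSet.ncard

/-- The probability of the event `P` under the probability mass function `μ`. -/
def prEvent {α : Type*} (μ : PMF α) (P : α → Prop) : ℝ≥0∞ := ∑' a, if P a then μ a else 0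

/-- `μ` is the uniform distribution on the set `S`. -/
def IsUniformOn {α : Type*} (μ : PMF α) (S : Set α) : Prop :=
  ∀ a, μ a = if a ∈ S then (S.ncard : ℝ≥0∞)⁻¹ else 0

/-- `P` lists the `k+1` vertices of a `(G₁,G₂)`-alternating path of length `k`: the vertices
are distinct and consecutive vertices are joined by an edge of `G₁` (for steps of even index)
or of `G₂` (for steps of odd index). -/
def IsAltSeq (G₁ G₂ : SimpleGraph (Fin n)) (k : ℕ) (P : Fin (k + 1) → Fin n) : Prop :=
  Function.Injective P ∧
    ∀ i : Fin k, if (i : ℕ) % 2 = 0 then G₁.Adj (P i.castSucc) (P i.succ)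
      else G₂.Adj (P i.castSucc) (P i.succ)

/-- The number of `(G₁,G₂)`-alternating `x,y`-paths of length `k` with no internal vertex
in `Z`. -/
def altPathCount (G₁ G₂ : SimpleGraph (Fin n)) (k : ℕ) (x y : Fin n) (Z : Set (Fin n)) : ℕ :=
  Nat.card {P : Fin (k + 1) → Fin n // IsAltSeq G₁ G₂ k P ∧ P 0 = x ∧ P (Fin.last k) = y ∧
    ∀ i : Fin (k + 1), i ≠ 0 → i ≠ Fin.last k → P i ∉ Z}

/-- The number of `(G₁,G₂)`-alternating paths of length `k` starting at `x`. -/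
def altStartCount (G₁ G₂ : SimpleGraph (Fin n)) (k : ℕ) (x : Fin n) : ℕ :=
  Nat.card {P : Fin (k + 1) → Fin n // IsAltSeq G₁ G₂ k P ∧ P 0 = x}

/-- The external neighbourhood `N_G(U)` of a set of vertices `U`. -/
def nbhd (G : SimpleGraph (Fin n)) (U : Set (Fin n)) : Set (Fin n) :=
  {v | v ∉ U ∧ ∃ u ∈ U, G.Adj u v}

/-- `e_G(U)`, the number of edges of `G` with both endpoints in `U`. -/
def edgesWithin (G : SimpleGraph (Fin n)) (U : Set (Fin n)) : ℕ :=
  {e ∈ G.edgeSet | ∀ v ∈ e, v ∈ U}.ncard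

/-- `e_G(U,V) = |{(u,v) : u ∈ U, v ∈ V, uv ∈ E(G)}|`. -/
def edgesBetween (G : SimpleGraph (Fin n)) (U V : Set (Fin n)) : ℕ :=
  {p : Fin n × Fin n | p.1 ∈ U ∧ p.2 ∈ V ∧ G.Adj p.1 p.2}.ncard

/-- `|E_{≥2,G}(U)|`, the number of edges `xy ∈ E(G)` with `x ∈ U`, `y ∉ U` such that some
`x' ∈ U ∖ {x}` also satisfies `x'y ∈ E(G)`. -/
def E2count (G : SimpleGraph (Fin n)) (U : Set (Fin n)) : ℕ :=
  {e : Sym2 (Fin n) | e ∈ G.edgeSet ∧ ∃ x y, e = s(x, y) ∧ x ∈ U ∧ y ∉ U ∧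
    ∃ x' ∈ U, x' ≠ x ∧ G.Adj x' y}.ncard

/-- `Σ_{u ∈ N_{F∖K}(v)} Σ_{u' ∈ N_K(u)} d_{F∖K}(u')`. -/
def doubleDegSum (F K : SimpleGraph (Fin n)) (v : Fin n) : ℝ :=
  ∑ u : Fin n, if (F \ K).Adj v u then
    ∑ u' : Fin n, if K.Adj u u' then (deg (F \ K) u' : ℝ) else 0
  else 0

/-- `μ` is the law of the binomial random graph `G(n,p)`. -/
def IsGnp (μ : PMF (SimpleGraph (Fin n))) (p : ℝ) : Prop :=
  ∀ G, μ G = ENNReal.ofReal (p ^ edgeCount G * (1 - p) ^ (n.choose 2 - edgeCount G))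

/-- `μ` is the law of `G(n,p)`, where `p` is truncated to `[0,1]` (so that `G(n,p)` is the
empty graph for `p ≤ 0` and the complete graph for `p ≥ 1`). -/
def IsGnpLaw (μ : PMF (SimpleGraph (Fin n))) (p : ℝ) : Prop :=
  IsGnp μ (max 0 (min p 1))

/-- `μ` is the law of `K + E`, where `E` includes each pair not in `E(K)` independently with
probability `p`. -/
def IsAddGnp (μ : PMF (SimpleGraph (Fin n))) (K : SimpleGraph (Fin n)) (p : ℝ) : Prop :=
  ∀ F, μ F = if K ≤ F then
      ENNReal.ofReal (p ^ (edgeCount F - edgeCount K) * (1 - p) ^ (n.choose 2 - edgeCount F))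
    else 0

/-- `ν` is the joint law of `(K, F)` where `K ~ G_d(n)` is a uniformly random `d`-regular graph
and `F = K + E`, `E` including each pair not in `E(K)` independently with probability `p`. -/
def IsRegAddGnp (ν : PMF (SimpleGraph (Fin n) × SimpleGraph (Fin n))) (d : ℕ) (p : ℝ) : Prop :=
  ∀ w, ν w = if IsRegularGraph w.1 d ∧ w.1 ≤ w.2 then
      ({G : SimpleGraph (Fin n) | IsRegularGraph G d}.ncard : ℝ≥0∞)⁻¹ *
        ENNReal.ofReal (p ^ (edgeCount w.2 - edgeCount w.1) *
          (1 - p) ^ (n.choose 2 - edgeCount w.2))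
    else 0

/-- `ν` is the joint law of an independent pair `(K, F)` with `K ~ G_d(n)` and `F ~ G(n,q)`. -/
def IsRegIndepGnp (ν : PMF (SimpleGraph (Fin n) × SimpleGraph (Fin n))) (d : ℕ) (q : ℝ) :
    Prop :=
  ∀ w, ν w = (if IsRegularGraph w.1 d then
      ({G : SimpleGraph (Fin n) | IsRegularGraph G d}.ncard : ℝ≥0∞)⁻¹ else 0) *
      ENNReal.ofReal (q ^ edgeCount w.2 * (1 - q) ^ (n.choose 2 - edgeCount w.2))

/-- The product weight `p ^ #S * (1 - p) ^ #(E \ S)` of a subset `S` of `E`. -/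
def weight {ι : Type*} [DecidableEq ι] (E : Finset ι) (p : ℝ) (S : Finset ι) : ℝ :=
  ∏ e ∈ E, if e ∈ S then p else 1 - p

theorem weight_nonneg {ι : Type*} [DecidableEq ι] (E : Finset ι) {p : ℝ}
    (hp₀ : 0 ≤ p) (hp₁ : p ≤ 1)
    (S : Finset ι) : 0 ≤ weight E p S := by
  refine Finset.prod_nonneg fun e _ => ?_
  split_ifs <;> linarith

theorem sum_powerset_prod_ite {ι : Type*} [DecidableEq ι] (E : Finset ι) (a b : ι → ℝ) :
    ∑ S ∈ E.powerset, ∏ e ∈ E, (if e ∈ S then a e else b e) = ∏ e ∈ E, (a e + b e) := by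
  rw [Finset.prod_add]
  refine Finset.sum_congr rfl fun S hS => ?_
  have hSE := Finset.mem_powerset.1 hS
  rw [Finset.prod_ite]
  congr 2
  · ext e
    simp only [Finset.mem_filter]
    exact ⟨fun h => h.2, fun h => ⟨hSE h, h⟩⟩
  · ext e
    simp

theorem sum_weight {ι : Type*} [DecidableEq ι] (E : Finset ι) (p : ℝ) :
    ∑ S ∈ E.powerset, weight E p S = 1 := by
  unfold weight
  rw [sum_powerset_prod_ite E (fun _ => p) (fun _ => 1 - p)]
  simp

theorem mul_exp_add_one_sub_le {p x : ℝ} (hp₀ : 0 ≤ p) (hp₁ : p ≤ 1) (hx : |x| ≤ 1) :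
    p * Real.exp x + (1 - p) ≤ Real.exp (p * x + x ^ 2) := by
  have h₁ := (abs_le.1 (Real.abs_exp_sub_one_sub_id_le hx)).2
  have h₂ := Real.add_one_le_exp (p * x + x ^ 2)
  nlinarith [sq_nonneg x, mul_le_mul_of_nonneg_left h₁ hp₀,
    mul_le_mul_of_nonneg_right hp₁ (sq_nonneg x)]

/-- Exponential moment bound for a linear statistic of a random subset. -/
theorem sum_weight_mul_exp_le {ι : Type*} [DecidableEq ι] (E : Finset ι) {p : ℝ}
    (hp₀ : 0 ≤ p) (hp₁ : p ≤ 1)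
    (c : ι → ℝ) (hc : ∀ e ∈ E, |c e| ≤ 1) :
    ∑ S ∈ E.powerset, weight E p S * Real.exp (∑ e ∈ S, c e) ≤
      Real.exp (p * ∑ e ∈ E, c e + ∑ e ∈ E, c e ^ 2) := by
  calc ∑ S ∈ E.powerset, weight E p S * Real.exp (∑ e ∈ S, c e)
      = ∑ S ∈ E.powerset, ∏ e ∈ E, (if e ∈ S then p * Real.exp (c e) else 1 - p) := by
        refine Finset.sum_congr rfl fun S hS => ?_
        have hSE := Finset.mem_powerset.1 hS
        have h : ∑ e ∈ S, c e = ∑ e ∈ E, if e ∈ S then c e else 0 := by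
          rw [← Finset.sum_filter]
          congr 1
          ext e
          simp only [Finset.mem_filter]
          exact ⟨fun h => ⟨hSE h, h⟩, fun h => h.2⟩
        rw [h, Real.exp_sum, weight, ← Finset.prod_mul_distrib]
        refine Finset.prod_congr rfl fun e _ => ?_
        split_ifs <;> simp
    _ = ∏ e ∈ E, (p * Real.exp (c e) + (1 - p)) :=
        sum_powerset_prod_ite E (fun e => p * Real.exp (c e)) (fun _ => 1 - p)
    _ ≤ ∏ e ∈ E, Real.exp (p * c e + c e ^ 2) := by
        refine Finset.prod_le_prod (fun e _ => ?_) fun e he =>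
          mul_exp_add_one_sub_le hp₀ hp₁ (hc e he)
        have := mul_nonneg hp₀ (Real.exp_pos (c e)).le
        linarith
    _ = _ := by rw [← Real.exp_sum, Finset.sum_add_distrib, Finset.mul_sum]

theorem sum_weight_tail_le {ι : Type*} [DecidableEq ι] (E : Finset ι) {p : ℝ}
    (hp₀ : 0 ≤ p) (hp₁ : p ≤ 1)
    (c : ι → ℝ) (hc : ∀ e ∈ E, |c e| ≤ 2) {M t : ℝ} (hM : 0 < M)
    (hcM : ∑ e ∈ E, c e ^ 2 ≤ 2 * M) (ht₀ : 0 ≤ t) (htM : t ≤ 2 * M) :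
    ∑ S ∈ E.powerset with p * ∑ e ∈ E, c e + t ≤ ∑ e ∈ S, c e, weight E p S ≤
      Real.exp (-(t ^ 2 / (8 * M))) := by
  set l : ℝ := t / (4 * M) with hl
  have hl₀ : 0 ≤ l := by positivity
  have hl₁ : l * 2 ≤ 1 := by
    rw [hl, div_mul_eq_mul_div, div_le_one (by positivity)]; linarith
  have key := sum_weight_mul_exp_le E hp₀ hp₁ (fun e => l * c e) (fun e he => by
    rw [abs_mul, abs_of_nonneg hl₀]
    exact (mul_le_mul_of_nonneg_left (hc e he) hl₀).trans hl₁)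
  simp only [← Finset.mul_sum, mul_pow] at key
  set m := p * ∑ e ∈ E, c e with hm
  calc ∑ S ∈ E.powerset with m + t ≤ ∑ e ∈ S, c e, weight E p S
      ≤ ∑ S ∈ E.powerset with m + t ≤ ∑ e ∈ S, c e,
          weight E p S * Real.exp (l * ∑ e ∈ S, c e) * Real.exp (-(l * (m + t))) := by
        refine Finset.sum_le_sum fun S hS => ?_
        have hS' := (Finset.mem_filter.1 hS).2
        rw [mul_assoc, ← Real.exp_add]
        refine le_mul_of_one_le_right (weight_nonneg E hp₀ hp₁ S) (Real.one_le_exp ?_)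
        nlinarith
    _ ≤ ∑ S ∈ E.powerset,
          weight E p S * Real.exp (l * ∑ e ∈ S, c e) * Real.exp (-(l * (m + t))) := by
        refine Finset.sum_le_sum_of_subset_of_nonneg (Finset.filter_subset _ _) fun S _ _ => ?_
        have := weight_nonneg E hp₀ hp₁ S
        positivity
    _ ≤ Real.exp (p * (l * ∑ e ∈ E, c e) + l ^ 2 * ∑ e ∈ E, c e ^ 2) *
          Real.exp (-(l * (m + t))) := by
        rw [← Finset.sum_mul]
        exact mul_le_mul_of_nonneg_right key (Real.exp_pos _).le
    _ ≤ _ := by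
        rw [← Real.exp_add, Real.exp_le_exp]
        have h₁ : l ^ 2 * ∑ e ∈ E, c e ^ 2 ≤ l ^ 2 * (2 * M) :=
          mul_le_mul_of_nonneg_left hcM (sq_nonneg l)
        have h₂ : l ^ 2 * (2 * M) - l * t = -(t ^ 2 / (8 * M)) := by
          rw [hl]; field_simp; ring
        have h₃ : p * (l * ∑ e ∈ E, c e) = l * m := by rw [hm]; ring
        linarith

/-- Subsets close to `K` have total weight comparable with the weight of `K`. -/
theorem sum_weight_near_le {ι : Type*} [DecidableEq ι] (E : Finset ι) {p : ℝ} {n : ℕ} (hn : 0 < n)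
    (hp₀ : 1 / (n : ℝ) ≤ p) (hp₁ : p ≤ 1 - 1 / (n : ℝ)) (hE : E.card ≤ n ^ 2) (K : Finset ι)
    (T : ℕ) :
    ∑ S ∈ E.powerset with (symmDiff S K).card ≤ T, weight E p S ≤
      weight E p K * ((n : ℝ) ^ (2 * T) * Real.exp n) := by
  have hn' : (1 : ℝ) ≤ n := by exact_mod_cast hn
  have hn₀ : (0 : ℝ) < n := by linarith
  have hinv : (0 : ℝ) < 1 / n := by positivity
  have hK := weight_nonneg E (by linarith) (by linarith) K (p := p)
  let f : Finset ι → ℕ := fun S => (E.filter fun e => ¬ (e ∈ S ↔ e ∈ K)).card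
  have hf (S : Finset ι) (x : ℝ) :
      x ^ f S = ∏ e ∈ E, (if e ∈ S then (if e ∈ K then 1 else x) else
        (if e ∈ K then x else 1)) := by
    rw [← Finset.prod_const, Finset.prod_filter]
    refine Finset.prod_congr rfl fun e _ => ?_
    by_cases h₁ : e ∈ S <;> by_cases h₂ : e ∈ K <;> simp [h₁, h₂]
  have hfT {S : Finset ι} (hS : (symmDiff S K).card ≤ T) : f S ≤ T := by
    refine (Finset.card_le_card fun e he => ?_).trans hS
    have := (Finset.mem_filter.1 he).2
    rw [Finset.mem_symmDiff]
    tauto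
  have hw (S : Finset ι) : weight E p S ≤ weight E p K * (n : ℝ) ^ f S := by
    rw [hf, weight, weight, ← Finset.prod_mul_distrib]
    refine Finset.prod_le_prod (fun e _ => by split_ifs <;> linarith) fun e _ => ?_
    have h₁ : 1 ≤ p * n := by rwa [div_le_iff₀ hn₀] at hp₀
    have h₂ : 1 ≤ (1 - p) * n := by
      rw [← div_le_iff₀ hn₀]; linarith
    by_cases hS : e ∈ S <;> by_cases hK : e ∈ K <;> simp only [hS, hK, if_true, if_false] <;>
      linarith
  calc ∑ S ∈ E.powerset with (symmDiff S K).card ≤ T, weight E p S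
      ≤ ∑ S ∈ E.powerset with (symmDiff S K).card ≤ T,
          weight E p K * ((n : ℝ) ^ (2 * T) * (1 / (n : ℝ)) ^ f S) := by
        refine Finset.sum_le_sum fun S hS => (hw S).trans ?_
        refine mul_le_mul_of_nonneg_left ?_ hK
        have := hfT (Finset.mem_filter.1 hS).2
        rw [one_div, inv_pow, ← div_eq_mul_inv, le_div_iff₀ (by positivity), ← pow_add]
        exact pow_le_pow_right₀ hn' (by omega)
    _ ≤ ∑ S ∈ E.powerset, weight E p K * ((n : ℝ) ^ (2 * T) * (1 / (n : ℝ)) ^ f S) :=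
        Finset.sum_le_sum_of_subset_of_nonneg (Finset.filter_subset _ _)
          fun S _ _ => by positivity
    _ = weight E p K * ((n : ℝ) ^ (2 * T) * (1 + 1 / (n : ℝ)) ^ E.card) := by
        simp_rw [← Finset.mul_sum, hf]
        rw [sum_powerset_prod_ite E (fun e => if e ∈ K then 1 else 1 / (n : ℝ))
          (fun e => if e ∈ K then 1 / (n : ℝ) else 1), ← Finset.prod_const]
        congr 2
        refine Finset.prod_congr rfl fun e _ => ?_
        split_ifs <;> ring
    _ ≤ _ := by
        gcongr
        calc (1 + 1 / (n : ℝ)) ^ E.card ≤ (1 + 1 / (n : ℝ)) ^ (n ^ 2) :=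
              pow_le_pow_right₀ (by linarith) hE
          _ ≤ (Real.exp (1 / n)) ^ (n ^ 2) := by
              gcongr
              have := Real.add_one_le_exp (1 / (n : ℝ))
              linarith
          _ = Real.exp n := by
              rw [← Real.exp_nat_mul]
              congr 1
              push_cast
              field_simp

/-- The potential edges of a graph on `Fin n`. -/
def pairs (n : ℕ) : Finset (Sym2 (Fin n)) := Finset.univ.filter fun e => ¬ e.IsDiag

/-- The number of pairs in `U × V` with underlying unordered pair `e`. -/
def multiplicity (U V : Finset (Fin n)) (e : Sym2 (Fin n)) : ℕ :=
  ((U ×ˢ V).filter fun q => s(q.1, q.2) = e).card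

/-- The degree of `v` with respect to the edge set `S`. -/
def degIn (S : Finset (Sym2 (Fin n))) (v : Fin n) : ℕ := ∑ e ∈ S, multiplicity {v} Finset.univ e

theorem sum_multiplicity (S : Finset (Sym2 (Fin n))) (U V : Finset (Fin n)) :
    ∑ e ∈ S, multiplicity U V e = ((U ×ˢ V).filter fun q => s(q.1, q.2) ∈ S).card := by
  rw [Finset.card_eq_sum_card_fiberwise (s := (U ×ˢ V).filter fun q => s(q.1, q.2) ∈ S)
    (f := fun q : Fin n × Fin n => s(q.1, q.2)) (t := S) fun q hq => (Finset.mem_filter.1 hq).2]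
  refine Finset.sum_congr rfl fun e he => ?_
  rw [multiplicity, Finset.filter_filter]
  congr 1
  ext q
  simp only [Finset.mem_filter]
  refine ⟨fun h => ⟨h.1, ?_, h.2⟩, fun h => ⟨h.1, h.2.2⟩⟩
  rw [h.2]
  exact he

theorem multiplicity_le_two (U V : Finset (Fin n)) (e : Sym2 (Fin n)) :
    multiplicity U V e ≤ 2 := by
  induction e using Sym2.ind with
  | _ a b =>
    refine (Finset.card_le_card (t := {(a, b), (b, a)}) fun q hq => ?_).trans
      Finset.card_le_two
    have := (Finset.mem_filter.1 hq).2
    rw [Sym2.eq_iff] at this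
    simp only [Finset.mem_insert, Finset.mem_singleton, Prod.ext_iff]
    exact this

theorem multiplicity_singleton_univ (v : Fin n) (e : Sym2 (Fin n)) :
    multiplicity {v} Finset.univ e = if v ∈ e then 1 else 0 := by
  split_ifs with h
  · obtain ⟨w, rfl⟩ := h
    rw [multiplicity, Finset.card_eq_one]
    refine ⟨(v, w), ?_⟩
    ext ⟨x, y⟩
    simp only [Finset.mem_filter, Finset.mem_product, Finset.mem_singleton, Finset.mem_univ,
      and_true, Prod.mk.injEq]
    constructor
    · rintro ⟨rfl, h⟩
      exact ⟨rfl, Sym2.congr_right.1 h⟩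
    · rintro ⟨rfl, rfl⟩
      exact ⟨rfl, rfl⟩
  · rw [multiplicity, Finset.card_eq_zero, Finset.filter_eq_empty_iff]
    rintro ⟨x, y⟩ hx rfl
    simp only [Finset.mem_product, Finset.mem_singleton, Finset.mem_univ, and_true] at hx
    subst hx
    exact h (Sym2.mem_mk_left _ _)

theorem degIn_eq_card (S : Finset (Sym2 (Fin n))) (v : Fin n) :
    degIn S v = (Finset.univ.filter fun w => s(v, w) ∈ S).card := by
  rw [degIn, sum_multiplicity]
  symm
  refine Finset.card_bij (fun w _ => (v, w)) (fun w hw => ?_) (fun a _ b _ h => ?_) fun q hq => ?_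
  · simpa using hw
  · exact (Prod.mk.inj h).2
  · obtain ⟨x, y⟩ := q
    simp only [Finset.mem_filter, Finset.mem_product, Finset.mem_singleton, Finset.mem_univ,
      and_true] at hq
    obtain ⟨rfl, h⟩ := hq
    exact ⟨y, by simpa using h, rfl⟩

theorem mk_mem_pairs {a b : Fin n} : s(a, b) ∈ pairs n ↔ a ≠ b := by
  simp [pairs]

theorem degIn_insert {S : Finset (Sym2 (Fin n))} {e : Sym2 (Fin n)} (he : e ∉ S) (v : Fin n) :
    degIn (insert e S) v = degIn S v + if v ∈ e then 1 else 0 := by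
  rw [degIn, Finset.sum_insert he, multiplicity_singleton_univ, degIn, add_comm]

theorem degIn_erase {S : Finset (Sym2 (Fin n))} {e : Sym2 (Fin n)} (he : e ∈ S) (v : Fin n) :
    degIn (S.erase e) v + (if v ∈ e then 1 else 0) = degIn S v := by
  rw [degIn, ← multiplicity_singleton_univ, Finset.sum_erase_add _ _ he, degIn]

theorem sum_degIn {S : Finset (Sym2 (Fin n))} (hS : S ⊆ pairs n) :
    ∑ v, degIn S v = 2 * S.card := by
  induction S using Finset.induction_on with
  | empty => simp [degIn]
  | insert e S he ih =>
    simp only [degIn_insert he, Finset.sum_add_distrib]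
    rw [ih ((Finset.subset_insert e S).trans hS), Finset.card_insert_of_notMem he, mul_add]
    have hd := hS (Finset.mem_insert_self e S)
    induction e using Sym2.ind with
    | _ a b =>
      rw [mk_mem_pairs] at hd
      rw [Finset.sum_boole]
      have : (Finset.univ.filter fun v => v ∈ s(a, b)) = {a, b} := by
        ext v; simp
      rw [this, Finset.card_pair hd]
      norm_num

/-- How far the edge set `S` is from being `d`-regular. -/
def defect (S : Finset (Sym2 (Fin n))) (d : ℕ) : ℤ :=
  ∑ v, |(degIn S v : ℤ) - d| + |∑ v, ((degIn S v : ℤ) - d)|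

theorem exists_mem_notMem_of_degIn_lt {S : Finset (Sym2 (Fin n))} (hS : S ⊆ pairs n)
    {u v : Fin n} (h : degIn S v < degIn S u) :
    ∃ w, w ≠ u ∧ w ≠ v ∧ s(u, w) ∈ S ∧ s(v, w) ∉ S := by
  by_contra! hcon
  rw [degIn_eq_card, degIn_eq_card] at h
  refine h.not_ge ?_
  have huv : u ≠ v := fun huv => by subst huv; exact h.false
  refine Finset.card_le_card_of_injOn (Equiv.swap u v) (fun w hw => ?_)
    (Equiv.injective _).injOn
  simp only [Finset.coe_filter, Finset.mem_univ, true_and, Set.mem_ofPred_eq] at hw ⊢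
  have hne := mk_mem_pairs.1 (hS hw)
  by_cases hwv : w = v
  · subst hwv
    rw [Equiv.swap_apply_right, Sym2.eq_swap]
    exact hw
  · rw [Equiv.swap_apply_of_ne_of_ne hne.symm hwv]
    exact hcon w hne.symm hwv hw

theorem sum_abs_add_le {f g : Fin n → ℤ} {a b : Fin n} (hab : a ≠ b) {k : ℤ}
    (h₀ : ∀ v, v ≠ a → v ≠ b → g v = f v) (h : |g a| + |g b| + k ≤ |f a| + |f b|) :
    ∑ v, |g v| + k ≤ ∑ v, |f v| := by
  have hs (x : Fin n → ℤ) :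
      ∑ v, |x v| = ∑ v ∈ (Finset.univ \ {a, b}), |x v| + (|x a| + |x b|) := by
    rw [← Finset.sum_pair (f := fun v => |x v|) hab, Finset.sum_sdiff (Finset.subset_univ _)]
  rw [hs g, hs f]
  have : ∑ v ∈ (Finset.univ \ {a, b}), |g v| = ∑ v ∈ (Finset.univ \ {a, b}), |f v| := by
    refine Finset.sum_congr rfl fun v hv => ?_
    simp only [Finset.mem_sdiff, Finset.mem_univ, true_and, Finset.mem_insert,
      Finset.mem_singleton, not_or] at hv
    rw [h₀ v hv.1 hv.2]
  linarith

theorem sum_add_indicator {f : Fin n → ℤ} {a b : Fin n} (hab : a ≠ b) :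
    ∑ v, (f v + if v ∈ s(a, b) then 1 else 0) = ∑ v, f v + 2 := by
  rw [Finset.sum_add_distrib, Finset.sum_boole]
  have : (Finset.univ.filter fun v => v ∈ s(a, b)) = {a, b} := by
    ext v; simp
  rw [this, Finset.card_pair hab]
  norm_num

theorem exists_defect_decrease {S : Finset (Sym2 (Fin n))} (hS : S ⊆ pairs n) {d : ℕ}
    (hd : d ≤ n - 1) (hdn : Even (d * n)) (hreg : ∃ v, degIn S v ≠ d) :
    ∃ S' ⊆ pairs n, defect S' d + 2 ≤ defect S d ∧ (symmDiff S S').card ≤ 2 := by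
  have hcast : ∑ v, ((degIn S v : ℤ) - d) = ((∑ v, degIn S v : ℕ) : ℤ) - ((d * n : ℕ) : ℤ) := by
    rw [Finset.sum_sub_distrib]
    simp [mul_comm]
  have heven : Even (∑ v, ((degIn S v : ℤ) - d)) := by
    rw [hcast]
    exact (Int.even_coe_nat _ |>.2 (sum_degIn hS ▸ even_two_mul _)).sub
      (Int.even_coe_nat _ |>.2 hdn)
  rcases lt_trichotomy (∑ v, ((degIn S v : ℤ) - d)) 0 with hlt | heq | hgt
  · obtain ⟨v, -, hv⟩ : ∃ v ∈ Finset.univ, (degIn S v : ℤ) - d < 0 := by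
      by_contra! h
      exact hlt.not_ge (Finset.sum_nonneg h)
    obtain ⟨w, hwv, hw⟩ : ∃ w, w ≠ v ∧ s(v, w) ∉ S := by
      by_contra! h
      have h₁ : (Finset.univ.erase v).card ≤ degIn S v := by
        rw [degIn_eq_card]
        refine Finset.card_le_card fun w hw => ?_
        simp only [Finset.mem_filter, Finset.mem_univ, true_and]
        exact h w (Finset.ne_of_mem_erase hw)
      rw [Finset.card_erase_of_mem (Finset.mem_univ v), Finset.card_univ, Fintype.card_fin] at h₁
      omega
    refine ⟨insert s(v, w) S, Finset.insert_subset (mk_mem_pairs.2 hwv.symm) hS, ?_, ?_⟩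
    · have hdeg (x : Fin n) : (degIn (insert s(v, w) S) x : ℤ) - d =
          ((degIn S x : ℤ) - d) + if x ∈ s(v, w) then 1 else 0 := by
        rw [degIn_insert hw]; push_cast; ring
      simp only [defect, hdeg]
      rw [sum_add_indicator hwv.symm]
      have := sum_abs_add_le (f := fun x => (degIn S x : ℤ) - d)
        (g := fun x => ((degIn S x : ℤ) - d) + if x ∈ s(v, w) then 1 else 0)
        hwv.symm (k := 0) (fun x h₁ h₂ => by simp [h₁, h₂]) (by
          simp only [Sym2.mem_iff, true_or, or_true, if_true]
          rw [abs_of_neg hv, abs_of_nonpos (by omega)]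
          have := abs_add_le ((degIn S w : ℤ) - d) 1
          simp at this ⊢
          linarith)
      rw [abs_of_neg hlt, abs_of_nonpos]
      · linarith
      · obtain ⟨r, hr⟩ := heven
        omega
    · refine (Finset.card_le_card (t := {s(v, w)}) fun e he => ?_).trans (by simp)
      rw [Finset.mem_symmDiff, Finset.mem_insert] at he
      rw [Finset.mem_singleton]
      tauto
  · obtain ⟨v, -, hv⟩ : ∃ v ∈ Finset.univ, (degIn S v : ℤ) - d < 0 := by
      by_contra! h
      obtain ⟨v, hv⟩ := hreg
      have := (Finset.sum_eq_zero_iff_of_nonneg h).1 heq v (Finset.mem_univ v)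
      omega
    obtain ⟨u, -, hu⟩ : ∃ u ∈ Finset.univ, 0 < (degIn S u : ℤ) - d := by
      by_contra! h
      have := (Finset.sum_eq_zero_iff_of_nonpos h).1 heq v (Finset.mem_univ v)
      omega
    obtain ⟨w, hwu, hwv, huw, hvw⟩ :=
      exists_mem_notMem_of_degIn_lt hS (u := u) (v := v) (by omega)
    have huv : u ≠ v := fun h => by subst h; omega
    have hvw' : s(v, w) ∉ S.erase s(u, w) := fun h => hvw (Finset.mem_of_mem_erase h)
    refine ⟨insert s(v, w) (S.erase s(u, w)),
      Finset.insert_subset (mk_mem_pairs.2 hwv.symm) ((Finset.erase_subset _ _).trans hS), ?_, ?_⟩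
    · have hdeg (x : Fin n) : (degIn (insert s(v, w) (S.erase s(u, w))) x : ℤ) - d =
          ((degIn S x : ℤ) - d) + (if x ∈ s(v, w) then 1 else 0)
            - (if x ∈ s(u, w) then 1 else 0) := by
        rw [degIn_insert hvw', ← degIn_erase huw x]; push_cast; ring
      simp only [defect, hdeg]
      have hsum : ∑ x, (((degIn S x : ℤ) - d) + (if x ∈ s(v, w) then 1 else 0)
            - (if x ∈ s(u, w) then 1 else 0)) = ∑ x, ((degIn S x : ℤ) - d) := by
        rw [Finset.sum_sub_distrib, sum_add_indicator hwv.symm]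
        have := sum_add_indicator (f := fun _ : Fin n => 0) hwu.symm
        simp only [zero_add, Finset.sum_const_zero] at this
        rw [this]
        ring
      rw [hsum]
      have := sum_abs_add_le (f := fun x => (degIn S x : ℤ) - d)
        (g := fun x => ((degIn S x : ℤ) - d) + (if x ∈ s(v, w) then 1 else 0)
            - (if x ∈ s(u, w) then 1 else 0))
        huv (k := 2) (fun x h₁ h₂ => by simp [h₁, h₂]) (by
          simp only [Sym2.mem_iff, huv, huv.symm, hwu.symm, hwv.symm, true_or, or_self,
            if_true, if_false]
          rw [abs_of_neg hv, abs_of_pos hu, abs_of_nonneg (by omega), abs_of_nonpos (by omega)]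
          omega)
      linarith
    · refine (Finset.card_le_card (t := {s(v, w), s(u, w)}) fun e he => ?_).trans
        Finset.card_le_two
      rw [Finset.mem_symmDiff, Finset.mem_insert, Finset.mem_erase] at he
      rw [Finset.mem_insert, Finset.mem_singleton]
      tauto
  · obtain ⟨v, -, hv⟩ : ∃ v ∈ Finset.univ, 0 < (degIn S v : ℤ) - d := by
      by_contra! h
      exact hgt.not_ge (Finset.sum_nonpos h)
    obtain ⟨w, hw⟩ : ∃ w, s(v, w) ∈ S := by
      by_contra! h
      have : degIn S v = 0 := by
        rw [degIn_eq_card, Finset.card_eq_zero, Finset.filter_eq_empty_iff]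
        exact fun w _ => h w
      omega
    have hvw := mk_mem_pairs.1 (hS hw)
    refine ⟨S.erase s(v, w), (Finset.erase_subset _ _).trans hS, ?_, ?_⟩
    · have hdeg (x : Fin n) : (degIn (S.erase s(v, w)) x : ℤ) - d =
          ((degIn S x : ℤ) - d) - if x ∈ s(v, w) then 1 else 0 := by
        rw [← degIn_erase hw x]; push_cast; ring
      simp only [defect, hdeg]
      have hsum : ∑ x, (((degIn S x : ℤ) - d) - if x ∈ s(v, w) then 1 else 0) =
          ∑ x, ((degIn S x : ℤ) - d) - 2 := by
        rw [Finset.sum_sub_distrib]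
        have := sum_add_indicator (f := fun _ : Fin n => 0) hvw
        simp only [zero_add, Finset.sum_const_zero] at this
        rw [this]
      rw [hsum]
      have := sum_abs_add_le (f := fun x => (degIn S x : ℤ) - d)
        (g := fun x => ((degIn S x : ℤ) - d) - if x ∈ s(v, w) then 1 else 0)
        hvw (k := 0) (fun x h₁ h₂ => by simp [h₁, h₂]) (by
          simp only [Sym2.mem_iff, true_or, or_true, if_true]
          rw [abs_of_pos hv, abs_of_nonneg (by omega)]
          have := abs_sub ((degIn S w : ℤ) - d) 1
          simp at this ⊢
          linarith)
      rw [abs_of_pos hgt, abs_of_nonneg]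
      · linarith
      · obtain ⟨r, hr⟩ := heven
        omega
    · refine (Finset.card_le_card (t := {s(v, w)}) fun e he => ?_).trans (by simp)
      rw [Finset.mem_symmDiff, Finset.mem_erase] at he
      rw [Finset.mem_singleton]
      tauto

theorem defect_nonneg (S : Finset (Sym2 (Fin n))) (d : ℕ) : 0 ≤ defect S d :=
  add_nonneg (Finset.sum_nonneg fun _ _ => abs_nonneg _) (abs_nonneg _)

/-- Every graph can be turned into a `d`-regular one by changing few edges. -/
theorem exists_regular_near {d : ℕ} (hd : d ≤ n - 1) (hdn : Even (d * n)) (T : ℕ)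
    {S : Finset (Sym2 (Fin n))} (hS : S ⊆ pairs n) (hT : defect S d ≤ T) :
    ∃ K ⊆ pairs n, (∀ v, degIn K v = d) ∧ (symmDiff S K).card ≤ T := by
  induction T using Nat.strong_induction_on generalizing S with
  | _ T ih =>
    by_cases hreg : ∃ v, degIn S v ≠ d
    · obtain ⟨S', hS', hdef, hcard⟩ := exists_defect_decrease hS hd hdn hreg
      have h₀ := defect_nonneg S' d
      obtain ⟨K, hK, hKreg, hKcard⟩ := ih (T - 2) (by omega) hS' (by omega)
      refine ⟨K, hK, hKreg, ?_⟩
      have h₁ := Finset.card_le_card (symmDiff_triangle S S' K)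
      have h₂ := Finset.card_union_le (symmDiff S S') (symmDiff S' K)
      rw [Finset.sup_eq_union] at h₁
      omega
    · push Not at hreg
      exact ⟨S, hS, hreg, by simp⟩

theorem weight_eq {ι : Type*} [DecidableEq ι] {E K : Finset ι} (p : ℝ) (hK : K ⊆ E) :
    weight E p K = p ^ K.card * (1 - p) ^ (E.card - K.card) := by
  rw [weight, Finset.prod_ite, Finset.prod_const, Finset.prod_const,
    ← Finset.card_sdiff_of_subset hK]
  congr 3
  · ext e
    simp only [Finset.mem_filter]
    exact ⟨fun h => h.2, fun h => ⟨hK h, h⟩⟩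
  · ext e
    simp

theorem sum_filter_exists_le {α β : Type*} (A : Finset α) (I : Finset β) (Q : β → α → Prop)
    {_ : DecidablePred fun a => ∃ i ∈ I, Q i a} [∀ i, DecidablePred (Q i)]
    (w : α → ℝ) (hw : ∀ a ∈ A, 0 ≤ w a) :
    ∑ a ∈ A with ∃ i ∈ I, Q i a, w a ≤ ∑ i ∈ I, ∑ a ∈ A with Q i a, w a := by
  simp only [Finset.sum_filter]
  rw [Finset.sum_comm]
  refine Finset.sum_le_sum fun a ha => ?_
  have hnn : ∀ i ∈ I, 0 ≤ if Q i a then w a else 0 := fun i _ => by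
    split_ifs
    exacts [hw a ha, le_rfl]
  split_ifs with h
  · obtain ⟨i, hi, hQ⟩ := h
    calc w a = if Q i a then w a else 0 := by rw [if_pos hQ]
      _ ≤ _ := Finset.single_le_sum hnn hi
  · exact Finset.sum_nonneg hnn

theorem sum_multiplicity_pairs (U V : Finset (Fin n)) :
    ∑ e ∈ pairs n, multiplicity U V e + (U ∩ V).card = U.card * V.card := by
  rw [sum_multiplicity, ← Finset.card_product,
    ← Finset.card_filter_add_card_filter_not (s := U ×ˢ V)
      (fun q : Fin n × Fin n => s(q.1, q.2) ∈ pairs n)]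
  congr 1
  refine Finset.card_bij (fun v _ => (v, v)) (fun v hv => ?_) (fun a _ b _ h => ?_) fun q hq => ?_
  · simpa [mk_mem_pairs] using hv
  · exact (Prod.mk.inj h).1
  · obtain ⟨x, y⟩ := q
    simp only [Finset.mem_filter, Finset.mem_product, mk_mem_pairs, not_not] at hq
    obtain ⟨⟨hx, hy⟩, rfl⟩ := hq
    exact ⟨x, Finset.mem_inter.2 ⟨hx, hy⟩, rfl⟩

/-- Concentration of the number of edges between `U` and `V` in a random graph. -/
theorem sum_weight_multiplicity_tail_le {p : ℝ} (hp₀ : 0 ≤ p) (hp₁ : p ≤ 1)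
    (U V : Finset (Fin n)) {t : ℝ} (ht₀ : 0 < t) (htM : t ≤ 2 * (U.card * V.card)) :
    ∑ S ∈ (pairs n).powerset with
        t ≤ |((∑ e ∈ S, multiplicity U V e : ℕ) : ℝ) - p * (U.card * V.card - (U ∩ V).card)|,
      weight (pairs n) p S ≤ 2 * Real.exp (-(t ^ 2 / (8 * (U.card * V.card)))) := by
  have hM : (0 : ℝ) < U.card * V.card := by linarith
  have hsum : ∑ e ∈ pairs n, (multiplicity U V e : ℝ) = U.card * V.card - (U ∩ V).card := by
    have : (((∑ e ∈ pairs n, multiplicity U V e + (U ∩ V).card : ℕ)) : ℝ) =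
        ((U.card * V.card : ℕ) : ℝ) := congrArg _ (sum_multiplicity_pairs U V)
    push_cast at this
    linarith
  have htwo (e : Sym2 (Fin n)) : (multiplicity U V e : ℝ) ≤ 2 := by
    exact_mod_cast multiplicity_le_two U V e
  have hsq : ∑ e ∈ pairs n, (multiplicity U V e : ℝ) ^ 2 ≤ 2 * (U.card * V.card) := by
    calc ∑ e ∈ pairs n, (multiplicity U V e : ℝ) ^ 2
        ≤ ∑ e ∈ pairs n, 2 * (multiplicity U V e : ℝ) := by
          refine Finset.sum_le_sum fun e _ => ?_
          rw [sq]
          exact mul_le_mul_of_nonneg_right (htwo e) (Nat.cast_nonneg _)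
      _ = 2 * (U.card * V.card - (U ∩ V).card) := by rw [← Finset.mul_sum, hsum]
      _ ≤ _ := by
          have : (0 : ℝ) ≤ (U ∩ V).card := Nat.cast_nonneg _
          linarith
  have hup := sum_weight_tail_le (pairs n) hp₀ hp₁ (fun e => (multiplicity U V e : ℝ))
    (fun e _ => by rw [abs_of_nonneg (Nat.cast_nonneg _)]; exact htwo e) hM hsq ht₀.le htM
  have hlow := sum_weight_tail_le (pairs n) hp₀ hp₁ (fun e => -(multiplicity U V e : ℝ))
    (fun e _ => by rw [abs_neg, abs_of_nonneg (Nat.cast_nonneg _)]; exact htwo e) hM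
    (by simpa only [neg_sq] using hsq) ht₀.le htM
  simp only [Finset.sum_neg_distrib, hsum] at hup hlow
  have hnn (S : Finset (Sym2 (Fin n))) := weight_nonneg (pairs n) hp₀ hp₁ S
  refine le_trans ?_ ((add_le_add hup hlow).trans_eq (two_mul _).symm)
  simp only [Finset.sum_filter]
  rw [← Finset.sum_add_distrib]
  refine Finset.sum_le_sum fun S _ => ?_
  have := hnn S
  push_cast
  split_ifs with h₁ h₂ h₃ h₃ <;> try linarith
  rcases le_abs.1 h₁ with h | h
  · exact absurd (by linarith) h₂
  · exact absurd (by linarith) h₃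

/-- The edge sets of `d`-regular graphs on `Fin n`. -/
def regularSets (n d : ℕ) : Finset (Finset (Sym2 (Fin n))) :=
  (pairs n).powerset.filter fun S => ∀ v, degIn S v = d

theorem weight_regularSets {d : ℕ} (p : ℝ) {K : Finset (Sym2 (Fin n))}
    (hK : K ∈ regularSets n d) :
    weight (pairs n) p K = p ^ (d * n / 2) * (1 - p) ^ ((pairs n).card - d * n / 2) := by
  obtain ⟨hK, hd⟩ := Finset.mem_filter.1 hK
  rw [Finset.mem_powerset] at hK
  have h := sum_degIn hK
  simp only [hd, Finset.sum_const, Finset.card_univ, Fintype.card_fin, smul_eq_mul] at h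
  have hcard : K.card = d * n / 2 := by
    rw [mul_comm d n]; omega
  rw [weight_eq p hK, hcard]

theorem card_pairs_le (n : ℕ) : (pairs n).card ≤ n ^ 2 := by
  have h := Finset.card_le_card_of_surjOn (s := (Finset.univ : Finset (Fin n × Fin n)))
    (t := pairs n) (fun q => s(q.1, q.2)) (fun e _ => by
      induction e using Sym2.ind with
      | _ a b => exact ⟨(a, b), by simp, rfl⟩)
  simpa [sq] using h

/-- A graph with almost the right degrees is close to a `d`-regular graph. -/
theorem exists_regularSets_near {d : ℕ} (hd : d ≤ n - 1) (hdn : Even (d * n)) {D : ℕ}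
    {S : Finset (Sym2 (Fin n))} (hS : S ⊆ pairs n) (hdeg : ∀ v, |(degIn S v : ℤ) - d| ≤ D) :
    ∃ K ∈ regularSets n d, (symmDiff S K).card ≤ 2 * n * D := by
  have hdef : defect S d ≤ ((2 * n * D : ℕ) : ℤ) := by
    have h₁ : ∑ v, |(degIn S v : ℤ) - d| ≤ n * D := by
      refine (Finset.sum_le_sum fun v _ => hdeg v).trans ?_
      simp
    have h₂ := Finset.abs_sum_le_sum_abs (fun v => (degIn S v : ℤ) - d) Finset.univ
    rw [defect]
    push_cast
    linarith
  obtain ⟨K, hK, hKd, hSK⟩ := exists_regular_near hd hdn (2 * n * D) hS hdef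
  exact ⟨K, Finset.mem_filter.2 ⟨Finset.mem_powerset.2 hK, hKd⟩, hSK⟩

/-- Concentration of all degrees of a random graph. -/
theorem sum_weight_degIn_tail_le {p : ℝ} (hp₀ : 0 ≤ p) (hp₁ : p ≤ 1) {t : ℝ} (ht₀ : 0 < t)
    (htn : t ≤ 2 * n) :
    ∑ S ∈ (pairs n).powerset with
        ∃ v ∈ (Finset.univ : Finset (Fin n)), t ≤ |(degIn S v : ℝ) - p * (n - 1)|,
      weight (pairs n) p S ≤ 2 * n * Real.exp (-(t ^ 2 / (8 * n))) := by
  refine (sum_filter_exists_le _ _ _ _ fun S _ => weight_nonneg (pairs n) hp₀ hp₁ S).trans ?_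
  calc _ ≤ ∑ _v : Fin n, 2 * Real.exp (-(t ^ 2 / (8 * n))) := by
        refine Finset.sum_le_sum fun v _ => ?_
        have := sum_weight_multiplicity_tail_le hp₀ hp₁ {v} Finset.univ ht₀ (by simpa using htn)
        simpa [degIn] using this
    _ = _ := by
        rw [Finset.sum_const, Finset.card_univ, Fintype.card_fin, nsmul_eq_mul]; ring

/-- A random graph of density `d / n` is close to a `d`-regular graph with probability at least
one half. -/
theorem half_le_card_regularSets_mul {d : ℕ} (hn : 0 < n) (hd₀ : 0 < d) (hd : d ≤ n - 1)
    (hdn : Even (d * n)) {t : ℝ} (ht₀ : 0 < t) (htn : t ≤ 2 * n)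
    (ht : 2 * n * Real.exp (-(t ^ 2 / (8 * n))) ≤ 1 / 2) {D : ℕ} (hD : t + 1 ≤ D) :
    1 / 2 ≤ ((regularSets n d).card : ℝ) *
      (((d : ℝ) / n) ^ (d * n / 2) * (1 - (d : ℝ) / n) ^ ((pairs n).card - d * n / 2) *
        ((n : ℝ) ^ (2 * (2 * n * D)) * Real.exp n)) := by
  set p : ℝ := (d : ℝ) / n with hp
  have hn₀ : (0 : ℝ) < n := by exact_mod_cast hn
  have hd₁ : (1 : ℝ) ≤ d := by exact_mod_cast hd₀
  have hdn₁ : (d : ℝ) + 1 ≤ n := by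
    have : d + 1 ≤ n := by omega
    exact_mod_cast this
  have hp₀ : 1 / (n : ℝ) ≤ p := by rw [hp]; gcongr
  have hp₁ : p ≤ 1 - 1 / (n : ℝ) := by
    rw [hp, div_le_iff₀ hn₀, sub_mul, one_div_mul_cancel hn₀.ne']; linarith
  have hinv : (0 : ℝ) < 1 / n := by positivity
  have hp₀' : 0 ≤ p := by linarith
  have hp₁' : p ≤ 1 := by linarith
  have hnn (S : Finset (Sym2 (Fin n))) := weight_nonneg (pairs n) hp₀' hp₁' S
  have hfar := sum_weight_degIn_tail_le hp₀' hp₁' ht₀ htn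
  have hsplit := Finset.sum_filter_add_sum_filter_not (pairs n).powerset
    (fun S => ∃ v ∈ (Finset.univ : Finset (Fin n)), t ≤ |(degIn S v : ℝ) - p * (n - 1)|)
    (weight (pairs n) p)
  rw [sum_weight] at hsplit
  calc (1 : ℝ) / 2 ≤ ∑ S ∈ (pairs n).powerset with
        ¬ ∃ v ∈ (Finset.univ : Finset (Fin n)), t ≤ |(degIn S v : ℝ) - p * (n - 1)|,
          weight (pairs n) p S := by linarith
    _ ≤ ∑ S ∈ (pairs n).powerset with
          ∃ K ∈ regularSets n d, (symmDiff S K).card ≤ 2 * n * D, weight (pairs n) p S := by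
        refine Finset.sum_le_sum_of_subset_of_nonneg (fun S hS => ?_) fun S _ _ => hnn S
        obtain ⟨hSp, hS⟩ := Finset.mem_filter.1 hS
        refine Finset.mem_filter.2 ⟨hSp,
          exists_regularSets_near hd hdn (Finset.mem_powerset.1 hSp) fun v => ?_⟩
        have h₁ : |(degIn S v : ℝ) - p * (n - 1)| < t := by
          by_contra! h
          exact hS ⟨v, Finset.mem_univ v, h⟩
        have h₂ : p * (n - 1) = d - p := by
          rw [mul_sub, hp, div_mul_cancel₀ _ hn₀.ne', mul_one]
        have h₃ : |(degIn S v : ℝ) - d| ≤ D := by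
          rw [h₂, abs_lt] at h₁
          rw [abs_le]
          constructor <;> linarith
        exact_mod_cast h₃
    _ ≤ ∑ K ∈ regularSets n d, ∑ S ∈ (pairs n).powerset with (symmDiff S K).card ≤ 2 * n * D,
          weight (pairs n) p S :=
        sum_filter_exists_le (pairs n).powerset (regularSets n d)
          (fun K S => (symmDiff S K).card ≤ 2 * n * D) (weight (pairs n) p) fun S _ => hnn S
    _ ≤ ∑ _K ∈ regularSets n d, p ^ (d * n / 2) * (1 - p) ^ ((pairs n).card - d * n / 2) *
        ((n : ℝ) ^ (2 * (2 * n * D)) * Real.exp n) := by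
        refine Finset.sum_le_sum fun K hK => ?_
        rw [← weight_regularSets p hK]
        exact sum_weight_near_le (pairs n) hn hp₀ hp₁ (card_pairs_le n) K (2 * n * D)
    _ = _ := by rw [Finset.sum_const, nsmul_eq_mul]

/-- The edge set of `K` as a finite set. -/
def edges (K : SimpleGraph (Fin n)) : Finset (Sym2 (Fin n)) :=
  Finset.univ.filter fun e => e ∈ K.edgeSet

theorem mem_edges {K : SimpleGraph (Fin n)} {e : Sym2 (Fin n)} : e ∈ edges K ↔ e ∈ K.edgeSet := by
  simp [edges]

theorem edges_subset_pairs (K : SimpleGraph (Fin n)) : edges K ⊆ pairs n := fun e he => by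
  rw [mem_edges] at he
  exact Finset.mem_filter.2 ⟨Finset.mem_univ e, K.not_isDiag_of_mem_edgeSet he⟩

theorem edges_injective : Function.Injective (edges (n := n)) := fun K K' h => by
  rw [← SimpleGraph.edgeSet_inj]
  ext e
  rw [← mem_edges, h, mem_edges]

theorem edges_fromEdgeSet {S : Finset (Sym2 (Fin n))} (hS : S ⊆ pairs n) :
    edges (SimpleGraph.fromEdgeSet (S : Set (Sym2 (Fin n)))) = S := by
  ext e
  rw [mem_edges, SimpleGraph.edgeSet_fromEdgeSet]
  simp only [Set.mem_sdiff, Finset.mem_coe]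
  exact ⟨fun h => h.1, fun h => ⟨h, (Finset.mem_filter.1 (hS h)).2⟩⟩

theorem deg_eq_degIn (K : SimpleGraph (Fin n)) (v : Fin n) : deg K v = degIn (edges K) v := by
  rw [deg, degIn_eq_card, Nat.card_coe_set_eq, ← Set.ncard_coe_finset]
  congr 1
  ext w
  simp [mem_edges]

theorem edgesBetween_eq_sum (K : SimpleGraph (Fin n)) (U V : Finset (Fin n)) :
    edgesBetween K U V = ∑ e ∈ edges K, multiplicity U V e := by
  rw [edgesBetween, sum_multiplicity, ← Set.ncard_coe_finset]
  congr 1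
  ext q
  simp [mem_edges, and_assoc]

theorem ncard_regular_eq (n d : ℕ) :
    {K : SimpleGraph (Fin n) | IsRegularGraph K d}.ncard = (regularSets n d).card := by
  have himg : edges '' {K : SimpleGraph (Fin n) | IsRegularGraph K d} =
      (regularSets n d : Set (Finset (Sym2 (Fin n)))) := by
    ext S
    simp only [Set.mem_image, Set.mem_ofPred_eq, IsRegularGraph, deg_eq_degIn, Finset.mem_coe,
      regularSets, Finset.mem_filter, Finset.mem_powerset]
    constructor
    · rintro ⟨K, hK, rfl⟩
      exact ⟨edges_subset_pairs K, hK⟩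
    · rintro ⟨hS, hd⟩
      exact ⟨_, by rwa [edges_fromEdgeSet hS], edges_fromEdgeSet hS⟩
  rw [← Set.ncard_coe_finset, ← himg, Set.ncard_image_of_injective _ edges_injective]

/-- A random graph is unlikely to have unevenly distributed edges. -/
theorem sum_weight_uneven_le {p ε L : ℝ} (hp₀ : 0 < p) (hp₁ : p ≤ 1) (hε₀ : 0 < ε) (hε₁ : ε ≤ 1)
    (hL : 0 < L) {A : Finset (Finset (Sym2 (Fin n)))} (hA : A ⊆ (pairs n).powerset)
    (h : ∀ S ∈ A, ∃ U V : Finset (Fin n), L ≤ U.card ∧ L ≤ V.card ∧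
      ε * p * (U.card * V.card) ≤ |((∑ e ∈ S, multiplicity U V e : ℕ) : ℝ) -
        p * (U.card * V.card - (U ∩ V).card)|) :
    ∑ S ∈ A, weight (pairs n) p S ≤
      4 ^ n * (2 * Real.exp (-(ε ^ 2 * p ^ 2 * L ^ 2 / 8))) := by
  let I := Finset.univ.filter fun W : Finset (Fin n) × Finset (Fin n) =>
    L ≤ W.1.card ∧ L ≤ W.2.card
  let Q : Finset (Fin n) × Finset (Fin n) → Finset (Sym2 (Fin n)) → Prop := fun W S =>
    ε * p * (W.1.card * W.2.card) ≤ |((∑ e ∈ S, multiplicity W.1 W.2 e : ℕ) : ℝ) -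
      p * (W.1.card * W.2.card - (W.1 ∩ W.2).card)|
  have hnn (S : Finset (Sym2 (Fin n))) := weight_nonneg (pairs n) hp₀.le hp₁ S
  have hsub : ∑ S ∈ A, weight (pairs n) p S ≤
      ∑ S ∈ (pairs n).powerset with ∃ W ∈ I, Q W S, weight (pairs n) p S := by
    refine Finset.sum_le_sum_of_subset_of_nonneg (fun S hS => ?_) fun S _ _ => hnn S
    rw [Finset.mem_filter]
    obtain ⟨U, V, hU, hV, hUV⟩ := h S hS
    exact ⟨hA hS, (U, V), Finset.mem_filter.2 ⟨Finset.mem_univ _, hU, hV⟩, hUV⟩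
  refine hsub.trans ((sum_filter_exists_le _ _ Q _ fun S _ => hnn S).trans ?_)
  refine (Finset.sum_le_card_nsmul _ _ (2 * Real.exp (-(ε ^ 2 * p ^ 2 * L ^ 2 / 8)))
    fun W hW => ?_).trans ?_
  · obtain ⟨hU, hV⟩ := (Finset.mem_filter.1 hW).2
    have hM : L ^ 2 ≤ W.1.card * W.2.card := by
      rw [sq]; exact mul_le_mul hU hV hL.le (Nat.cast_nonneg _)
    have hM₀ : (0 : ℝ) < W.1.card * W.2.card := (by positivity : 0 < L ^ 2).trans_le hM
    have hεp : ε * p ≤ 2 := by nlinarith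
    refine (sum_weight_multiplicity_tail_le hp₀.le hp₁ W.1 W.2 (by positivity)
      (mul_le_mul_of_nonneg_right hεp hM₀.le)).trans ?_
    have : (ε * p * (W.1.card * W.2.card)) ^ 2 / (8 * ((W.1.card : ℝ) * W.2.card)) =
        ε ^ 2 * p ^ 2 * (W.1.card * W.2.card) / 8 := by
      field_simp
    rw [this]
    gcongr
  · rw [nsmul_eq_mul]
    refine mul_le_mul_of_nonneg_right ?_ (by positivity)
    have : (Finset.univ.filter fun W : Finset (Fin n) × Finset (Fin n) =>
        L ≤ W.1.card ∧ L ≤ W.2.card).card ≤ 4 ^ n := by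
      refine (Finset.card_le_univ _).trans ?_
      rw [Fintype.card_prod, Fintype.card_finset, Fintype.card_fin, ← mul_pow]
      norm_num
    exact_mod_cast this

theorem log_le_ten_mul_rpow {x : ℝ} (hx : 0 ≤ x) : Real.log x ≤ 10 * x ^ (0.1 : ℝ) := by
  have h := Real.log_le_rpow_div hx (ε := 0.1) (by norm_num)
  rw [div_eq_mul_inv, mul_comm] at h
  have h₁ : (0.1 : ℝ)⁻¹ = 10 := by norm_num
  rwa [h₁] at h

theorem four_mul_rpow_le {x : ℝ} (hx : 1 ≤ x) (h : 8000 ≤ x ^ (0.02 : ℝ)) :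
    2 * x * Real.exp (-((x ^ (0.8 : ℝ)) ^ 2 / (8 * x))) ≤ 1 / 2 := by
  have hx₀ : 0 < x := by linarith
  have hlog := log_le_ten_mul_rpow hx₀.le
  have hpow : (x ^ (0.8 : ℝ)) ^ 2 / (8 * x) = x ^ (0.6 : ℝ) / 8 := by
    rw [← Real.rpow_natCast, ← Real.rpow_mul hx₀.le, mul_comm 8 x, ← div_div]
    nth_rewrite 2 [← Real.rpow_one x]
    rw [← Real.rpow_sub hx₀]
    norm_num
  have h₁ : 1 ≤ x ^ (0.1 : ℝ) := Real.one_le_rpow hx (by norm_num)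
  have h₂ : x ^ (0.02 : ℝ) * x ^ (0.1 : ℝ) ≤ x ^ (0.6 : ℝ) := by
    rw [← Real.rpow_add hx₀]
    exact Real.rpow_le_rpow_of_exponent_le hx (by norm_num)
  have h₃ : 8000 * x ^ (0.1 : ℝ) ≤ x ^ (0.6 : ℝ) :=
    (mul_le_mul_of_nonneg_right h (by linarith)).trans h₂
  have h₄ : (4 : ℝ) ≤ Real.exp 3 := by
    have := Real.add_one_le_exp (3 : ℝ)
    linarith
  rw [hpow]
  have h₅ : 4 * x ≤ Real.exp (x ^ (0.6 : ℝ) / 8) := by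
    calc 4 * x ≤ Real.exp 3 * Real.exp (Real.log x) := by
          rw [Real.exp_log hx₀]; gcongr
      _ = Real.exp (3 + Real.log x) := (Real.exp_add _ _).symm
      _ ≤ _ := Real.exp_le_exp.2 (by linarith)
  rw [Real.exp_neg, ← div_eq_mul_inv, div_le_iff₀ (Real.exp_pos _)]
  linarith

theorem four_mul_four_pow_mul_le {n : ℕ} (hn : 1 ≤ n) (h : 8000 ≤ (n : ℝ) ^ (0.02 : ℝ)) {D : ℕ}
    (hD : (D : ℝ) ≤ (n : ℝ) ^ (0.8 : ℝ) + 2) :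
    4 * 4 ^ n * Real.exp (-((n : ℝ) ^ (1.92 : ℝ) / 32)) *
      ((n : ℝ) ^ (2 * (2 * n * D)) * Real.exp n) ≤ Real.exp (-(n : ℝ)) := by
  set x : ℝ := (n : ℝ) with hxn
  have hx : 1 ≤ x := Nat.one_le_cast.2 hn
  have hx₀ : 0 < x := by linarith
  have hlog := log_le_ten_mul_rpow hx₀.le
  have hlog₀ : 0 ≤ Real.log x := Real.log_nonneg hx
  have h₀ : x ≤ x ^ (1.9 : ℝ) := by
    conv_lhs => rw [← Real.rpow_one x]
    exact Real.rpow_le_rpow_of_exponent_le hx (by norm_num)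
  have h₁ : 1 ≤ x ^ (0.8 : ℝ) := Real.one_le_rpow hx (by norm_num)
  have h₂ : 8000 * x ^ (1.9 : ℝ) ≤ x ^ (1.92 : ℝ) := by
    refine (mul_le_mul_of_nonneg_right h (by positivity)).trans_eq ?_
    rw [← Real.rpow_add hx₀]
    norm_num
  have h₃ : x * x ^ (0.8 : ℝ) * x ^ (0.1 : ℝ) = x ^ (1.9 : ℝ) := by
    nth_rewrite 1 [← Real.rpow_one x]
    rw [← Real.rpow_add hx₀, ← Real.rpow_add hx₀]
    norm_num
  have h₄ : (4 : ℝ) ≤ Real.exp 3 := by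
    have := Real.add_one_le_exp (3 : ℝ)
    linarith
  have h₅ : (4 : ℝ) ^ n ≤ Real.exp (3 * x) := by
    rw [mul_comm, hxn, Real.exp_nat_mul]
    gcongr
  have h₆ : x ^ (2 * (2 * n * D)) = Real.exp (4 * x * D * Real.log x) := by
    rw [← Real.rpow_natCast, Real.rpow_def_of_pos hx₀]
    congr 1
    push_cast
    ring
  have h₇ : 4 * x * D * Real.log x ≤ 120 * x ^ (1.9 : ℝ) := by
    calc 4 * x * D * Real.log x ≤ 4 * x * (3 * x ^ (0.8 : ℝ)) * (10 * x ^ (0.1 : ℝ)) := by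
          gcongr
          linarith
      _ = 120 * (x * x ^ (0.8 : ℝ) * x ^ (0.1 : ℝ)) := by ring
      _ = _ := by rw [h₃]
  rw [h₆]
  calc _ ≤ Real.exp 3 * Real.exp (3 * x) * Real.exp (-(x ^ (1.92 : ℝ) / 32)) *
        (Real.exp (4 * x * D * Real.log x) * Real.exp x) := by gcongr
    _ = Real.exp (3 + 3 * x + -(x ^ (1.92 : ℝ) / 32) + (4 * x * D * Real.log x + x)) := by
        simp only [Real.exp_add]
    _ ≤ _ := Real.exp_le_exp.2 (by linarith)

/-- A deviation from the stated bounds is a deviation from the mean in the random graph. -/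
theorem le_abs_sub_of_not_bounds {p η M I X : ℝ} (hp : 0 ≤ p) (hI₀ : 0 ≤ I)
    (hI : I ≤ η / 2 * M) (h : ¬ ((1 - η) * p * M ≤ X ∧ X ≤ (1 + η) * p * M)) :
    η / 2 * p * M ≤ |X - p * (M - I)| := by
  have h₁ := mul_le_mul_of_nonneg_left hI hp
  have h₂ := mul_nonneg hp hI₀
  rw [le_abs]
  by_contra! hcon
  exact h ⟨by linarith, by linarith⟩

/-- **Lemma 8.2 (edge distribution in `G_d(n)` for large `d`).** For all sufficiently large
`n` and every `d` with `n^{0.99} ≤ d ≤ n−1` and `dn` even, all but at most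
`e^{−n}·|𝒦_d(n)|` graphs `K ∈ 𝒦_d(n)` satisfy: for all `U, V ⊆ [n]` with
`|U|, |V| ≥ n^{0.98}`, `e_K(U,V) = (1 ± n^{−0.01})·(d/n)·|U||V|`. -/
theorem edge_distribution_dense_regular :
    ∃ n₀ : ℕ, ∀ n : ℕ, n₀ ≤ n →
      ∀ d : ℕ, (n : ℝ) ^ (0.99 : ℝ) ≤ (d : ℝ) → d ≤ n - 1 → Even (d * n) →
        ({K : SimpleGraph (Fin n) | IsRegularGraph K d ∧
            ¬ (∀ U V : Set (Fin n), (n : ℝ) ^ (0.98 : ℝ) ≤ (U.ncard : ℝ) →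
                (n : ℝ) ^ (0.98 : ℝ) ≤ (V.ncard : ℝ) →
                (1 - (n : ℝ) ^ (-(0.01 : ℝ))) * ((d : ℝ) / n) * U.ncard * V.ncard ≤
                    (edgesBetween K U V : ℝ) ∧
                  (edgesBetween K U V : ℝ) ≤
                    (1 + (n : ℝ) ^ (-(0.01 : ℝ))) * ((d : ℝ) / n) * U.ncard *
                      V.ncard)}.ncard : ℝ) ≤
          Real.exp (-(n : ℝ)) *
            ({K : SimpleGraph (Fin n) | IsRegularGraph K d}.ncard : ℝ) := by
  have htend : Filter.Tendsto (fun n : ℕ => (n : ℝ) ^ (0.02 : ℝ)) Filter.atTop Filter.atTop :=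
    (tendsto_rpow_atTop (by norm_num)).comp tendsto_natCast_atTop_atTop
  obtain ⟨n₀, hn₀⟩ := Filter.eventually_atTop.1
    ((htend.eventually_ge_atTop 8000).and (Filter.eventually_ge_atTop 1))
  refine ⟨n₀, fun n hn d hd₀ hd hdn => ?_⟩
  obtain ⟨hbig, hn₁⟩ := hn₀ n hn
  have hx : (1 : ℝ) ≤ n := by exact_mod_cast hn₁
  have hx₀ : (0 : ℝ) < n := by linarith
  have hd₁ : (1 : ℝ) ≤ d := (Real.one_le_rpow hx (by norm_num)).trans hd₀
  have hdpos : 0 < d := by exact_mod_cast lt_of_lt_of_le one_pos hd₁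
  have hdn₁ : (d : ℝ) < n := by exact_mod_cast (by omega : d < n)
  set p : ℝ := (d : ℝ) / n with hp
  have hp₀ : 0 < p := by positivity
  have hp₁ : p < 1 := by rw [hp, div_lt_one hx₀]; exact hdn₁
  have hpn : (n : ℝ) ^ (-(0.01 : ℝ)) ≤ p := by
    rw [hp, le_div_iff₀ hx₀]
    nth_rewrite 2 [← Real.rpow_one (n : ℝ)]
    rw [← Real.rpow_add hx₀]
    norm_num at hd₀ ⊢
    exact hd₀
  set η : ℝ := (n : ℝ) ^ (-(0.01 : ℝ)) with hη
  set L : ℝ := (n : ℝ) ^ (0.98 : ℝ) with hL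
  have hη₀ : 0 < η := by positivity
  have hη₁ : η ≤ 1 := Real.rpow_le_one_of_one_le_of_nonpos hx (by norm_num)
  have hL₀ : 0 < L := by positivity
  have hηL : 2 ≤ η * L := by
    rw [hη, hL, ← Real.rpow_add hx₀]
    have : (n : ℝ) ^ (0.02 : ℝ) ≤ (n : ℝ) ^ (-(0.01 : ℝ) + 0.98) :=
      Real.rpow_le_rpow_of_exponent_le hx (by norm_num)
    linarith
  have hexp : (n : ℝ) ^ (1.92 : ℝ) / 32 ≤ (η / 2) ^ 2 * p ^ 2 * L ^ 2 / 8 := by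
    have h₁ : (n : ℝ) ^ (1.92 : ℝ) = η ^ 2 * η ^ 2 * L ^ 2 := by
      simp only [hη, hL, ← Real.rpow_natCast, ← Real.rpow_mul hx₀.le, ← Real.rpow_add hx₀]
      norm_num
    have h₂ : η ^ 2 * η ^ 2 * L ^ 2 ≤ η ^ 2 * p ^ 2 * L ^ 2 := by gcongr
    rw [h₁]
    linarith
  set D : ℕ := ⌈(n : ℝ) ^ (0.8 : ℝ)⌉₊ + 1 with hD
  have hD₁ : (n : ℝ) ^ (0.8 : ℝ) + 1 ≤ D := by
    rw [hD]; push_cast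
    linarith [Nat.le_ceil ((n : ℝ) ^ (0.8 : ℝ))]
  have hD₂ : (D : ℝ) ≤ (n : ℝ) ^ (0.8 : ℝ) + 2 := by
    rw [hD]; push_cast
    linarith [Nat.ceil_lt_add_one (by positivity : 0 ≤ (n : ℝ) ^ (0.8 : ℝ))]
  have hhalf := half_le_card_regularSets_mul hn₁ hdpos hd hdn
    (by positivity : 0 < (n : ℝ) ^ (0.8 : ℝ)) (by
      have : (n : ℝ) ^ (0.8 : ℝ) ≤ (n : ℝ) ^ (1 : ℝ) :=
        Real.rpow_le_rpow_of_exponent_le hx (by norm_num)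
      rw [Real.rpow_one] at this
      linarith) (four_mul_rpow_le hx hbig) hD₁
  rw [← hp] at hhalf
  set w : ℝ := p ^ (d * n / 2) * (1 - p) ^ ((pairs n).card - d * n / 2) with hw
  have hw₀ : 0 < w := mul_pos (pow_pos hp₀ _) (pow_pos (by linarith) _)
  rw [ncard_regular_eq]
  generalize hB : {K : SimpleGraph (Fin n) | IsRegularGraph K d ∧ _} = B
  have hBw : (B.ncard : ℝ) * w ≤
      4 ^ n * (2 * Real.exp (-((η / 2) ^ 2 * p ^ 2 * L ^ 2 / 8))) := by
    have hcard : B.ncard = (Finset.image edges B.toFinset).card := by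
      rw [Finset.card_image_of_injective _ edges_injective, Set.ncard_eq_toFinset_card']
    rw [hcard, ← nsmul_eq_mul, ← Finset.sum_const]
    have hmem : ∀ S ∈ Finset.image edges B.toFinset, S ∈ regularSets n d := by
      intro S hS
      obtain ⟨K, hK, rfl⟩ := Finset.mem_image.1 hS
      rw [Set.mem_toFinset, ← hB] at hK
      exact Finset.mem_filter.2 ⟨Finset.mem_powerset.2 (edges_subset_pairs K),
        fun v => deg_eq_degIn K v ▸ hK.1 v⟩
    rw [← Finset.sum_congr rfl fun S hS => weight_regularSets p (hmem S hS)]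
    refine sum_weight_uneven_le hp₀ hp₁.le (half_pos hη₀) (by linarith) hL₀
      (fun S hS => (Finset.mem_filter.1 (hmem S hS)).1) fun S hS => ?_
    obtain ⟨K, hK, rfl⟩ := Finset.mem_image.1 hS
    rw [Set.mem_toFinset, ← hB] at hK
    have hK₂ := hK.2
    push Not at hK₂
    obtain ⟨U, V, hU, hV, hUV⟩ := hK₂
    have hU' := Set.ncard_eq_toFinset_card' U
    have hV' := Set.ncard_eq_toFinset_card' V
    rw [hU'] at hU hUV
    rw [hV'] at hV hUV
    refine ⟨U.toFinset, V.toFinset, hU, hV, ?_⟩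
    rw [← edgesBetween_eq_sum]
    refine le_abs_sub_of_not_bounds hp₀.le (Nat.cast_nonneg _) ?_ ?_
    · have h₁ : ((U.toFinset ∩ V.toFinset).card : ℝ) ≤ U.toFinset.card := by
        exact_mod_cast Finset.card_le_card Finset.inter_subset_left
      have h₂ : 2 ≤ η * V.toFinset.card := hηL.trans (by gcongr)
      have h₃ : (0 : ℝ) ≤ U.toFinset.card := Nat.cast_nonneg _
      nlinarith
    · rintro ⟨h₁, h₂⟩
      rw [Set.coe_toFinset, Set.coe_toFinset, ← mul_assoc] at h₁ h₂
      exact h₂.not_gt (hUV h₁)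
  set R : ℝ := ((regularSets n d).card : ℝ) with hR
  set Q : ℝ := (n : ℝ) ^ (2 * (2 * n * D)) * Real.exp n with hQ
  have hfinal := four_mul_four_pow_mul_le hn₁ hbig hD₂
  have hR₀ : 0 ≤ R := Nat.cast_nonneg _
  refine le_of_mul_le_mul_right ?_ hw₀
  set Z : ℝ := Real.exp (-((n : ℝ) ^ (1.92 : ℝ) / 32)) with hZ
  calc (B.ncard : ℝ) * w
      ≤ 4 ^ n * (2 * Real.exp (-((η / 2) ^ 2 * p ^ 2 * L ^ 2 / 8))) := hBw
    _ ≤ 4 ^ n * (2 * Z) := by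
        rw [hZ]; gcongr
    _ = 4 * 4 ^ n * Z * (1 / 2) := by ring
    _ ≤ 4 * 4 ^ n * Z * (R * (w * Q)) := by gcongr
    _ = 4 * 4 ^ n * Z * Q * (R * w) := by ring
    _ ≤ Real.exp (-(n : ℝ)) * (R * w) := by gcongr
    _ = _ := by ring

end Sandwich
end
end

section
/- For all η, ε ∈ (0,1] there is C > 0 such that for every c > 0 there is n₀ ∈ ℕ with the following property for all n ≥ n₀. Let d satisfy C·log n ≤ d ≤ n−1 and dn even, and let m be an integer with ε·d·n ≤ m ≤ dn/2. Let K ~ G_d(n), let E be a uniformly random m-element subset of E(K), and let F = K − E. Then with probability at least 1 − c·n^{−8} the following holds: for every pair of distinct x, y ∈ [n] and every Z ⊆ [n]∖{x,y} with |Z| ≤ 10 such that, in the case d ≥ n − 10³/η, every vertex of Z ∪ {y} is adjacent to x in K, the number of (K̄, K∖F)-alternating x,y-paths of length 4 lies between (1−η)·(2m)²·(n−1−d)²/n³ and (1+η)·(2m)²·(n−1−d)²/n³, where K̄ is the complement of K. (Lemma on concentration for switching paths in the lower part of the sandwich.) -/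
open scoped Classical ENNReal

noncomputable section

namespace Sandwich

variable {n : ℕ}

open Finset in
/-- Double counting of pairs consisting of an `m`-subset and an element outside of it, against
pairs consisting of an `(m+1)`-subset and one of its elements. -/
lemma sum_powersetCard_sdiff {α : Type*} (s : Finset α) (m : ℕ) (h : Finset α → α → ℝ) :
    ∑ E ∈ s.powersetCard m, ∑ f ∈ s \ E, h E f =
      ∑ E ∈ s.powersetCard (m + 1), ∑ f ∈ E, h (E.erase f) f := by
  rw [Finset.sum_sigma', Finset.sum_sigma']
  refine Finset.sum_bij' (fun p _ => ⟨insert p.2 p.1, p.2⟩) (fun p _ => ⟨p.1.erase p.2, p.2⟩)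
    ?_ ?_ ?_ ?_ ?_
  · rintro ⟨E, f⟩ hp
    simp only [mem_sigma, mem_powersetCard, mem_sdiff] at hp ⊢
    obtain ⟨⟨h1, h2⟩, h3, h4⟩ := hp
    refine ⟨⟨insert_subset h3 h1, ?_⟩, mem_insert_self _ _⟩
    rw [card_insert_of_notMem h4, h2]
  · rintro ⟨E, f⟩ hp
    simp only [mem_sigma, mem_powersetCard, mem_sdiff] at hp ⊢
    obtain ⟨⟨h1, h2⟩, h3⟩ := hp
    refine ⟨⟨(erase_subset _ _).trans h1, ?_⟩, h1 h3, notMem_erase _ _⟩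
    rw [card_erase_of_mem h3, h2]; rfl
  · rintro ⟨E, f⟩ hp
    simp only [mem_sigma, mem_powersetCard, mem_sdiff] at hp
    simp [erase_insert hp.2.2]
  · rintro ⟨E, f⟩ hp
    simp only [mem_sigma, mem_powersetCard] at hp
    simp [insert_erase hp.2]
  · rintro ⟨E, f⟩ hp
    simp only [mem_sigma, mem_powersetCard, mem_sdiff] at hp
    simp [erase_insert hp.2.2]

open Finset in
/-- Negative correlation between the product over an `m`-subset and the sum over it. -/
lemma sum_prod_mul_sum_le {α : Type*} (s : Finset α) (a : α → ℝ) (ha : ∀ i, 0 ≤ a i) (m : ℕ)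
    (hm : m ≤ s.card) :
    m * ∑ E ∈ s.powersetCard m, (∏ i ∈ E, a i) * ∑ f ∈ s \ E, a f ≤
      (s.card - m) * ∑ E ∈ s.powersetCard m, (∏ i ∈ E, a i) * ∑ e ∈ E, a e := by
  cases m with
  | zero =>
    simp
  | succ k =>
    have h1 : ((k + 1 : ℕ) : ℝ) * ∑ E ∈ s.powersetCard (k + 1), (∏ i ∈ E, a i) * ∑ f ∈ s \ E, a f
        = ∑ E ∈ s.powersetCard k, ∑ e ∈ s \ E, (∏ i ∈ E, a i) * a e *
            ∑ f ∈ s \ insert e E, a f := by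
      rw [sum_powersetCard_sdiff s k
        (fun E e => (∏ i ∈ E, a i) * a e * ∑ f ∈ s \ insert e E, a f), Finset.mul_sum]
      refine Finset.sum_congr rfl fun E hE => ?_
      rw [← (mem_powersetCard.1 hE).2, ← nsmul_eq_mul, ← Finset.sum_const]
      refine Finset.sum_congr rfl fun e he => ?_
      rw [insert_erase he, prod_erase_mul _ _ he]
    have h2 : ∑ E ∈ s.powersetCard (k + 1), (∏ i ∈ E, a i) * ∑ e ∈ E, a e
        = ∑ E ∈ s.powersetCard k, ∑ e ∈ s \ E, (∏ i ∈ E, a i) * a e * a e := by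
      rw [sum_powersetCard_sdiff s k (fun E e => (∏ i ∈ E, a i) * a e * a e)]
      refine Finset.sum_congr rfl fun E hE => ?_
      rw [Finset.mul_sum]
      refine Finset.sum_congr rfl fun e he => ?_
      rw [prod_erase_mul _ _ he]
    rw [h1, h2, Finset.mul_sum]
    refine Finset.sum_le_sum fun E hE => ?_
    have hP : 0 ≤ ∏ i ∈ E, a i := Finset.prod_nonneg fun i _ => ha i
    have hc : ((s \ E).card : ℝ) = s.card - k := by
      have := (mem_powersetCard.1 hE)
      rw [card_sdiff_of_subset this.1, this.2, Nat.cast_sub (by omega)]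
    have key := sq_sum_le_card_mul_sum_sq (s := s \ E) (f := a)
    have h3 : ∑ e ∈ s \ E, (∏ i ∈ E, a i) * a e * ∑ f ∈ s \ insert e E, a f
        = (∏ i ∈ E, a i) * ((∑ e ∈ s \ E, a e) ^ 2 - ∑ e ∈ s \ E, a e ^ 2) := by
      rw [mul_sub, sq, Finset.sum_mul, Finset.mul_sum, Finset.mul_sum, ← Finset.sum_sub_distrib]
      refine Finset.sum_congr rfl fun e he => ?_
      have : ∑ f ∈ s \ insert e E, a f = ∑ f ∈ s \ E, a f - a e := by
        rw [← Finset.sum_erase_add _ _ he, sdiff_insert]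
        ring
      rw [this]; ring
    have h4 : ∑ e ∈ s \ E, (∏ i ∈ E, a i) * a e * a e
        = (∏ i ∈ E, a i) * ∑ e ∈ s \ E, a e ^ 2 := by
      rw [Finset.mul_sum]
      exact Finset.sum_congr rfl fun e _ => by ring
    rw [h3, h4]
    rw [hc] at key
    push_cast
    nlinarith [mul_le_mul_of_nonneg_left key hP]

open Finset in
/-- A weak form of Maclaurin's inequality for elementary symmetric polynomials. -/
lemma sum_prod_powersetCard_le {α : Type*} (s : Finset α) (a : α → ℝ) (ha : ∀ i, 0 ≤ a i) (m : ℕ)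
    (hm : m ≤ s.card) :
    ∑ E ∈ s.powersetCard m, ∏ i ∈ E, a i ≤
      (s.card.choose m : ℝ) * ((∑ i ∈ s, a i) / s.card) ^ m := by
  induction m with
  | zero => simp
  | succ k ih =>
    have ih := ih (by omega)
    have hS : 0 ≤ ∑ i ∈ s, a i := Finset.sum_nonneg fun i _ => ha i
    have hM : (0 : ℝ) < s.card := by exact_mod_cast (by omega : 0 < s.card)
    have h1 : ((k : ℝ) + 1) * ∑ E ∈ s.powersetCard (k + 1), ∏ i ∈ E, a i
        = ∑ E ∈ s.powersetCard k, (∏ i ∈ E, a i) * ∑ f ∈ s \ E, a f := by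
      simp_rw [Finset.mul_sum]
      rw [sum_powersetCard_sdiff s k (fun E e => (∏ i ∈ E, a i) * a e)]
      refine Finset.sum_congr rfl fun E hE => ?_
      have : ((k : ℝ) + 1) = E.card := by rw [(mem_powersetCard.1 hE).2]; push_cast; ring
      rw [this, ← nsmul_eq_mul, ← Finset.sum_const]
      exact Finset.sum_congr rfl fun e he => (prod_erase_mul _ _ he).symm
    have h2 := sum_prod_mul_sum_le s a ha k (by omega)
    have h3 : ∑ E ∈ s.powersetCard k, (∏ i ∈ E, a i) * ∑ f ∈ s \ E, a f
        + ∑ E ∈ s.powersetCard k, (∏ i ∈ E, a i) * ∑ e ∈ E, a e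
        = (∑ i ∈ s, a i) * ∑ E ∈ s.powersetCard k, ∏ i ∈ E, a i := by
      rw [← Finset.sum_add_distrib, Finset.mul_sum]
      refine Finset.sum_congr rfl fun E hE => ?_
      rw [← mul_add, Finset.sum_sdiff (mem_powersetCard.1 hE).1, mul_comm]
    have hk : (0 : ℝ) ≤ s.card - k := by
      have : ((k + 1 : ℕ) : ℝ) ≤ s.card := by exact_mod_cast hm
      push_cast at this; linarith
    have hch : ((k : ℝ) + 1) * (s.card.choose (k + 1) : ℝ) = (s.card - k) * s.card.choose k := by
      have := Nat.choose_succ_right_eq s.card k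
      have h := congrArg (fun z : ℕ => (z : ℝ)) this
      simp only [Nat.cast_mul, Nat.cast_sub (show k ≤ s.card by omega)] at h
      push_cast at h; linarith
    set F := ∑ E ∈ s.powersetCard k, ∏ i ∈ E, a i with hF
    set X := ∑ E ∈ s.powersetCard k, (∏ i ∈ E, a i) * ∑ f ∈ s \ E, a f with hX
    set Y := ∑ E ∈ s.powersetCard k, (∏ i ∈ E, a i) * ∑ e ∈ E, a e with hY
    set S := ∑ i ∈ s, a i with hSdef
    have h4 : (s.card : ℝ) * X ≤ (s.card - k) * (S * F) := by
      rw [← h3]; nlinarith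
    have hk1 : (0 : ℝ) < (k : ℝ) + 1 := by positivity
    refine le_of_mul_le_mul_left ?_ (mul_pos hM hk1)
    calc (s.card : ℝ) * (k + 1) * ∑ E ∈ s.powersetCard (k + 1), ∏ i ∈ E, a i
        = s.card * X := by rw [mul_assoc, h1]
      _ ≤ (s.card - k) * (S * F) := h4
      _ ≤ (s.card - k) * (S * ((s.card.choose k : ℝ) * (S / s.card) ^ k)) := by gcongr
      _ = s.card * (((s.card - k) * (s.card.choose k : ℝ)) * (S / s.card) ^ (k + 1)) := by
          rw [pow_succ]; field_simp
      _ = _ := by rw [← hch]; ring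

/-- The moment generating function of a sum over a uniformly random `m`-subset. -/
lemma sum_exp_powersetCard_le {α : Type*} (s : Finset α) (w : α → ℝ) (m : ℕ) (hm : m ≤ s.card) :
    ∑ E ∈ s.powersetCard m, Real.exp (∑ i ∈ E, w i) ≤
      (s.card.choose m : ℝ) * Real.exp ((m : ℝ) / s.card * ∑ i ∈ s, (Real.exp (w i) - 1)) := by
  rcases Nat.eq_zero_or_pos s.card with h0 | h0
  · have hm0 : m = 0 := by omega
    subst hm0
    simp
  have hM : (0 : ℝ) < s.card := by exact_mod_cast h0
  simp_rw [Real.exp_sum]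
  refine (sum_prod_powersetCard_le s (fun i => Real.exp (w i)) (fun i => (Real.exp_pos _).le) m
    hm).trans ?_
  refine mul_le_mul_of_nonneg_left ?_ (Nat.cast_nonneg _)
  have h1 : (∑ i ∈ s, Real.exp (w i)) / s.card ≤
      Real.exp ((∑ i ∈ s, (Real.exp (w i) - 1)) / s.card) := by
    have := Real.add_one_le_exp ((∑ i ∈ s, (Real.exp (w i) - 1)) / s.card)
    refine le_trans (le_of_eq ?_) this
    rw [Finset.sum_sub_distrib]
    simp only [Finset.sum_const, nsmul_eq_mul, mul_one]
    field_simp; ring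
  calc _ ≤ (Real.exp ((∑ i ∈ s, (Real.exp (w i) - 1)) / s.card)) ^ m :=
        pow_le_pow_left₀ (div_nonneg (Finset.sum_nonneg fun i _ => (Real.exp_pos _).le) hM.le) h1 m
    _ = _ := by
        rw [← Real.exp_nat_mul]; congr 1; ring

/-- A Chernoff bound for sums of weights in `[0,1]` over a uniformly random `m`-subset. -/
lemma chernoff_powersetCard {α : Type*} (s : Finset α) (w : α → ℝ) (m : ℕ) (hm : m ≤ s.card)
    (hw0 : ∀ i ∈ s, 0 ≤ w i) (hw1 : ∀ i ∈ s, w i ≤ 1) (μ μ' t : ℝ)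
    (hμ : μ = (m : ℝ) / s.card * ∑ i ∈ s, w i) (hμ' : μ ≤ μ') (hpos : 0 < μ') (ht0 : 0 ≤ t)
    (ht : t ≤ 2 * μ') :
    (((s.powersetCard m).filter (fun E => t ≤ |∑ i ∈ E, w i - μ|)).card : ℝ) ≤
      2 * Real.exp (-(t ^ 2 / (4 * μ'))) * s.card.choose m := by
  have hq : (0 : ℝ) ≤ (m : ℝ) / s.card := by positivity
  set l : ℝ := t / (2 * μ') with hl
  have hl0 : 0 ≤ l := by positivity
  have hl1 : l ≤ 1 := by rw [hl, div_le_one (by positivity)]; exact ht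
  have main : ∀ σ : ℝ, |σ| = 1 →
      (((s.powersetCard m).filter (fun E => t ≤ σ * (∑ i ∈ E, w i - μ))).card : ℝ) ≤
        Real.exp (-(t ^ 2 / (4 * μ'))) * s.card.choose m := by
    intro σ hσ
    have hσ2 : σ ^ 2 = 1 := by rw [← sq_abs, hσ, one_pow]
    have h1 := sum_exp_powersetCard_le s (fun i => σ * l * w i) m hm
    have h2 : (m : ℝ) / s.card * ∑ i ∈ s, (Real.exp (σ * l * w i) - 1) ≤
        σ * l * μ + l ^ 2 * μ' := by
      have : ∑ i ∈ s, (Real.exp (σ * l * w i) - 1) ≤ ∑ i ∈ s, (σ * l + l ^ 2) * w i := by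
        refine Finset.sum_le_sum fun i hi => ?_
        have a0 := hw0 i hi
        have a1 := hw1 i hi
        have habs : |σ * l * w i| ≤ 1 := by
          rw [abs_mul, abs_mul, hσ, abs_of_nonneg hl0, abs_of_nonneg a0, one_mul]
          exact mul_le_one₀ hl1 a0 a1
        have := (abs_le.1 (Real.abs_exp_sub_one_sub_id_le habs)).2
        have e : (σ * l * w i) ^ 2 = l ^ 2 * (w i) ^ 2 := by
          rw [mul_pow, mul_pow, hσ2, one_mul]
        have : (w i) ^ 2 ≤ w i := by nlinarith
        have := mul_le_mul_of_nonneg_left this (sq_nonneg l)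
        nlinarith
      calc _ ≤ (m : ℝ) / s.card * ∑ i ∈ s, (σ * l + l ^ 2) * w i :=
            mul_le_mul_of_nonneg_left this hq
        _ = σ * l * μ + l ^ 2 * μ := by rw [← Finset.mul_sum, hμ]; ring
        _ ≤ _ := by gcongr
    have h3 : (((s.powersetCard m).filter (fun E => t ≤ σ * (∑ i ∈ E, w i - μ))).card : ℝ) *
        Real.exp (l * t + σ * l * μ) ≤
          ∑ E ∈ s.powersetCard m, Real.exp (∑ i ∈ E, σ * l * w i) := by
      rw [← nsmul_eq_mul, ← Finset.sum_const]
      calc _ ≤ ∑ E ∈ (s.powersetCard m).filter (fun E => t ≤ σ * (∑ i ∈ E, w i - μ)),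
              Real.exp (∑ i ∈ E, σ * l * w i) := by
            refine Finset.sum_le_sum fun E hE => Real.exp_le_exp.2 ?_
            have := (Finset.mem_filter.1 hE).2
            rw [← Finset.mul_sum]
            nlinarith [mul_le_mul_of_nonneg_left this hl0]
        _ ≤ _ := Finset.sum_le_sum_of_subset_of_nonneg (Finset.filter_subset _ _)
            fun _ _ _ => (Real.exp_pos _).le
    have h4 := h3.trans (h1.trans (mul_le_mul_of_nonneg_left (Real.exp_le_exp.2 h2)
      (Nat.cast_nonneg _)))
    have hE : Real.exp (-(t ^ 2 / (4 * μ'))) * Real.exp (l * t + σ * l * μ) =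
        Real.exp (σ * l * μ + l ^ 2 * μ') := by
      rw [← Real.exp_add]; congr 1; rw [hl]; field_simp; ring
    refine le_of_mul_le_mul_right ?_ (Real.exp_pos (l * t + σ * l * μ))
    calc _ ≤ _ := h4
      _ = _ := by rw [← hE]; ring
  have hsub : (s.powersetCard m).filter (fun E => t ≤ |∑ i ∈ E, w i - μ|) ⊆
      (s.powersetCard m).filter (fun E => t ≤ 1 * (∑ i ∈ E, w i - μ)) ∪
      (s.powersetCard m).filter (fun E => t ≤ (-1) * (∑ i ∈ E, w i - μ)) := by
    intro E hE
    rw [Finset.mem_filter] at hE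
    rw [Finset.mem_union, Finset.mem_filter, Finset.mem_filter]
    rcases le_abs.1 hE.2 with h | h
    · exact Or.inl ⟨hE.1, by linarith⟩
    · exact Or.inr ⟨hE.1, by linarith⟩
  have hc := (Finset.card_le_card hsub).trans (Finset.card_union_le _ _)
  have hc' : (((s.powersetCard m).filter (fun E => t ≤ |∑ i ∈ E, w i - μ|)).card : ℝ) ≤
      ((s.powersetCard m).filter (fun E => t ≤ 1 * (∑ i ∈ E, w i - μ))).card +
      ((s.powersetCard m).filter (fun E => t ≤ (-1) * (∑ i ∈ E, w i - μ))).card := by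
    exact_mod_cast hc
  have ha := main 1 (by simp)
  have hb := main (-1) (by simp)
  linarith

open Finset in
/-- The sum over `e ∈ E` of the number of `i ∈ I` with `f i = e`. -/
lemma sum_card_fiber {α ι : Type*} [DecidableEq α] (I : Finset ι) (f : ι → α) (E : Finset α) :
    ∑ e ∈ E, ((I.filter (fun i => f i = e)).card : ℝ) = ((I.filter (fun i => f i ∈ E)).card : ℝ) := by
  rw [Finset.card_eq_sum_card_fiberwise (f := f) (t := E) (s := I.filter (fun i => f i ∈ E))]
  · push_cast
    refine Finset.sum_congr rfl fun e he => ?_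
    congr 2
    ext i
    simp only [mem_filter]
    constructor
    · rintro ⟨h1, h2⟩; exact ⟨⟨h1, h2 ▸ he⟩, h2⟩
    · rintro ⟨⟨h1, _⟩, h2⟩; exact ⟨h1, h2⟩
  · intro i hi
    simp only [coe_filter, Set.mem_ofPred_eq] at hi
    exact hi.2

open Finset in
/-- Relative concentration of the number of indices hit by a uniformly random `m`-subset. -/
lemma card_fiber_concentration {α ι : Type*} [DecidableEq α] (Ω : Finset α) (I : Finset ι) (f : ι → α)
    (hf : ∀ i ∈ I, f i ∈ Ω) (L : ℝ) (hL : 0 < L)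
    (hfib : ∀ e, ((I.filter (fun i => f i = e)).card : ℝ) ≤ L) (m : ℕ) (hm : m ≤ Ω.card)
    (q : ℝ) (hq : q = (m : ℝ) / Ω.card) (hpos : 0 < q * I.card) (τ : ℝ) (hτ : 0 ≤ τ)
    (hτ1 : τ ≤ 1) :
    (((Ω.powersetCard m).filter (fun E => τ * (q * I.card) ≤
        |((I.filter (fun i => f i ∈ E)).card : ℝ) - q * I.card|)).card : ℝ) ≤
      2 * Real.exp (-(τ ^ 2 * (q * I.card) / (4 * L))) * Ω.card.choose m := by
  have hI : ∑ e ∈ Ω, ((I.filter (fun i => f i = e)).card : ℝ) = I.card := by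
    rw [sum_card_fiber, Finset.filter_true_of_mem hf]
  have h := chernoff_powersetCard Ω (fun e => ((I.filter (fun i => f i = e)).card : ℝ) / L) m hm
    (fun e _ => by positivity) (fun e _ => by rw [div_le_one hL]; exact hfib e)
    (q * I.card / L) (q * I.card / L) (τ * (q * I.card / L))
    (by rw [← Finset.sum_div, hI, hq]; ring) le_rfl (by positivity) (by positivity)
    (by nlinarith [div_pos hpos hL])
  have e1 : (τ * (q * I.card / L)) ^ 2 / (4 * (q * I.card / L)) =
      τ ^ 2 * (q * I.card) / (4 * L) := by
    have := hpos.ne'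
    generalize q * (I.card : ℝ) = z at *
    field_simp
  rw [e1] at h
  refine le_trans (le_of_eq ?_) h
  congr 2
  ext E
  simp only [mem_filter]
  refine and_congr_right fun _ => ?_
  rw [← Finset.sum_div, sum_card_fiber, ← sub_div, abs_div, abs_of_pos hL, ← mul_div_assoc,
    div_le_div_iff_of_pos_right hL]

open Finset in
/-- The number of `m`-subsets of `Ω` with prescribed trace on `Ω₁`. -/
lemma card_fiber_inter {α : Type*} [DecidableEq α] (Ω Ω₁ B : Finset α) (m : ℕ)
    (P : Finset α → Prop) (hΩ : Ω₁ ⊆ Ω) (hB : B ⊆ Ω₁) (hBm : B.card ≤ m) :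
    ((Ω.powersetCard m).filter (fun E => E ∩ Ω₁ = B ∧ P (E \ Ω₁))).card =
      (((Ω \ Ω₁).powersetCard (m - B.card)).filter P).card := by
  have key : ∀ E : Finset α, E ∩ Ω₁ = B → E = B ∪ (E \ Ω₁) := by
    intro E h; rw [← h, union_comm, sdiff_union_inter]
  refine Finset.card_bij' (fun E _ => E \ Ω₁) (fun E _ => B ∪ E) ?_ ?_ ?_ ?_
  · intro E hE
    simp only [mem_filter, mem_powersetCard] at hE ⊢
    obtain ⟨⟨h1, h2⟩, h3, h4⟩ := hE
    refine ⟨⟨sdiff_subset_sdiff h1 subset_rfl, ?_⟩, h4⟩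
    rw [← h3, ← h2, card_sdiff, inter_comm]
  · intro E hE
    simp only [mem_filter, mem_powersetCard] at hE ⊢
    obtain ⟨⟨h1, h2⟩, h3⟩ := hE
    have hd : Disjoint E Ω₁ := (subset_sdiff.1 h1).2
    have hd' : Disjoint B E := (hd.mono_right hB).symm
    have e2 : (B ∪ E) \ Ω₁ = E := by
      rw [union_sdiff_distrib, sdiff_eq_empty_iff_subset.2 hB, empty_union,
        sdiff_eq_self_of_disjoint hd]
    refine ⟨⟨union_subset (hB.trans hΩ) (subset_sdiff.1 h1).1, ?_⟩, ?_, ?_⟩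
    · rw [card_union_of_disjoint hd', h2]; omega
    · rw [union_inter_distrib_right, inter_eq_left.2 hB, disjoint_iff_inter_eq_empty.1 hd,
        union_empty]
    · rw [e2]; exact h3
  · intro E hE
    simp only [mem_filter] at hE
    exact (key E hE.2.1).symm
  · intro E hE
    simp only [mem_filter, mem_powersetCard] at hE
    have hd : Disjoint E Ω₁ := (subset_sdiff.1 hE.1.1).2
    change (B ∪ E) \ Ω₁ = E
    rw [union_sdiff_distrib, sdiff_eq_empty_iff_subset.2 hB, empty_union,
        sdiff_eq_self_of_disjoint hd]

lemma abs_sub_le_of_two_stage {τ Q Y x : ℝ} (hτ : 0 < τ) (hτ1 : τ ≤ 1 / 2) (hQ : 0 < Q)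
    (hlow : (1 - τ) ^ 2 * Q ≤ Y) (hup : Y ≤ (1 + τ) ^ 2 * Q) (h : |x - Y| < τ * Y) :
    |x - Q| ≤ 7 * τ * Q := by
  obtain ⟨l1, l2⟩ := abs_lt.1 h
  refine abs_le.2 ⟨?_, ?_⟩
  · have h1 := mul_le_mul_of_nonneg_left hlow (by linarith : 0 ≤ 1 - τ)
    have h7 : 1 - 7 * τ ≤ (1 - τ) ^ 3 := by nlinarith [mul_pos hτ hτ, pow_pos hτ 3]
    have := mul_le_mul_of_nonneg_right h7 hQ.le
    nlinarith
  · have h1 := mul_le_mul_of_nonneg_left hup (by linarith : 0 ≤ 1 + τ)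
    have h7 : (1 + τ) ^ 3 ≤ 1 + 7 * τ := by nlinarith [mul_pos hτ hτ, pow_pos hτ 3]
    have := mul_le_mul_of_nonneg_right h7 hQ.le
    nlinarith

lemma exponent_le_of_two_stage {τ Q Y L : ℝ} (hτ1 : τ ≤ 1 / 2) (hQ : 0 < Q) (hL : 0 < L)
    (hlow : (1 - τ) ^ 2 * Q ≤ Y) : τ ^ 2 * Q / (16 * L) ≤ τ ^ 2 * Y / (4 * L) := by
  rw [div_le_div_iff₀ (by positivity) (by positivity)]
  have h8 : (1 : ℝ) / 4 ≤ (1 - τ) ^ 2 := by nlinarith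
  have h9 : 1 / 4 * Q ≤ Y := (mul_le_mul_of_nonneg_right h8 hQ.le).trans hlow
  have h10 : 0 ≤ τ ^ 2 * L := by positivity
  nlinarith [mul_le_mul_of_nonneg_left h9 h10]

open Finset in
set_option maxHeartbeats 1000000 in
/-- Concentration of a bilinear count over a uniformly random `m`-subset. -/
lemma bilinear_concentration {α ι : Type*} [DecidableEq α] (Ω Ω₁ : Finset α) (hΩ : Ω₁ ⊆ Ω) (I : Finset ι)
    (a b : ι → α) (ha : ∀ i ∈ I, a i ∈ Ω \ Ω₁) (hb : ∀ i ∈ I, b i ∈ Ω₁) (L₁ L₂ : ℝ)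
    (hL₁ : 0 < L₁) (hL₂ : 0 < L₂)
    (hfb : ∀ e, ((I.filter (fun i => b i = e)).card : ℝ) ≤ L₁)
    (hfa : ∀ e, ((I.filter (fun i => a i = e)).card : ℝ) ≤ L₂)
    (m : ℕ) (hm : m ≤ Ω.card) (hm0 : 0 < m) (q : ℝ) (hq : q = (m : ℝ) / Ω.card)
    (hI : 0 < I.card) (τ : ℝ) (hτ : 0 < τ) (hτ1 : τ ≤ 1 / 2)
    (h1 : (Ω₁.card : ℝ) ≤ τ * m) (h2 : (Ω.card : ℝ) ≤ (1 + τ) * (Ω.card - Ω₁.card)) :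
    (((Ω.powersetCard m).filter (fun E => ¬ |((I.filter (fun i => a i ∈ E ∧ b i ∈ E)).card : ℝ)
        - q ^ 2 * I.card| ≤ 7 * τ * (q ^ 2 * I.card))).card : ℝ) ≤
      (2 * Real.exp (-(τ ^ 2 * (q * I.card) / (4 * L₁))) +
        2 * Real.exp (-(τ ^ 2 * (q ^ 2 * I.card) / (16 * L₂)))) * Ω.card.choose m := by
  have hm0' : (0 : ℝ) < m := by exact_mod_cast hm0
  have hM : (0 : ℝ) < Ω.card := by exact_mod_cast hm0.trans_le hm
  have hI' : (0 : ℝ) < I.card := by exact_mod_cast hI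
  have hq0 : 0 < q := by rw [hq]; positivity
  set X₁ : Finset α → ℝ := fun E => ((I.filter (fun i => b i ∈ E)).card : ℝ) with hX₁
  set X : Finset α → ℝ := fun E => ((I.filter (fun i => a i ∈ E ∧ b i ∈ E)).card : ℝ) with hX
  set bad : Finset α → Prop := fun E => ¬ |X E - q ^ 2 * I.card| ≤ 7 * τ * (q ^ 2 * I.card)
    with hbad
  set ok₁ : Finset α → Prop := fun E => |X₁ E - q * I.card| < τ * (q * I.card) with hok₁
  have hsplit : (Ω.powersetCard m).filter bad ⊆
      (Ω.powersetCard m).filter (fun E => τ * (q * I.card) ≤ |X₁ E - q * I.card|) ∪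
      (Ω.powersetCard m).filter (fun E => ok₁ E ∧ bad E) := by
    intro E hE
    simp only [mem_union, mem_filter] at hE ⊢
    rcases le_or_gt (τ * (q * I.card)) |X₁ E - q * I.card| with h | h
    · exact Or.inl ⟨hE.1, h⟩
    · exact Or.inr ⟨hE.1, h, hE.2⟩
  have hc : (((Ω.powersetCard m).filter bad).card : ℝ) ≤
      ((Ω.powersetCard m).filter (fun E => τ * (q * I.card) ≤ |X₁ E - q * I.card|)).card +
      ((Ω.powersetCard m).filter (fun E => ok₁ E ∧ bad E)).card := by
    exact_mod_cast (card_le_card hsplit).trans (card_union_le _ _)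
  have hA := card_fiber_concentration Ω I b (fun i hi => hΩ (hb i hi)) L₁ hL₁ hfb m hm q hq
    (mul_pos hq0 hI') τ hτ.le (by linarith)
  have hdR : ((Ω \ Ω₁).card : ℝ) = Ω.card - Ω₁.card := by
    rw [card_sdiff_of_subset hΩ, Nat.cast_sub (card_le_card hΩ)]
  have hdpos : (0 : ℝ) < Ω.card - Ω₁.card := by
    by_contra hcon; nlinarith
  -- the fibre estimate
  have hfib : ∀ B ∈ Ω₁.powerset,
      (((Ω.powersetCard m).filter (fun E => ok₁ E ∧ bad E)).filter (fun E => E ∩ Ω₁ = B)).card ≤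
      2 * Real.exp (-(τ ^ 2 * (q ^ 2 * I.card) / (16 * L₂))) *
        ((Ω.powersetCard m).filter (fun E => E ∩ Ω₁ = B)).card := by
    intro B hB
    have hB := mem_powerset.1 hB
    rcases Finset.eq_empty_or_nonempty
      (((Ω.powersetCard m).filter (fun E => ok₁ E ∧ bad E)).filter (fun E => E ∩ Ω₁ = B))
      with he | ⟨E₀, hE₀⟩
    · rw [he]; simp; positivity
    simp only [mem_filter, mem_powersetCard] at hE₀
    obtain ⟨⟨⟨hE₀s, hE₀c⟩, hE₀ok, hE₀bad⟩, hE₀B⟩ := hE₀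
    have hBm : B.card ≤ m := by
      rw [← hE₀B, ← hE₀c]; exact card_le_card inter_subset_left
    have hB1 : (B.card : ℝ) ≤ Ω₁.card := by exact_mod_cast card_le_card hB
    have hm' : m - B.card ≤ (Ω \ Ω₁).card := by
      have : E₀ \ Ω₁ ⊆ Ω \ Ω₁ := sdiff_subset_sdiff hE₀s subset_rfl
      have h := card_le_card this
      rw [card_sdiff, hE₀c, inter_comm, hE₀B] at h
      exact h
    -- reduced index set
    set J := I.filter (fun i => b i ∈ B) with hJ
    have hX₁eq : ∀ E : Finset α, E ∩ Ω₁ = B → X₁ E = J.card := by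
      intro E hE
      simp only [hX₁, hJ]
      congr 2
      refine Finset.filter_congr fun i hi => ?_
      rw [← hE, mem_inter]
      simp [hb i hi]
    have hXeq : ∀ E : Finset α, E ∩ Ω₁ = B →
        X E = ((J.filter (fun i => a i ∈ E \ Ω₁)).card : ℝ) := by
      intro E hE
      simp only [hX, hJ]
      rw [Finset.filter_filter]
      congr 2
      refine Finset.filter_congr fun i hi => ?_
      rw [← hE, mem_inter, mem_sdiff]
      have := (mem_sdiff.1 (ha i hi)).2
      have := hb i hi
      tauto
    have hJok : |(J.card : ℝ) - q * I.card| < τ * (q * I.card) := by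
      rw [← hX₁eq E₀ hE₀B]; exact hE₀ok
    obtain ⟨hJ1, hJ2⟩ := abs_lt.1 hJok
    set q' : ℝ := ((m - B.card : ℕ) : ℝ) / (Ω \ Ω₁).card with hq'
    have hmB : ((m - B.card : ℕ) : ℝ) = m - B.card := by rw [Nat.cast_sub hBm]
    have hq'1 : (1 - τ) * q ≤ q' := by
      rw [hq', hmB, hdR, hq, ← mul_div_assoc]
      have : (0 : ℝ) ≤ Ω₁.card := Nat.cast_nonneg _
      refine div_le_div₀ ?_ ?_ hdpos ?_ <;> linarith
    have hq'2 : q' ≤ (1 + τ) * q := by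
      rw [hq', hmB, hdR, hq, ← mul_div_assoc, div_le_div_iff₀ hdpos hM]
      have : (0 : ℝ) ≤ B.card := Nat.cast_nonneg _
      nlinarith
    have hJpos : 0 < q' * J.card := by
      have : 0 < q * I.card := by positivity
      refine mul_pos (lt_of_lt_of_le (mul_pos (by linarith) hq0) hq'1) (by nlinarith)
    have hcon := card_fiber_concentration (Ω \ Ω₁) J a
      (fun i hi => ha i (mem_filter.1 hi).1) L₂ hL₂
      (fun e => le_trans (by
        exact_mod_cast card_le_card (filter_subset_filter _ (filter_subset _ _))) (hfa e))
      (m - B.card) hm' q' hq' hJpos τ hτ.le (by linarith)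
    have hqI : 0 < q * I.card := by positivity
    have hlow : (1 - τ) ^ 2 * (q ^ 2 * I.card) ≤ q' * J.card := by
      have h3 : (1 - τ) * (q * I.card) ≤ J.card := by linarith
      have h4 : 0 ≤ (1 - τ) * (q * I.card) := mul_nonneg (by linarith) hqI.le
      have h5 : 0 ≤ (1 - τ) * q := mul_nonneg (by linarith) hq0.le
      calc _ = ((1 - τ) * q) * ((1 - τ) * (q * I.card)) := by ring
        _ ≤ _ := mul_le_mul hq'1 h3 h4 (h5.trans hq'1)
    have hup : q' * J.card ≤ (1 + τ) ^ 2 * (q ^ 2 * I.card) := by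
      have h3 : (J.card : ℝ) ≤ (1 + τ) * (q * I.card) := by linarith
      calc _ ≤ ((1 + τ) * q) * ((1 + τ) * (q * I.card)) :=
            mul_le_mul hq'2 h3 (Nat.cast_nonneg _) (by positivity)
        _ = _ := by ring
    have hqq : 0 < q ^ 2 * I.card := by positivity
    -- bound on the bad part of the fibre
    have step1 : (((Ω.powersetCard m).filter (fun E => ok₁ E ∧ bad E)).filter
        (fun E => E ∩ Ω₁ = B)).card ≤ ((Ω.powersetCard m).filter (fun E => E ∩ Ω₁ = B ∧
          τ * (q' * J.card) ≤
            |((J.filter (fun i => a i ∈ E \ Ω₁)).card : ℝ) - q' * J.card|)).card := by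
      refine card_le_card fun E hE => ?_
      simp only [mem_filter] at hE ⊢
      obtain ⟨⟨hE1, _, hE2⟩, hE3⟩ := hE
      refine ⟨hE1, hE3, ?_⟩
      by_contra hlt
      push Not at hlt
      rw [← hXeq E hE3] at hlt
      exact hE2 (abs_sub_le_of_two_stage hτ hτ1 hqq hlow hup hlt)
    have step2 := card_fiber_inter Ω Ω₁ B m (fun E' => τ * (q' * J.card) ≤
            |((J.filter (fun i => a i ∈ E')).card : ℝ) - q' * J.card|) hΩ hB hBm
    have step3 : ((Ω.powersetCard m).filter (fun E => E ∩ Ω₁ = B)).card =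
        (Ω \ Ω₁).card.choose (m - B.card) := by
      have := card_fiber_inter Ω Ω₁ B m (fun _ => True) hΩ hB hBm
      simpa using this
    rw [step3]
    have step4 : 2 * Real.exp (-(τ ^ 2 * (q' * J.card) / (4 * L₂))) ≤
        2 * Real.exp (-(τ ^ 2 * (q ^ 2 * I.card) / (16 * L₂))) := by
      refine mul_le_mul_of_nonneg_left (Real.exp_le_exp.2 (neg_le_neg ?_)) (by norm_num)
      exact exponent_le_of_two_stage hτ1 hqq hL₂ hlow
    calc _ ≤ _ := Nat.cast_le.2 step1
      _ = _ := congrArg _ step2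
      _ ≤ _ := hcon
      _ ≤ _ := mul_le_mul_of_nonneg_right step4 (Nat.cast_nonneg _)
  have hBsum : (((Ω.powersetCard m).filter (fun E => ok₁ E ∧ bad E)).card : ℝ) ≤
      2 * Real.exp (-(τ ^ 2 * (q ^ 2 * I.card) / (16 * L₂))) * Ω.card.choose m := by
    rw [card_eq_sum_card_fiberwise (f := fun E => E ∩ Ω₁) (t := Ω₁.powerset)
      (fun E _ => by simp), ← card_powersetCard m Ω,
      card_eq_sum_card_fiberwise (s := Ω.powersetCard m) (f := fun E => E ∩ Ω₁)
      (t := Ω₁.powerset) (fun E _ => by simp)]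
    push_cast
    rw [Finset.mul_sum]
    exact Finset.sum_le_sum hfib
  rw [add_mul]
  linarith

/-- The set of all unordered pairs of distinct vertices. -/
def allPairs (n : ℕ) : Finset (Sym2 (Fin n)) := Finset.univ.filter (fun e => ¬ e.IsDiag)

/-- The degree of `z` in the graph with edge set `E`. -/
def degE (E : Finset (Sym2 (Fin n))) (z : Fin n) : ℕ := (E.filter (fun e => z ∈ e)).card

/-- The number of ordered pairs in `S × T` forming an edge of `E`. -/
def cutE (E : Finset (Sym2 (Fin n))) (S T : Finset (Fin n)) : ℕ :=
  ((S ×ˢ T).filter (fun p => s(p.1, p.2) ∈ E)).card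

lemma mem_allPairs {u v : Fin n} : s(u, v) ∈ allPairs n ↔ u ≠ v := by
  simp [allPairs]

lemma card_allPairs (n : ℕ) : (allPairs n).card = n.choose 2 := by
  have := Sym2.card_subtype_not_diag (α := Fin n)
  rw [Fintype.card_fin] at this
  rw [← this, Fintype.card_subtype, allPairs]

lemma ne_of_mem_edges {E : Finset (Sym2 (Fin n))} (hE : E ⊆ allPairs n) {u v : Fin n}
    (h : s(u, v) ∈ E) : u ≠ v := mem_allPairs.1 (hE h)

open Finset in
lemma degE_eq_card_neighbors (E : Finset (Sym2 (Fin n))) (z : Fin n) :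
    degE E z = (univ.filter (fun w => s(z, w) ∈ E)).card := by
  symm
  unfold degE
  refine Finset.card_bij (fun w _ => s(z, w)) ?_ ?_ ?_
  · intro w hw
    simp only [mem_filter, mem_univ, true_and] at hw ⊢
    exact ⟨hw, Sym2.mem_mk_left _ _⟩
  · intro w _ w' _ h
    exact Sym2.congr_right.1 h
  · intro e he
    simp only [mem_filter, mem_univ, true_and] at he ⊢
    obtain ⟨w, rfl⟩ := Sym2.mem_iff_exists.1 he.2
    exact ⟨w, he.1, rfl⟩

open Finset in
lemma sum_degE {E : Finset (Sym2 (Fin n))} (hE : E ⊆ allPairs n) :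
    ∑ z, degE E z = 2 * E.card := by
  unfold degE
  simp_rw [Finset.card_filter]
  rw [Finset.sum_comm, mul_comm, ← smul_eq_mul, ← Finset.sum_const]
  refine Finset.sum_congr rfl fun e he => ?_
  have hd : ¬ e.IsDiag := (mem_filter.1 (hE he)).2
  rw [← Finset.card_filter]
  induction e with
  | h u v =>
    have huv : u ≠ v := by simpa using hd
    have : univ.filter (fun z => z ∈ s(u, v)) = {u, v} := by
      ext z; simp
    rw [this, card_pair huv]

open Finset in
lemma exists_edge_switch {E : Finset (Sym2 (Fin n))} (hE : E ⊆ allPairs n) {u v : Fin n}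
    (h : degE E v < degE E u) : ∃ w, w ≠ v ∧ s(u, w) ∈ E ∧ s(v, w) ∉ E := by
  by_contra hcon
  push Not at hcon
  rw [degE_eq_card_neighbors, degE_eq_card_neighbors] at h
  set Nu := univ.filter (fun w => s(u, w) ∈ E) with hNu
  set Nv := univ.filter (fun w => s(v, w) ∈ E) with hNv
  by_cases huv : s(u, v) ∈ E
  · have hsub : insert u (Nu.erase v) ⊆ insert u Nv := by
      intro w hw
      rcases mem_insert.1 hw with rfl | hw
      · exact mem_insert_self _ _
      · refine mem_insert_of_mem ?_
        rw [mem_erase, hNu, mem_filter] at hw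
        rw [hNv, mem_filter]
        exact ⟨mem_univ _, hcon w hw.1 hw.2.2⟩
    have huNv : u ∈ Nv := by
      rw [hNv, mem_filter, Sym2.eq_swap]; exact ⟨mem_univ _, huv⟩
    have huu : u ∉ Nu.erase v := fun h =>
      ne_of_mem_edges hE (mem_filter.1 (mem_of_mem_erase h)).2 rfl
    have hvN : v ∈ Nu := mem_filter.2 ⟨mem_univ _, huv⟩
    have hc := card_le_card hsub
    rw [card_insert_of_notMem huu, card_erase_of_mem hvN, insert_eq_of_mem huNv] at hc
    omega
  · have : Nu ⊆ Nv := by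
      intro w hw
      have hw' := (mem_filter.1 hw).2
      refine mem_filter.2 ⟨mem_univ _, hcon w (fun hwv => huv (hwv ▸ hw')) hw'⟩
    exact absurd (card_le_card this) (by omega)

open Finset in
lemma degE_switch {E : Finset (Sym2 (Fin n))} {u v w : Fin n} (huw : s(u, w) ∈ E)
    (hvw : s(v, w) ∉ E) (huv : u ≠ v) (hu : u ≠ w) (hv : w ≠ v) (z : Fin n) :
    degE (insert s(v, w) (E.erase s(u, w))) z + (if z = u then 1 else 0) =
      degE E z + (if z = v then 1 else 0) := by
  unfold degE
  rw [filter_insert, filter_erase]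
  have hn : s(v, w) ∉ (E.filter (fun e => z ∈ e)).erase s(u, w) :=
    fun h => hvw (mem_filter.1 (mem_of_mem_erase h)).1
  by_cases hzw : z = w
  · subst hzw
    have h1 : s(u, z) ∈ E.filter (fun e => z ∈ e) := mem_filter.2 ⟨huw, Sym2.mem_mk_right _ _⟩
    have := card_pos.2 ⟨_, h1⟩
    rw [if_pos (Sym2.mem_mk_right _ _), card_insert_of_notMem hn, card_erase_of_mem h1,
      if_neg hu.symm, if_neg hv]
    omega
  · by_cases hzu : z = u
    · subst hzu
      have h1 : s(z, w) ∈ E.filter (fun e => z ∈ e) := mem_filter.2 ⟨huw, Sym2.mem_mk_left _ _⟩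
      have := card_pos.2 ⟨_, h1⟩
      rw [if_neg (by simp [huv, hzw]), card_erase_of_mem h1, if_pos rfl, if_neg huv]
      omega
    · have h1 : s(u, w) ∉ E.filter (fun e => z ∈ e) := by
        simp [hzu, hzw]
      rw [erase_eq_of_notMem h1] at hn ⊢
      by_cases hzv : z = v
      · subst hzv
        rw [if_pos (Sym2.mem_mk_left _ _), card_insert_of_notMem hn, if_neg hzu, if_pos rfl]
      · rw [if_neg (by simp [hzv, hzw]), if_neg hzu, if_neg hzv]

open Finset in
/-- A graph with `dn/2` edges and total degree excess `k` over `d` can be made `d`-regular by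
changing at most `2k` edges. -/
lemma exists_regular_close (d k : ℕ) : ∀ E : Finset (Sym2 (Fin n)), E ⊆ allPairs n →
    2 * E.card = d * n → ∑ z, (degE E z - d) = k →
    ∃ E' : Finset (Sym2 (Fin n)), E' ⊆ allPairs n ∧ 2 * E'.card = d * n ∧ (∀ z, degE E' z = d) ∧
      (symmDiff E E').card ≤ 2 * k := by
  induction k with
  | zero =>
    intro E hE hc hk
    refine ⟨E, hE, hc, ?_, by simp⟩
    have hle : ∀ z ∈ univ, degE E z ≤ d := fun z hz => by
      have := (Finset.sum_eq_zero_iff.1 hk) z hz; omega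
    have hs : ∑ z, degE E z = ∑ _z : Fin n, d := by
      rw [sum_degE hE, hc]; simp [mul_comm]
    exact fun z => (Finset.sum_eq_sum_iff_of_le hle).1 hs z (mem_univ z)
  | succ k ih =>
    intro E hE hc hk
    obtain ⟨u, hu⟩ : ∃ u, d < degE E u := by
      by_contra hcon
      push Not at hcon
      rw [Finset.sum_eq_zero (fun z _ => Nat.sub_eq_zero_of_le (hcon z))] at hk
      omega
    obtain ⟨v, hv⟩ : ∃ v, degE E v < d := by
      by_contra hcon
      push Not at hcon
      have : ∑ _z : Fin n, d < ∑ z, degE E z :=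
        Finset.sum_lt_sum (fun z _ => hcon z) ⟨u, mem_univ _, hu⟩
      rw [sum_degE hE, hc] at this
      simp [mul_comm] at this
    obtain ⟨w, hwv, huw, hvw⟩ := exists_edge_switch hE (hv.trans hu)
    have huv : u ≠ v := by rintro rfl; omega
    have huw' := ne_of_mem_edges hE huw
    have hdeg := degE_switch huw hvw huv huw' hwv
    set E₁ := insert s(v, w) (E.erase s(u, w)) with hE₁
    have hn : s(v, w) ∉ E.erase s(u, w) := fun h => hvw (mem_of_mem_erase h)
    have hc1 : E₁.card = E.card := by
      have := card_pos.2 ⟨_, huw⟩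
      rw [hE₁, card_insert_of_notMem hn, card_erase_of_mem huw]; omega
    have hs1 : E₁ ⊆ allPairs n :=
      insert_subset (mem_allPairs.2 hwv.symm) ((erase_subset _ _).trans hE)
    have hk1 : ∑ z, (degE E₁ z - d) = k := by
      have h1 : ∑ z, ((degE E₁ z - d) + (if z = u then 1 else 0)) = ∑ z, (degE E z - d) := by
        refine Finset.sum_congr rfl fun z _ => ?_
        have := hdeg z
        by_cases hzu : z = u
        · subst hzu
          rw [if_pos rfl, if_neg huv] at this
          rw [if_pos rfl]; omega
        · rw [if_neg hzu] at this
          rw [if_neg hzu]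
          by_cases hzv : z = v
          · subst hzv; rw [if_pos rfl] at this; omega
          · rw [if_neg hzv] at this; omega
      rw [Finset.sum_add_distrib, hk] at h1
      simp at h1
      exact h1
    obtain ⟨E', h1, h2, h3, h4⟩ := ih E₁ hs1 (by rw [hc1, hc]) hk1
    refine ⟨E', h1, h2, h3, ?_⟩
    have hsd : symmDiff E E₁ ⊆ {s(u, w), s(v, w)} := by
      intro e he
      rw [mem_symmDiff, hE₁, mem_insert, mem_erase] at he
      rw [mem_insert, mem_singleton]
      tauto
    have hsd2 : (symmDiff E E₁).card ≤ 2 := (card_le_card hsd).trans card_le_two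
    have := (card_le_card (symmDiff_triangle E E₁ E')).trans (card_union_le _ _)
    omega

/-- The graph with edge set `E` has a pair of vertex sets whose number of edges deviates by more
than `γ n²` from the value expected at density `d/n`. -/
def HasDisc (γ : ℝ) (d : ℕ) (E : Finset (Sym2 (Fin n))) : Prop :=
  ∃ S T : Finset (Fin n), γ * (n : ℝ) ^ 2 < |(cutE E S T : ℝ) - (d : ℝ) / n * (S.card * T.card)|

open Finset in
lemma card_mk_fiber_le_two (I : Finset (Fin n × Fin n)) (e : Sym2 (Fin n)) :
    (I.filter (fun p => s(p.1, p.2) = e)).card ≤ 2 := by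
  induction e with
  | h a b =>
    have : I.filter (fun p => s(p.1, p.2) = s(a, b)) ⊆ {(a, b), (b, a)} := by
      rintro ⟨u, v⟩ h
      have := (mem_filter.1 h).2
      simp only [Sym2.eq_iff] at this
      simp only [mem_insert, mem_singleton, Prod.mk.injEq]
      exact this
    exact (card_le_card this).trans card_le_two

open Finset in
lemma card_cut_deviation_le (S T : Finset (Fin n)) (d M : ℕ) (γ : ℝ) (hγ : 0 < γ) (hγ8 : γ ≤ 8)
    (hn : 2 ≤ n) (hnγ : 2 ≤ γ * n) (hd : d ≤ n - 1) (hM : 2 * M = d * n) :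
    (((allPairs n).powersetCard M).filter (fun E => γ * (n : ℝ) ^ 2 <
        |(cutE E S T : ℝ) - (d : ℝ) / n * (S.card * T.card)|)).card ≤
      2 * Real.exp (-(γ ^ 2 / 64 * (n : ℝ) ^ 2)) * (allPairs n).card.choose M := by
  have hn1 : (2 : ℝ) ≤ n := by exact_mod_cast hn
  have hdR : (d : ℝ) ≤ n - 1 := by
    have : ((d + 1 : ℕ) : ℝ) ≤ n := by exact_mod_cast (by omega : d + 1 ≤ n)
    push_cast at this; linarith
  have hMR : 2 * (M : ℝ) = d * n := by exact_mod_cast hM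
  have hN : ((allPairs n).card : ℝ) = n * (n - 1) / 2 := by
    rw [card_allPairs, Nat.cast_choose_two]
  have hML : M ≤ (allPairs n).card := by
    have : (M : ℝ) ≤ (allPairs n).card := by rw [hN]; nlinarith
    exact_mod_cast this
  set I := (S ×ˢ T).filter (fun p => p.1 ≠ p.2) with hI
  set f : Fin n × Fin n → Sym2 (Fin n) := fun p => s(p.1, p.2) with hf
  have hIle : (I.card : ℝ) ≤ S.card * T.card := by
    rw [← Nat.cast_mul, ← card_product]; exact_mod_cast card_filter_le _ _
  have hIge : (S.card * T.card : ℝ) ≤ I.card + n := by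
    rw [← Nat.cast_mul, ← card_product]
    have h1 := card_filter_add_card_filter_not (s := S ×ˢ T) (fun p => p.1 ≠ p.2)
    have h2 : ((S ×ˢ T).filter (fun p => ¬ p.1 ≠ p.2)).card ≤ n := by
      have : ((S ×ˢ T).filter (fun p => ¬ p.1 ≠ p.2)).card ≤ (univ : Finset (Fin n)).card := by
        refine card_le_card_of_injOn (fun p => p.1) (fun _ _ => mem_coe.2 (mem_univ _)) ?_
        rintro ⟨a, b⟩ h ⟨a', b'⟩ h' heq
        simp only [coe_filter, Set.mem_ofPred_eq, not_not] at h h'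
        simp only at heq
        ext <;> simp [← h.2, ← h'.2, heq]
      simpa using this
    have h3 : (S ×ˢ T).card ≤ I.card + n := by rw [hI]; omega
    exact_mod_cast h3
  have hSn : (S.card : ℝ) ≤ n := by exact_mod_cast (card_le_univ S).trans (by simp)
  have hTn : (T.card : ℝ) ≤ n := by exact_mod_cast (card_le_univ T).trans (by simp)
  have hST : (S.card : ℝ) * T.card ≤ n ^ 2 := by
    rw [sq]; exact mul_le_mul hSn hTn (Nat.cast_nonneg _) (by positivity)
  have hsum : ∑ e ∈ allPairs n, ((I.filter (fun i => f i = e)).card : ℝ) / 2 = I.card / 2 := by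
    rw [← Finset.sum_div, sum_card_fiber, Finset.filter_true_of_mem]
    intro p hp
    exact mem_allPairs.2 (mem_filter.1 hp).2
  have hq : (M : ℝ) / (allPairs n).card = d / (n - 1) := by
    rw [hN, div_eq_div_iff (by nlinarith) (by linarith)]
    nlinarith
  have hn0 : (0 : ℝ) < n := by linarith
  have hn10 : (0 : ℝ) < n - 1 := by linarith
  have hq1 : (d : ℝ) / (n - 1) ≤ 1 := by rw [div_le_one hn10]; exact hdR
  have hq0 : (0 : ℝ) ≤ (d : ℝ) / (n - 1) := by positivity
  have hI0 : (0 : ℝ) ≤ I.card := Nat.cast_nonneg _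
  have h := chernoff_powersetCard (allPairs n)
    (fun e => ((I.filter (fun i => f i = e)).card : ℝ) / 2) M hML
    (fun e _ => by positivity)
    (fun e _ => by
      rw [div_le_one (by norm_num)]; exact_mod_cast card_mk_fiber_le_two I e)
    ((d : ℝ) / (n - 1) * (I.card / 2)) ((n : ℝ) ^ 2) (γ * n ^ 2 / 4)
    (by rw [hsum, hq])
    (by
      calc _ ≤ 1 * ((I.card : ℝ) / 2) := mul_le_mul_of_nonneg_right hq1 (by positivity)
        _ ≤ _ := by linarith)
    (by positivity) (by positivity)
    (by
      have := mul_le_mul_of_nonneg_right hγ8 (sq_nonneg (n : ℝ))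
      linarith)
  have e1 : (γ * (n : ℝ) ^ 2 / 4) ^ 2 / (4 * (n : ℝ) ^ 2) = γ ^ 2 / 64 * (n : ℝ) ^ 2 := by
    field_simp; ring
  rw [e1] at h
  refine le_trans (Nat.cast_le.2 (card_le_card ?_)) h
  intro E hE
  rw [mem_filter] at hE ⊢
  refine ⟨hE.1, ?_⟩
  have hEs := (mem_powersetCard.1 hE.1).1
  have hcut : (cutE E S T : ℝ) = ((I.filter (fun i => f i ∈ E)).card : ℝ) := by
    unfold cutE
    congr 2
    ext p
    simp only [hI, hf, mem_filter]
    constructor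
    · rintro ⟨h1, h2⟩; exact ⟨⟨h1, ne_of_mem_edges hEs h2⟩, h2⟩
    · rintro ⟨⟨h1, _⟩, h2⟩; exact ⟨h1, h2⟩
  have hEd : ∑ i ∈ E, ((I.filter (fun j => f j = i)).card : ℝ) / 2 = (cutE E S T : ℝ) / 2 := by
    rw [← Finset.sum_div, sum_card_fiber, hcut]
  rw [hEd]
  have hdiff : |(d : ℝ) / (n - 1) * I.card - d / n * (S.card * T.card)| ≤ n := by
    have hdn : (d : ℝ) / n ≤ 1 := by rw [div_le_one hn0]; linarith
    have hdn0 : (0 : ℝ) ≤ (d : ℝ) / n := by positivity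
    have hrel : (d : ℝ) / (n - 1) = d / n + d / (n - 1) / n := by
      have h1 := hn0.ne'
      have h2 := hn10.ne'
      rw [div_div, div_add_div _ _ h1 (mul_ne_zero h2 h1), div_eq_div_iff h2 (by positivity)]
      ring
    have hIn : (I.card : ℝ) ≤ n ^ 2 := hIle.trans hST
    have hsm : (d : ℝ) / (n - 1) / n * I.card ≤ n := by
      rw [div_mul_eq_mul_div, div_le_iff₀ hn0, ← sq]
      calc _ ≤ 1 * (I.card : ℝ) := mul_le_mul_of_nonneg_right hq1 hI0
        _ ≤ _ := by rw [one_mul]; exact hIn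
    have hsm0 : 0 ≤ (d : ℝ) / (n - 1) / n * I.card := mul_nonneg (div_nonneg hq0 hn0.le) hI0
    have hp0 : 0 ≤ (d : ℝ) / n * (S.card * T.card - I.card) :=
      mul_nonneg hdn0 (by linarith)
    have hp1 : (d : ℝ) / n * (S.card * T.card - I.card) ≤ 1 * n :=
      mul_le_mul hdn (by linarith) (by linarith) (by norm_num)
    have hrw : (d : ℝ) / (n - 1) * I.card - d / n * (S.card * T.card) =
        (d : ℝ) / (n - 1) / n * I.card - (d : ℝ) / n * (S.card * T.card - I.card) := by
      linear_combination (I.card : ℝ) * hrel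
    rw [hrw, abs_le]
    constructor <;> linarith
  have hbig := hE.2
  have htri : |(cutE E S T : ℝ) - (d : ℝ) / n * (S.card * T.card)| ≤
      |(cutE E S T : ℝ) - (d : ℝ) / (n - 1) * I.card| +
      |(d : ℝ) / (n - 1) * I.card - d / n * (S.card * T.card)| := abs_sub_le _ _ _
  have hhalf : |(cutE E S T : ℝ) / 2 - (d : ℝ) / (n - 1) * (I.card / 2)| =
      |(cutE E S T : ℝ) - (d : ℝ) / (n - 1) * I.card| / 2 := by
    rw [← mul_div_assoc, ← sub_div, abs_div, abs_of_pos (show (0 : ℝ) < 2 by norm_num)]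
  rw [hhalf]
  have hng : 2 * (n : ℝ) ≤ γ * n ^ 2 := by
    calc 2 * (n : ℝ) ≤ γ * n * n := mul_le_mul_of_nonneg_right hnγ hn0.le
      _ = _ := by ring
  linarith

open Finset in
lemma card_hasDisc_le (d M : ℕ) (γ : ℝ) (hγ : 0 < γ) (hγ8 : γ ≤ 8)
    (hn : 2 ≤ n) (hnγ : 2 ≤ γ * n) (hd : d ≤ n - 1) (hM : 2 * M = d * n) :
    (((allPairs n).powersetCard M).filter (HasDisc γ d)).card ≤
      (4 : ℝ) ^ n * (2 * Real.exp (-(γ ^ 2 / 64 * (n : ℝ) ^ 2)) *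
        (allPairs n).card.choose M) := by
  have hsub : ((allPairs n).powersetCard M).filter (HasDisc γ d) ⊆
      (univ : Finset (Finset (Fin n) × Finset (Fin n))).biUnion (fun p =>
        ((allPairs n).powersetCard M).filter (fun E => γ * (n : ℝ) ^ 2 <
        |(cutE E p.1 p.2 : ℝ) - (d : ℝ) / n * (p.1.card * p.2.card)|)) := by
    intro E hE
    obtain ⟨h1, S, T, h2⟩ := mem_filter.1 hE
    exact mem_biUnion.2 ⟨(S, T), mem_univ _, mem_filter.2 ⟨h1, h2⟩⟩
  have h := (card_le_card hsub).trans card_biUnion_le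
  have h' : ((((allPairs n).powersetCard M).filter (HasDisc γ d)).card : ℝ) ≤
      ∑ p : Finset (Fin n) × Finset (Fin n),
        ((((allPairs n).powersetCard M).filter (fun E => γ * (n : ℝ) ^ 2 <
        |(cutE E p.1 p.2 : ℝ) - (d : ℝ) / n * (p.1.card * p.2.card)|)).card : ℝ) := by
    exact_mod_cast h
  refine h'.trans ((Finset.sum_le_sum fun p _ =>
    card_cut_deviation_le p.1 p.2 d M γ hγ hγ8 hn hnγ hd hM).trans (le_of_eq ?_))
  rw [Finset.sum_const, nsmul_eq_mul, card_univ, Fintype.card_prod, Fintype.card_finset,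
    Fintype.card_fin]
  push_cast
  rw [← mul_pow]; norm_num

/-- The edge sets of the `d`-regular graphs on `Fin n`. -/
def regEdges (n d : ℕ) : Finset (Finset (Sym2 (Fin n))) :=
  (allPairs n).powerset.filter (fun E => ∀ z, degE E z = d)

lemma two_mul_card_of_mem_regEdges {d : ℕ} {E : Finset (Sym2 (Fin n))} (hE : E ∈ regEdges n d) :
    2 * E.card = d * n := by
  obtain ⟨h1, h2⟩ := Finset.mem_filter.1 hE
  rw [← sum_degE (Finset.mem_powerset.1 h1)]
  simp [h2, mul_comm]

open Finset in
lemma cutE_univ (E : Finset (Sym2 (Fin n))) (S : Finset (Fin n)) :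
    cutE E S univ = ∑ z ∈ S, degE E z := by
  unfold cutE
  rw [Finset.card_filter, Finset.sum_product]
  refine Finset.sum_congr rfl fun z _ => ?_
  rw [degE_eq_card_neighbors, Finset.card_filter]

open Finset in
/-- Without discrepancy, the total degree excess is small. -/
lemma excess_le_of_not_hasDisc {E : Finset (Sym2 (Fin n))} {d : ℕ} {γ : ℝ} (hn : 0 < n)
    (h : ¬ HasDisc γ d E) : ((∑ z, (degE E z - d) : ℕ) : ℝ) ≤ γ * (n : ℝ) ^ 2 := by
  set S := univ.filter (fun z => d < degE E z) with hS
  have h1 : ∑ z, (degE E z - d) = ∑ z ∈ S, (degE E z - d) := by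
    rw [hS, Finset.sum_filter]
    refine Finset.sum_congr rfl fun z _ => ?_
    split_ifs with hz
    · rfl
    · omega
  have h2 : ((∑ z ∈ S, (degE E z - d) : ℕ) : ℝ) = (cutE E S univ : ℝ) - d * S.card := by
    rw [cutE_univ, Nat.cast_sum, Nat.cast_sum, mul_comm, ← nsmul_eq_mul, ← Finset.sum_const,
      ← Finset.sum_sub_distrib]
    refine Finset.sum_congr rfl fun z hz => ?_
    rw [Nat.cast_sub (mem_filter.1 hz).2.le]
  unfold HasDisc at h
  push Not at h
  have h3 := h S univ
  rw [card_univ, Fintype.card_fin] at h3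
  have hn0 : (0 : ℝ) < n := by exact_mod_cast hn
  have h4 : (d : ℝ) / n * (S.card * n) = d * S.card := by field_simp
  rw [h4] at h3
  rw [h1, h2]
  exact (le_abs_self _).trans h3

open Finset in
/-- The number of small subsets of a finite set. -/
lemma card_small_subsets_le {α : Type*} (s : Finset α) (l x : ℝ) (hl : 0 ≤ l) :
    ((s.powerset.filter (fun F => (F.card : ℝ) ≤ x)).card : ℝ) ≤
      Real.exp (l * x + Real.exp (-l) * s.card) := by
  have h1 : ∑ F ∈ s.powerset, Real.exp (-l) ^ F.card = (1 + Real.exp (-l)) ^ s.card := by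
    have := Finset.prod_one_add (f := fun _ : α => Real.exp (-l)) s
    simp only [Finset.prod_const] at this
    exact this.symm
  have h2 : ((s.powerset.filter (fun F => (F.card : ℝ) ≤ x)).card : ℝ) * Real.exp (-(l * x)) ≤
      ∑ F ∈ s.powerset, Real.exp (-l) ^ F.card := by
    rw [← nsmul_eq_mul, ← Finset.sum_const]
    refine (Finset.sum_le_sum fun F hF => ?_).trans
      (Finset.sum_le_sum_of_subset_of_nonneg (filter_subset _ _) fun _ _ _ => by positivity)
    rw [← Real.exp_nat_mul]
    refine Real.exp_le_exp.2 ?_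
    nlinarith [mul_le_mul_of_nonneg_left (mem_filter.1 hF).2 hl]
  have h3 : (1 + Real.exp (-l)) ^ s.card ≤ Real.exp (Real.exp (-l) * s.card) := by
    rw [mul_comm, Real.exp_nat_mul]
    refine pow_le_pow_left₀ (by positivity) ?_ _
    rw [add_comm]; exact Real.add_one_le_exp _
  rw [h1] at h2
  have h4 := h2.trans h3
  rw [Real.exp_add]
  refine le_of_mul_le_mul_right ?_ (Real.exp_pos (-(l * x)))
  calc _ ≤ _ := h4
    _ = _ := by
      rw [mul_comm (Real.exp (l * x)), mul_assoc, ← Real.exp_add]; simp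

open Finset in
/-- A lower bound for the number of `d`-regular graphs, in terms of the number of graphs with
the same number of edges and small discrepancy. -/
lemma card_not_hasDisc_le (d M : ℕ) (γ l : ℝ) (hl : 0 ≤ l) (hn : 0 < n) (hM : 2 * M = d * n) :
    ((((allPairs n).powersetCard M).filter (fun E => ¬ HasDisc γ d E)).card : ℝ) ≤
      (regEdges n d).card *
        Real.exp (l * (2 * (γ * (n : ℝ) ^ 2)) + Real.exp (-l) * (allPairs n).card) := by
  have hsub : ((allPairs n).powersetCard M).filter (fun E => ¬ HasDisc γ d E) ⊆
      (regEdges n d).biUnion (fun K => ((allPairs n).powerset.filter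
        (fun E => ((symmDiff E K).card : ℝ) ≤ 2 * (γ * (n : ℝ) ^ 2)))) := by
    intro E hE
    obtain ⟨h1, h2⟩ := mem_filter.1 hE
    obtain ⟨hEs, hEc⟩ := mem_powersetCard.1 h1
    obtain ⟨K, hK1, _, hK3, hK4⟩ := exists_regular_close d _ E hEs (by rw [hEc, hM]) rfl
    refine mem_biUnion.2 ⟨K, mem_filter.2 ⟨mem_powerset.2 hK1, hK3⟩,
      mem_filter.2 ⟨mem_powerset.2 hEs, ?_⟩⟩
    have := excess_le_of_not_hasDisc hn h2
    have h5 : ((symmDiff E K).card : ℝ) ≤ 2 * ((∑ z, (degE E z - d) : ℕ) : ℝ) := by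
      exact_mod_cast hK4
    linarith
  have h := (card_le_card hsub).trans card_biUnion_le
  have h' : ((((allPairs n).powersetCard M).filter (fun E => ¬ HasDisc γ d E)).card : ℝ) ≤
      ∑ K ∈ regEdges n d, (((allPairs n).powerset.filter
        (fun E => ((symmDiff E K).card : ℝ) ≤ 2 * (γ * (n : ℝ) ^ 2))).card : ℝ) := by
    exact_mod_cast h
  refine h'.trans ?_
  rw [← nsmul_eq_mul, ← Finset.sum_const]
  refine Finset.sum_le_sum fun K hK => ?_
  refine le_trans (Nat.cast_le.2 ?_) (card_small_subsets_le (allPairs n) l _ hl)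
  refine card_le_card_of_injOn (fun E => symmDiff E K) ?_ ?_
  · intro E hE
    simp only [coe_filter, mem_powerset, Set.mem_ofPred_eq] at hE ⊢
    refine ⟨?_, hE.2⟩
    have hKs := mem_powerset.1 (mem_filter.1 hK).1
    exact symmDiff_subset_union.trans (union_subset hE.1 hKs)
  · intro E _ E' _ h
    exact symmDiff_left_injective K h

set_option maxHeartbeats 1600000 in
open Finset Filter in
/-- Almost all `d`-regular graphs have small discrepancy. -/
lemma card_regEdges_hasDisc_le (γ c : ℝ) (hγ : 0 < γ) (hγ1 : γ ≤ 1) (hc : 0 < c) :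
    ∃ n₀ : ℕ, ∀ n : ℕ, n₀ ≤ n → ∀ d : ℕ, d ≤ n - 1 → Even (d * n) →
      (((regEdges n d).filter (HasDisc γ d)).card : ℝ) ≤
        c / (n : ℝ) ^ 8 * (regEdges n d).card := by
  set g : ℝ := γ ^ 2 / 64 with hg
  have hg0 : 0 < g := by positivity
  obtain ⟨l, hl0, hl⟩ : ∃ l : ℝ, 0 < l ∧ Real.exp (-l) ≤ g / 4 := by
    have := (Real.tendsto_exp_neg_atTop_nhds_zero).eventually_le_const (show 0 < g / 4 by positivity)
    obtain ⟨l, h1, h2⟩ := (this.and (eventually_gt_atTop 0)).exists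
    exact ⟨l, h2, h1⟩
  set γ₁ : ℝ := min 1 (g / (16 * l)) with hγ₁
  have hγ₁0 : 0 < γ₁ := lt_min one_pos (by positivity)
  have hγ₁1 : γ₁ ≤ 1 := min_le_left _ _
  have hγ₁l : l * (2 * γ₁) ≤ g / 8 := by
    have : γ₁ ≤ g / (16 * l) := min_le_right _ _
    rw [le_div_iff₀ (by positivity)] at this
    linarith
  set g₁ : ℝ := γ₁ ^ 2 / 64 with hg₁
  have hg₁0 : 0 < g₁ := by positivity
  -- eventual bounds
  have hlin : ∀ a : ℝ, 0 < a → ∀ b : ℝ, ∀ᶠ n : ℕ in atTop, b ≤ a * n := by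
    intro a ha b
    have : Tendsto (fun n : ℕ => a * (n : ℝ)) atTop atTop :=
      tendsto_natCast_atTop_atTop.const_mul_atTop ha
    exact this.eventually_ge_atTop b
  have hexp : ∀ᶠ n : ℕ in atTop, 4 * Real.exp (-(n : ℝ)) ≤ c / (n : ℝ) ^ 8 := by
    have h1 : Tendsto (fun n : ℕ => (n : ℝ) ^ 8 * Real.exp (-(n : ℝ))) atTop (nhds 0) :=
      (Real.tendsto_pow_mul_exp_neg_atTop_nhds_zero 8).comp tendsto_natCast_atTop_atTop
    filter_upwards [h1.eventually_le_const (show 0 < c / 4 by positivity), eventually_gt_atTop 0]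
      with n h2 h3
    have h3 : (0 : ℝ) < n := by exact_mod_cast h3
    rw [le_div_iff₀ (by positivity)]
    linarith
  obtain ⟨n₀, hn₀⟩ := eventually_atTop.1 (((hlin γ hγ 2).and (hlin γ₁ hγ₁0 2)).and
    (((hlin g₁ hg₁0 4).and (hlin (g / 2) (by positivity) 3)).and
      (hexp.and (eventually_ge_atTop 2))))
  refine ⟨n₀, fun n hn d hd hev => ?_⟩
  obtain ⟨⟨a1, a2⟩, ⟨a3, a4⟩, a5, a6⟩ := hn₀ n hn
  obtain ⟨M, hM⟩ := hev
  have hM : 2 * M = d * n := by omega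
  have hn0 : (0 : ℝ) < n := by exact_mod_cast (by omega : 0 < n)
  have hn2 : (2 : ℝ) ≤ n := by exact_mod_cast a6
  have h4n : (4 : ℝ) ^ n ≤ Real.exp (2 * n) := by
    rw [mul_comm, Real.exp_nat_mul]
    refine pow_le_pow_left₀ (by norm_num) ?_ _
    have := Real.add_one_le_exp (1 : ℝ)
    have h2 : Real.exp 2 = Real.exp 1 * Real.exp 1 := by rw [← Real.exp_add]; norm_num
    rw [h2]; nlinarith
  have hb := card_hasDisc_le d M γ hγ (by linarith) a6 a1 hd hM
  have hb₁ := card_hasDisc_le d M γ₁ hγ₁0 (by linarith) a6 a2 hd hM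
  rw [← hg] at hb
  rw [← hg₁] at hb₁
  have hnd := card_not_hasDisc_le d M γ₁ l hl0.le (by omega : 0 < n) hM
  set Ch : ℝ := ((allPairs n).card.choose M : ℝ) with hCh
  have hCh0 : 0 ≤ Ch := Nat.cast_nonneg _
  have hsplit : ((((allPairs n).powersetCard M).filter (HasDisc γ₁ d)).card : ℝ) +
      (((allPairs n).powersetCard M).filter (fun E => ¬ HasDisc γ₁ d E)).card = Ch := by
    rw [hCh, ← card_powersetCard]
    exact_mod_cast card_filter_add_card_filter_not (s := (allPairs n).powersetCard M) (HasDisc γ₁ d)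
  have hhalf : (4 : ℝ) ^ n * (2 * Real.exp (-(g₁ * (n : ℝ) ^ 2)) * Ch) ≤ Ch / 2 := by
    have : (4 : ℝ) ^ n * Real.exp (-(g₁ * (n : ℝ) ^ 2)) ≤ 1 / 4 := by
      calc _ ≤ Real.exp (2 * n) * Real.exp (-(g₁ * (n : ℝ) ^ 2)) := by gcongr
        _ = Real.exp (2 * n - g₁ * (n : ℝ) ^ 2) := by rw [← Real.exp_add]; congr 1
        _ ≤ Real.exp (-(2 * n)) := by
          refine Real.exp_le_exp.2 ?_
          have := mul_le_mul_of_nonneg_right a3 hn0.le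
          nlinarith
        _ ≤ Real.exp (-4) := Real.exp_le_exp.2 (by linarith)
        _ ≤ 1 / 4 := by
          rw [Real.exp_neg, ← one_div]
          refine one_div_le_one_div_of_le (by norm_num) ?_
          have := Real.add_one_le_exp (4 : ℝ)
          linarith
    calc _ = 2 * ((4 : ℝ) ^ n * Real.exp (-(g₁ * (n : ℝ) ^ 2))) * Ch := by ring
      _ ≤ 2 * (1 / 4) * Ch := by gcongr
      _ = _ := by ring
  have hN : ((allPairs n).card : ℝ) ≤ (n : ℝ) ^ 2 := by
    rw [card_allPairs, Nat.cast_choose_two]; nlinarith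
  have hexpo : Real.exp (l * (2 * (γ₁ * (n : ℝ) ^ 2)) + Real.exp (-l) * (allPairs n).card) ≤
      Real.exp (g / 2 * (n : ℝ) ^ 2) := by
    refine Real.exp_le_exp.2 ?_
    have e1 : Real.exp (-l) * (allPairs n).card ≤ g / 4 * (n : ℝ) ^ 2 :=
      mul_le_mul hl hN (Nat.cast_nonneg _) (by positivity)
    have e2 := mul_le_mul_of_nonneg_right hγ₁l (sq_nonneg (n : ℝ))
    have e3 : 0 ≤ g * (n : ℝ) ^ 2 := by positivity
    nlinarith
  have hR0 : (0 : ℝ) ≤ (regEdges n d).card := Nat.cast_nonneg _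
  have hCh2 : Ch ≤ 2 * ((regEdges n d).card * Real.exp (g / 2 * (n : ℝ) ^ 2)) := by
    have := mul_le_mul_of_nonneg_left hexpo hR0
    linarith
  have hsub : (regEdges n d).filter (HasDisc γ d) ⊆
      ((allPairs n).powersetCard M).filter (HasDisc γ d) := by
    intro E hE
    obtain ⟨h1, h2⟩ := mem_filter.1 hE
    refine mem_filter.2 ⟨mem_powersetCard.2 ⟨mem_powerset.1 (mem_filter.1 h1).1, ?_⟩, h2⟩
    have := two_mul_card_of_mem_regEdges h1
    omega
  calc (((regEdges n d).filter (HasDisc γ d)).card : ℝ)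
      ≤ (((allPairs n).powersetCard M).filter (HasDisc γ d)).card :=
        Nat.cast_le.2 (card_le_card hsub)
    _ ≤ _ := hb
    _ ≤ Real.exp (2 * n) * (2 * Real.exp (-(g * (n : ℝ) ^ 2)) *
          (2 * ((regEdges n d).card * Real.exp (g / 2 * (n : ℝ) ^ 2)))) :=
        mul_le_mul h4n (mul_le_mul_of_nonneg_left hCh2 (by positivity)) (by positivity)
          (Real.exp_pos _).le
    _ = 4 * Real.exp (2 * n - g / 2 * (n : ℝ) ^ 2) * (regEdges n d).card := by
        have : Real.exp (2 * n - g / 2 * (n : ℝ) ^ 2) = Real.exp (2 * n) *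
            Real.exp (-(g * (n : ℝ) ^ 2)) * Real.exp (g / 2 * (n : ℝ) ^ 2) := by
          rw [← Real.exp_add, ← Real.exp_add]; congr 1; ring
        rw [this]; ring
    _ ≤ 4 * Real.exp (-(n : ℝ)) * (regEdges n d).card := by
        have : 2 * (n : ℝ) - g / 2 * (n : ℝ) ^ 2 ≤ -n := by
          have := mul_le_mul_of_nonneg_right a4 hn0.le
          nlinarith
        exact mul_le_mul_of_nonneg_right
          (mul_le_mul_of_nonneg_left (Real.exp_le_exp.2 this) (by norm_num)) hR0
    _ ≤ _ := mul_le_mul_of_nonneg_right a5 hR0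

/-- The internal vertices `(v₁, v₂, v₃)` of the alternating paths `x v₁ v₂ v₃ y` of length `4`
whose edges lie alternately outside and inside `E`. -/
def pathTriples (E : Finset (Sym2 (Fin n))) (x y : Fin n) : Finset (Fin n × Fin n × Fin n) :=
  Finset.univ.filter (fun p => (x ≠ p.1 ∧ s(x, p.1) ∉ E ∧ p.1 ≠ y) ∧ s(p.2.1, p.1) ∈ E ∧
    (p.2.1 ≠ p.2.2 ∧ s(p.2.1, p.2.2) ∉ E) ∧ s(y, p.2.2) ∈ E ∧ p.2.2 ≠ x)

open Finset in
lemma card_pathTriples_eq_sum (E : Finset (Sym2 (Fin n))) (x y : Fin n) :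
    (pathTriples E x y).card = ∑ v : Fin n,
      ((univ.filter (fun w => x ≠ w ∧ s(x, w) ∉ E ∧ w ≠ y)).filter (fun w => s(v, w) ∈ E)).card *
      ((univ.filter (fun w => s(y, w) ∈ E ∧ w ≠ x)).filter
        (fun w => v ≠ w ∧ s(v, w) ∉ E)).card := by
  rw [card_eq_sum_card_fiberwise (f := fun p => p.2.1) (t := univ) (fun _ _ => mem_univ _)]
  refine sum_congr rfl fun v _ => ?_
  rw [← card_product]
  refine card_bij (fun p _ => (p.1, p.2.2)) ?_ ?_ ?_
  · rintro ⟨v₁, v₂, v₃⟩ h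
    simp only [pathTriples, mem_filter, mem_univ, true_and, mem_product] at h ⊢
    obtain ⟨h, rfl⟩ := h
    tauto
  · rintro ⟨v₁, v₂, v₃⟩ h ⟨w₁, w₂, w₃⟩ h' he
    have e1 := (mem_filter.1 h).2
    have e2 := (mem_filter.1 h').2
    simp only [Prod.mk.injEq] at he e1 e2 ⊢
    exact ⟨he.1, e1.trans e2.symm, he.2⟩
  · rintro ⟨v₁, v₃⟩ h
    refine ⟨(v₁, v, v₃), ?_, rfl⟩
    simp only [pathTriples, mem_filter, mem_univ, true_and, mem_product] at h ⊢
    tauto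

open Finset in
lemma sum_card_filter_adj {d : ℕ} {E : Finset (Sym2 (Fin n))} (hE : E ∈ regEdges n d)
    (A : Finset (Fin n)) : ∑ v : Fin n, (A.filter (fun w => s(v, w) ∈ E)).card = d * A.card := by
  simp_rw [card_filter]
  rw [sum_comm, mul_comm, ← smul_eq_mul, ← sum_const]
  refine sum_congr rfl fun w _ => ?_
  rw [← card_filter, ← (mem_filter.1 hE).2 w, degE_eq_card_neighbors]
  simp_rw [Sym2.eq_swap]

open Finset in
lemma card_filter_nonadj {d : ℕ} {E : Finset (Sym2 (Fin n))} (hE : E ∈ regEdges n d)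
    (w : Fin n) : (univ.filter (fun v => w ≠ v ∧ s(w, v) ∉ E)).card + 1 + d = n := by
  have h1 := (mem_filter.1 hE).2 w
  have hE' : E ⊆ allPairs n := mem_powerset.1 (mem_filter.1 hE).1
  rw [degE_eq_card_neighbors] at h1
  have h2 := card_filter_add_card_filter_not (s := (univ : Finset (Fin n)))
    (fun v => s(w, v) ∈ E)
  have h3 : univ.filter (fun v => s(w, v) ∉ E) =
      insert w (univ.filter (fun v => w ≠ v ∧ s(w, v) ∉ E)) := by
    ext v
    simp only [mem_filter, mem_univ, true_and, mem_insert]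
    constructor
    · intro h
      by_cases hv : v = w
      · exact Or.inl hv
      · exact Or.inr ⟨fun h => hv h.symm, h⟩
    · rintro (rfl | h)
      · exact fun h => ne_of_mem_edges hE' h rfl
      · exact h.2
  rw [h3, card_insert_of_notMem (by simp), h1, card_univ, Fintype.card_fin] at h2
  omega

open Finset in
lemma sum_card_filter_nonadj {d : ℕ} {E : Finset (Sym2 (Fin n))} (hE : E ∈ regEdges n d)
    (B : Finset (Fin n)) :
    ∑ v : Fin n, (B.filter (fun w => v ≠ w ∧ s(v, w) ∉ E)).card = (n - 1 - d) * B.card := by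
  simp_rw [card_filter]
  rw [sum_comm, mul_comm, ← smul_eq_mul, ← sum_const]
  refine sum_congr rfl fun w _ => ?_
  rw [← card_filter]
  have := card_filter_nonadj hE w
  simp_rw [Sym2.eq_swap, ne_comm] at this ⊢
  omega

open Finset in
/-- If `0 ≤ b ≤ β` and every partial sum of `f` is at most `g` in absolute value, then
`|∑ f b| ≤ g β`. -/
lemma abs_sum_mul_le {ι : Type*} (s : Finset ι) (f b : ι → ℝ) (β g : ℝ)
    (hb : ∀ v ∈ s, 0 ≤ b v ∧ b v ≤ β) (hβ : 0 ≤ β) (hf : ∀ t ⊆ s, |∑ v ∈ t, f v| ≤ g) :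
    |∑ v ∈ s, f v * b v| ≤ g * β := by
  have key : ∀ f : ι → ℝ, (∀ t ⊆ s, |∑ v ∈ t, f v| ≤ g) → ∑ v ∈ s, f v * b v ≤ g * β := by
    intro f hf
    calc ∑ v ∈ s, f v * b v ≤ ∑ v ∈ s, if 0 < f v then f v * β else 0 := by
          refine sum_le_sum fun v hv => ?_
          split_ifs with h
          · exact mul_le_mul_of_nonneg_left (hb v hv).2 h.le
          · exact mul_nonpos_of_nonpos_of_nonneg (not_lt.1 h) (hb v hv).1
      _ = (∑ v ∈ s.filter (fun v => 0 < f v), f v) * β := by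
          rw [← sum_filter, sum_mul]
      _ ≤ g * β := mul_le_mul_of_nonneg_right
          ((le_abs_self _).trans (hf _ (filter_subset _ _))) hβ
  refine abs_le.2 ⟨?_, key f hf⟩
  have := key (fun v => -f v) (fun t ht => by rw [sum_neg_distrib, abs_neg]; exact hf t ht)
  simp only [neg_mul, sum_neg_distrib] at this
  linarith

open Finset in
lemma card_pathTriples_crude {d : ℕ} {E : Finset (Sym2 (Fin n))} (hE : E ∈ regEdges n d)
    (hd : d + 1 ≤ n) (x y : Fin n) :
    ∃ A B : ℝ, 0 ≤ A ∧ 0 ≤ B ∧ A ≤ n - 1 - d ∧ (n : ℝ) - 1 - d - 1 ≤ A ∧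
      (s(x, y) ∈ E → A = n - 1 - d) ∧ B ≤ d ∧ (d : ℝ) - 1 ≤ B ∧
      ((pathTriples E x y).card : ℝ) ≤ d * (A * B) ∧
      ((pathTriples E x y).card : ℝ) ≤ (n - 1 - d) * (A * B) ∧
      d * B * ((n - 1 - d) + A - n) ≤ (pathTriples E x y).card ∧
      (n - 1 - d) * A * (d + B - n) ≤ (pathTriples E x y).card ∧
      ∀ γ : ℝ, ¬ HasDisc γ d E →
        |((pathTriples E x y).card : ℝ) - d / n * A * ((n - 1 - d) * B)| ≤ γ * n ^ 3 := by
  have hE' : E ⊆ allPairs n := mem_powerset.1 (mem_filter.1 hE).1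
  set D : ℝ := (n : ℝ) - 1 - d with hD
  have hDnat : ((n - 1 - d : ℕ) : ℝ) = D := by
    rw [hD, Nat.sub_sub, Nat.cast_sub (by omega)]; push_cast; ring
  have hD0 : 0 ≤ D := by rw [← hDnat]; exact Nat.cast_nonneg _
  set SA := univ.filter (fun w => x ≠ w ∧ s(x, w) ∉ E ∧ w ≠ y) with hSA
  set SB := univ.filter (fun w => s(y, w) ∈ E ∧ w ≠ x) with hSB
  have hSA' : SA = (univ.filter (fun w => x ≠ w ∧ s(x, w) ∉ E)).erase y := by
    ext w; simp only [hSA, mem_filter, mem_univ, true_and, mem_erase]; tauto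
  have hSB' : SB = (univ.filter (fun w => s(y, w) ∈ E)).erase x := by
    ext w; simp only [hSB, mem_filter, mem_univ, true_and, mem_erase]; tauto
  have hcN := card_filter_nonadj hE x
  have hcY : (univ.filter (fun w => s(y, w) ∈ E)).card = d := by
    rw [← degE_eq_card_neighbors]; exact (mem_filter.1 hE).2 y
  have cA1 : SA.card ≤ n - 1 - d := by
    rw [hSA']; exact (card_le_card (erase_subset _ _)).trans (by omega)
  have cA2 : n - 1 - d ≤ SA.card + 1 := by
    rw [hSA']
    have := pred_card_le_card_erase (s := univ.filter (fun w => x ≠ w ∧ s(x, w) ∉ E)) (a := y)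
    omega
  have cA3 : s(x, y) ∈ E → SA.card = n - 1 - d := by
    intro h
    rw [hSA', erase_eq_of_notMem (by simp [h])]
    omega
  have cB1 : SB.card ≤ d := by
    rw [hSB', ← hcY]; exact card_le_card (erase_subset _ _)
  have cB2 : d ≤ SB.card + 1 := by
    rw [hSB']
    have := pred_card_le_card_erase (s := univ.filter (fun w => s(y, w) ∈ E)) (a := x)
    omega
  set a : Fin n → ℝ := fun v => ((SA.filter (fun w => s(v, w) ∈ E)).card : ℝ) with ha
  set b : Fin n → ℝ := fun v => ((SB.filter (fun w => v ≠ w ∧ s(v, w) ∉ E)).card : ℝ) with hb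
  have hI : ((pathTriples E x y).card : ℝ) = ∑ v, a v * b v := by
    rw [card_pathTriples_eq_sum]; push_cast; rfl
  have hsa : ∑ v, a v = d * SA.card := by
    have := sum_card_filter_adj hE SA
    simp only [ha]; exact_mod_cast this
  have hsb : ∑ v, b v = D * SB.card := by
    have := sum_card_filter_nonadj hE SB
    rw [← hDnat]
    simp only [hb]; exact_mod_cast this
  have a0 : ∀ v, 0 ≤ a v := fun v => Nat.cast_nonneg _
  have b0 : ∀ v, 0 ≤ b v := fun v => Nat.cast_nonneg _
  have aA : ∀ v, a v ≤ SA.card := fun v => Nat.cast_le.2 (card_le_card (filter_subset _ _))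
  have bB : ∀ v, b v ≤ SB.card := fun v => Nat.cast_le.2 (card_le_card (filter_subset _ _))
  have ad : ∀ v, a v ≤ d := fun v => by
    have h : degE E v = d := (mem_filter.1 hE).2 v
    rw [degE_eq_card_neighbors] at h
    rw [← h]
    exact Nat.cast_le.2 (card_le_card (filter_subset_filter _ (subset_univ _)))
  have bD : ∀ v, b v ≤ D := fun v => by
    have h := card_filter_nonadj hE v
    rw [← hDnat]
    refine Nat.cast_le.2 ((card_le_card (filter_subset_filter _ (subset_univ _))).trans ?_)
    omega
  have hcn : ∑ _v : Fin n, (1 : ℝ) = n := by simp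
  refine ⟨SA.card, SB.card, Nat.cast_nonneg _, Nat.cast_nonneg _, ?_, ?_, ?_, Nat.cast_le.2 cB1,
    ?_, ?_, ?_, ?_, ?_, ?_⟩
  · rw [← hDnat]; exact Nat.cast_le.2 cA1
  · rw [← hDnat]
    have : ((n - 1 - d : ℕ) : ℝ) ≤ SA.card + 1 := by exact_mod_cast cA2
    linarith
  · intro h; rw [cA3 h, hDnat]
  · have : (d : ℝ) ≤ SB.card + 1 := by exact_mod_cast cB2
    linarith
  · rw [hI, ← mul_assoc, ← hsa, sum_mul]
    exact sum_le_sum fun v _ => mul_le_mul_of_nonneg_left (bB v) (a0 v)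
  · rw [hI, mul_left_comm, ← hsb, mul_sum]
    exact sum_le_sum fun v _ => mul_le_mul_of_nonneg_right (aA v) (b0 v)
  · have h : 0 ≤ ∑ v, (d - a v) * (SB.card - b v) :=
      sum_nonneg fun v _ => mul_nonneg (sub_nonneg.2 (ad v)) (sub_nonneg.2 (bB v))
    have h2 : ∑ v, ((d : ℝ) - a v) * (SB.card - b v) = d * SB.card * (∑ _v : Fin n, (1 : ℝ))
        - d * (∑ v, b v) - SB.card * (∑ v, a v) + ∑ v, a v * b v := by
      simp only [mul_sum, ← sum_add_distrib, ← sum_sub_distrib]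
      exact sum_congr rfl fun v _ => by ring
    rw [hI]
    rw [h2, hcn, hsa, hsb] at h
    linarith
  · have h : 0 ≤ ∑ v, (SA.card - a v) * (D - b v) :=
      sum_nonneg fun v _ => mul_nonneg (sub_nonneg.2 (aA v)) (sub_nonneg.2 (bD v))
    have h2 : ∑ v, ((SA.card : ℝ) - a v) * (D - b v) = SA.card * D * (∑ _v : Fin n, (1 : ℝ))
        - SA.card * (∑ v, b v) - D * (∑ v, a v) + ∑ v, a v * b v := by
      simp only [mul_sum, ← sum_add_distrib, ← sum_sub_distrib]
      exact sum_congr rfl fun v _ => by ring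
    rw [hI]
    rw [h2, hcn, hsa, hsb] at h
    linarith
  · intro γ hγ
    have hn1 : (SB.card : ℝ) ≤ n := by
      have := card_le_univ SB
      rw [Fintype.card_fin] at this
      exact_mod_cast this
    have h := abs_sum_mul_le univ (fun v => a v - d / n * SA.card) b n (γ * n ^ 2)
      (fun v _ => ⟨b0 v, (bB v).trans hn1⟩) (Nat.cast_nonneg _) ?_
    · have h2 : ∑ v, (a v - d / n * SA.card) * b v =
          ∑ v, a v * b v - d / n * SA.card * ∑ v, b v := by
        rw [mul_sum, ← sum_sub_distrib]
        exact sum_congr rfl fun v _ => by ring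
      rw [h2, hsb, ← hI] at h
      calc _ ≤ _ := h
        _ = _ := by ring
    · intro t _
      have h3 : ∑ v ∈ t, (a v - d / n * SA.card) =
          (cutE E t SA : ℝ) - d / n * (t.card * SA.card) := by
        rw [sum_sub_distrib, sum_const, nsmul_eq_mul]
        have : (cutE E t SA : ℝ) = ∑ v ∈ t, a v := by
          unfold cutE
          rw [card_filter, sum_product]
          simp only [ha, card_filter]
          push_cast; rfl
        rw [this]; ring
      rw [h3]
      by_contra hc
      exact hγ ⟨t, SA, not_le.1 hc⟩

lemma abs_sub_le_of_sparse {δ n d D A B I : ℝ} (hδ : 0 < δ) (hδ1 : δ ≤ 1 / 100) (hn : 0 < n)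
    (hd : 0 < d) (hD : (1 - 2 * δ) * n ≤ D) (hDn : D ≤ n) (hB : (1 - δ) * d ≤ B) (hBd : B ≤ d)
    (hA : D - δ * n ≤ A) (hAD : A ≤ D) (h1 : I ≤ d * (A * B)) (h2 : d * B * (D + A - n) ≤ I) :
    |I - d ^ 2 * D ^ 2 / n| ≤ 6 * δ * (d ^ 2 * D ^ 2 / n) := by
  have hD0 : 0 < D := lt_of_lt_of_le (mul_pos (by linarith) hn) hD
  have hB0 : 0 ≤ B := le_trans (mul_nonneg (by linarith) hd.le) hB
  have hup : I ≤ d ^ 2 * D := by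
    have : A * B ≤ D * d := mul_le_mul hAD hBd hB0 hD0.le
    calc I ≤ d * (A * B) := h1
      _ ≤ d * (D * d) := mul_le_mul_of_nonneg_left this hd.le
      _ = _ := by ring
  have hlow : (1 - 6 * δ) * (d ^ 2 * n) ≤ I := by
    have e1 : (1 - 5 * δ) * n ≤ D + A - n := by linarith
    have e2 : d * ((1 - δ) * d) * ((1 - 5 * δ) * n) ≤ d * B * (D + A - n) :=
      mul_le_mul (mul_le_mul_of_nonneg_left hB hd.le) e1
        (mul_nonneg (by linarith) hn.le) (mul_nonneg hd.le hB0)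
    have e3 : 0 ≤ δ ^ 2 * (d ^ 2 * n) := by positivity
    nlinarith
  have t1 : d ^ 2 * D ≤ (1 + 6 * δ) * (d ^ 2 * D ^ 2 / n) := by
    rw [mul_div_assoc', le_div_iff₀ hn]
    have : n ≤ (1 + 6 * δ) * D := by
      have := mul_le_mul_of_nonneg_left hD (by linarith : 0 ≤ 1 + 6 * δ)
      have e : 0 ≤ δ * n := by positivity
      nlinarith
    have := mul_le_mul_of_nonneg_left this (by positivity : 0 ≤ d ^ 2 * D)
    linarith
  have t2 : d ^ 2 * D ^ 2 / n ≤ d ^ 2 * n := by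
    rw [div_le_iff₀ hn]
    have : D ^ 2 ≤ n ^ 2 := pow_le_pow_left₀ hD0.le hDn 2
    have := mul_le_mul_of_nonneg_left this (sq_nonneg d)
    linarith
  have t3 := mul_le_mul_of_nonneg_left t2 (by linarith : 0 ≤ 1 - 6 * δ)
  exact abs_le.2 ⟨by linarith, by linarith⟩

lemma abs_sub_le_of_disc {δ n d D A B I : ℝ} (hδ : 0 < δ) (hδ1 : δ ≤ 1 / 100) (hn : 0 < n)
    (hd : δ * n ≤ d) (hD : δ * n ≤ D) (hB : (1 - δ) * d ≤ B) (hBd : B ≤ d)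
    (hA : (1 - δ) * D ≤ A) (hAD : A ≤ D) (h : |I - d / n * A * (D * B)| ≤ δ ^ 5 * n ^ 3) :
    |I - d ^ 2 * D ^ 2 / n| ≤ 6 * δ * (d ^ 2 * D ^ 2 / n) := by
  have hδn : 0 < δ * n := mul_pos hδ hn
  have hd0 : 0 < d := hδn.trans_le hd
  have hD0 : 0 < D := hδn.trans_le hD
  have hA0 : 0 ≤ A := le_trans (mul_nonneg (by linarith) hD0.le) hA
  set T := d ^ 2 * D ^ 2 / n with hT
  have hTl : δ ^ 4 * n ^ 3 ≤ T := by
    rw [hT, le_div_iff₀ hn]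
    have e1 : (δ * n) ^ 2 ≤ d ^ 2 := pow_le_pow_left₀ hδn.le hd 2
    have e2 : (δ * n) ^ 2 ≤ D ^ 2 := pow_le_pow_left₀ hδn.le hD 2
    have := mul_le_mul e1 e2 (sq_nonneg _) (sq_nonneg _)
    calc _ = (δ * n) ^ 2 * (δ * n) ^ 2 := by ring
      _ ≤ _ := this
  have h5 : δ ^ 5 * n ^ 3 ≤ δ * T := by
    have := mul_le_mul_of_nonneg_left hTl hδ.le
    calc _ = δ * (δ ^ 4 * n ^ 3) := by ring
      _ ≤ _ := this
  have hT0 : 0 < T := by positivity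
  have e : d / n * A * (D * B) = (A * B) * (d * D / n) := by ring
  have eT : T = (D * d) * (d * D / n) := by rw [hT]; ring
  have hc : 0 < d * D / n := by positivity
  have u : A * B ≤ D * d := mul_le_mul hAD hBd (le_trans (mul_nonneg (by linarith) hd0.le) hB) hD0.le
  have l : (1 - 2 * δ) * (D * d) ≤ A * B := by
    have := mul_le_mul hA hB (mul_nonneg (by linarith) hd0.le) hA0
    have e3 : 0 ≤ δ ^ 2 * (D * d) := by positivity
    nlinarith
  have u' := mul_le_mul_of_nonneg_right u hc.le
  have l' := mul_le_mul_of_nonneg_right l hc.le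
  rw [mul_assoc, ← eT] at l'
  rw [← eT] at u'
  rw [e] at h
  have h' := abs_le.1 h
  have : 0 ≤ δ * T := by positivity
  exact abs_le.2 ⟨by linarith, by linarith⟩

/-- In a `d`-regular graph the number of candidate `4`-paths between two vertices is close to
its expected value; small discrepancy is needed only when the graph is neither sparse nor
co-sparse. -/
lemma card_pathTriples_near {d : ℕ} {E : Finset (Sym2 (Fin n))} (hE : E ∈ regEdges n d)
    (hdn : d + 2 ≤ n) (x y : Fin n) {δ : ℝ} (hδ : 0 < δ) (hδ1 : δ ≤ 1 / 100)
    (hδd : 1 ≤ δ * d) (hxy : s(x, y) ∈ E ∨ 1 ≤ δ * ((n : ℝ) - 1 - d))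
    (hdisc : δ * n < d → δ * n < (n : ℝ) - 1 - d → ¬ HasDisc (δ ^ 5) d E) :
    |((pathTriples E x y).card : ℝ) - (d : ℝ) ^ 2 * ((n : ℝ) - 1 - d) ^ 2 / n| ≤
      6 * δ * ((d : ℝ) ^ 2 * ((n : ℝ) - 1 - d) ^ 2 / n) := by
  obtain ⟨A, B, hA0, hB0, hAD, hA1, hA2, hBd, hB1, u1, u2, l1, l2, hI⟩ :=
    card_pathTriples_crude hE (by omega) x y
  set I : ℝ := ((pathTriples E x y).card : ℝ)
  have hdR : (d : ℝ) + 2 ≤ n := by exact_mod_cast hdn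
  have hn0 : (0 : ℝ) < n := by have : (0 : ℝ) ≤ d := Nat.cast_nonneg _; linarith
  have hd0 : (0 : ℝ) < d := by
    by_contra h
    have := mul_nonpos_of_nonneg_of_nonpos hδ.le (not_lt.1 h); linarith
  set D : ℝ := (n : ℝ) - 1 - d with hD
  have hn1 : 1 ≤ δ * n := by
    have := mul_le_mul_of_nonneg_left (by linarith : (d : ℝ) ≤ n) hδ.le
    linarith
  have hA3 : (1 - δ) * D ≤ A := by
    rcases hxy with h | h
    · have : 0 ≤ δ * D := mul_nonneg hδ.le (by linarith)
      rw [hA2 h]; linarith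
    · linarith
  have hB3 : (1 - δ) * d ≤ B := by linarith
  rcases le_or_gt (d : ℝ) (δ * n) with h | h
  · exact abs_sub_le_of_sparse hδ hδ1 hn0 hd0 (by linarith) (by linarith) hB3 hBd
      (by linarith) hAD u1 l1
  rcases le_or_gt D (δ * n) with h' | h'
  · have := abs_sub_le_of_sparse (A := B) (B := A) (I := I) hδ hδ1 hn0 (by linarith : 0 < D)
      (by linarith : (1 - 2 * δ) * n ≤ d)
      (by linarith) hA3 hAD (by linarith) hBd (by linarith) (by linarith)
    rwa [mul_comm (D ^ 2)] at this
  · exact abs_sub_le_of_disc hδ hδ1 hn0 h.le h'.le hB3 hBd hA3 hAD (hI _ (hdisc h h'))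

open Finset in
lemma card_fiber_pathTriples_right {d : ℕ} {E : Finset (Sym2 (Fin n))} (hE : E ∈ regEdges n d)
    (x y : Fin n) (e : Sym2 (Fin n)) :
    ((pathTriples E x y).filter (fun p => s(y, p.2.2) = e)).card ≤
      min d (n - 1 - d) * (n - 1 - d) := by
  set J := (pathTriples E x y).filter (fun p => s(y, p.2.2) = e) with hJ
  rcases J.eq_empty_or_nonempty with h | ⟨p₀, hp₀⟩
  · simp [h]
  have hw : ∀ p ∈ J, p.2.2 = p₀.2.2 := fun p hp =>
    Sym2.congr_right.1 ((mem_filter.1 hp).2.trans (mem_filter.1 hp₀).2.symm)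
  have hmem : ∀ p ∈ J, _ := fun p hp => (mem_filter.1 (mem_filter.1 hp).1).2
  have h1 : (J.image (fun p => p.2.1)).card ≤ n - 1 - d := by
    have hsub : J.image (fun p => p.2.1) ⊆
        univ.filter (fun v => p₀.2.2 ≠ v ∧ s(p₀.2.2, v) ∉ E) := by
      intro v hv
      obtain ⟨p, hp, rfl⟩ := mem_image.1 hv
      have := (hmem p hp).2.2.1
      rw [hw p hp, Sym2.eq_swap] at this
      exact mem_filter.2 ⟨mem_univ _, this.1.symm, this.2⟩
    have := card_filter_nonadj hE p₀.2.2
    exact (card_le_card hsub).trans (by omega)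
  refine (card_le_mul_card_image (f := fun p => p.2.1) J (min d (n - 1 - d)) ?_).trans
    (Nat.mul_le_mul_left _ h1)
  intro v _
  have hinj : Set.InjOn (fun p : Fin n × Fin n × Fin n => p.1)
      ((J.filter (fun p => p.2.1 = v) : Finset _) : Set (Fin n × Fin n × Fin n)) := by
    intro p hp p' hp' he
    have hp := mem_filter.1 (mem_coe.1 hp)
    have hp' := mem_filter.1 (mem_coe.1 hp')
    exact Prod.ext he (Prod.ext (hp.2.trans hp'.2.symm) ((hw p hp.1).trans (hw p' hp'.1).symm))
  rw [← card_image_of_injOn hinj]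
  refine le_min ?_ ?_
  · have hd := (mem_filter.1 hE).2 v
    rw [degE_eq_card_neighbors] at hd
    rw [← hd]
    refine card_le_card fun u hu => ?_
    obtain ⟨p, hp, rfl⟩ := mem_image.1 hu
    have hp := mem_filter.1 hp
    have := (hmem p hp.1).2.1
    rw [hp.2] at this
    exact mem_filter.2 ⟨mem_univ _, this⟩
  · have := card_filter_nonadj hE x
    refine le_trans (card_le_card (t := univ.filter (fun v => x ≠ v ∧ s(x, v) ∉ E))
      fun u hu => ?_) (by omega)
    obtain ⟨p, hp, rfl⟩ := mem_image.1 hu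
    have := (hmem p (mem_filter.1 hp).1).1
    exact mem_filter.2 ⟨mem_univ _, this.1, this.2.1⟩

open Finset in
lemma card_fiber_pathTriples_left {d : ℕ} {E : Finset (Sym2 (Fin n))} (hE : E ∈ regEdges n d)
    (x y : Fin n) (e : Sym2 (Fin n)) :
    ((pathTriples E x y).filter (fun p => s(p.2.1, p.1) = e)).card ≤
      min d (n - 1 - d) * 2 := by
  set J := (pathTriples E x y).filter (fun p => s(p.2.1, p.1) = e) with hJ
  have hmem : ∀ p ∈ J, _ := fun p hp => (mem_filter.1 (mem_filter.1 hp).1).2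
  have h1 : (J.image (fun p => (p.2.1, p.1))).card ≤ 2 := by
    refine le_trans (card_le_card fun v hv => ?_) (card_mk_fiber_le_two univ e)
    obtain ⟨p, hp, rfl⟩ := mem_image.1 hv
    exact mem_filter.2 ⟨mem_univ _, (mem_filter.1 hp).2⟩
  refine (card_le_mul_card_image (f := fun p => (p.2.1, p.1)) J (min d (n - 1 - d)) ?_).trans
    (Nat.mul_le_mul_left _ h1)
  rintro ⟨v, u⟩ _
  have hinj : Set.InjOn (fun p : Fin n × Fin n × Fin n => p.2.2)
      ((J.filter (fun p => (p.2.1, p.1) = (v, u)) : Finset _) :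
        Set (Fin n × Fin n × Fin n)) := by
    intro p hp p' hp' he
    have hp := (mem_filter.1 (mem_coe.1 hp)).2
    have hp' := (mem_filter.1 (mem_coe.1 hp')).2
    rw [Prod.mk.injEq] at hp hp'
    exact Prod.ext (hp.2.trans hp'.2.symm) (Prod.ext (hp.1.trans hp'.1.symm) he)
  rw [← card_image_of_injOn hinj]
  refine le_min ?_ ?_
  · have hd := (mem_filter.1 hE).2 y
    rw [degE_eq_card_neighbors] at hd
    rw [← hd]
    refine card_le_card fun w hw => ?_
    obtain ⟨p, hp, rfl⟩ := mem_image.1 hw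
    exact mem_filter.2 ⟨mem_univ _, (hmem p (mem_filter.1 hp).1).2.2.2.1⟩
  · have := card_filter_nonadj hE v
    refine le_trans (card_le_card (t := univ.filter (fun w => v ≠ w ∧ s(v, w) ∉ E))
      fun w hw => ?_) (by omega)
    obtain ⟨p, hp, rfl⟩ := mem_image.1 hw
    have hp := mem_filter.1 hp
    have := (hmem p hp.1).2.2.1
    rw [(Prod.mk.inj hp.2).1] at this
    exact mem_filter.2 ⟨mem_univ _, this⟩

/-- The number of candidate `4`-paths in `K` both of whose `K`-edges lie in `E`. -/
def pathCountIn (K E : Finset (Sym2 (Fin n))) (x y : Fin n) : ℕ :=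
  ((pathTriples K x y).filter (fun p => s(p.2.1, p.1) ∈ E ∧ s(y, p.2.2) ∈ E)).card

set_option maxHeartbeats 1000000 in
open Finset in
lemma card_pathCountIn_deviation_le {d m : ℕ} {K : Finset (Sym2 (Fin n))}
    (hK : K ∈ regEdges n d) (hdn : d + 2 ≤ n) (x y : Fin n) {δ ε τ : ℝ} (hδ1 : δ ≤ 1 / 100)
    (hε : 0 < ε) (hε1 : ε ≤ 1) (hτ : 0 < τ) (hτ1 : τ ≤ 1 / 2) (hm : ε * d * n ≤ m) (hm2 : 2 * m ≤ d * n)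
    (hd : 0 < d) (hετ : 1 ≤ τ * (ε * n)) (hnτ : 2 * (1 + τ) ≤ τ * n)
    (hI : |((pathTriples K x y).card : ℝ) - (d : ℝ) ^ 2 * ((n : ℝ) - 1 - d) ^ 2 / n| ≤
      6 * δ * ((d : ℝ) ^ 2 * ((n : ℝ) - 1 - d) ^ 2 / n)) :
    (((K.powersetCard m).filter (fun E =>
      ¬ |(pathCountIn K E x y : ℝ) - (2 * m / (d * n)) ^ 2 * (pathTriples K x y).card| ≤
        7 * τ * ((2 * m / (d * n)) ^ 2 * (pathTriples K x y).card))).card : ℝ) ≤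
      4 * Real.exp (-(τ ^ 2 * ε ^ 2 * d / 64)) * K.card.choose m := by
  have hK' : K ⊆ allPairs n := mem_powerset.1 (mem_filter.1 hK).1
  have hMc := two_mul_card_of_mem_regEdges hK
  have hMR : 2 * (K.card : ℝ) = d * n := by exact_mod_cast hMc
  have hdR : (1 : ℝ) ≤ d := by exact_mod_cast hd
  have hdnR : (d : ℝ) + 2 ≤ n := by exact_mod_cast hdn
  set D : ℝ := (n : ℝ) - 1 - d with hD
  have hDnat : ((n - 1 - d : ℕ) : ℝ) = D := by
    rw [hD, Nat.sub_sub, Nat.cast_sub (by omega)]; push_cast; ring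
  have hD1 : 1 ≤ D := by linarith
  have hn0 : (0 : ℝ) < n := by linarith
  have hd0 : (0 : ℝ) < d := by linarith
  have hD0 : 0 < D := by linarith
  have hm0 : (0 : ℝ) < m := lt_of_lt_of_le (by positivity) hm
  set T : ℝ := (d : ℝ) ^ 2 * D ^ 2 / n with hT
  have hT0 : 0 < T := by positivity
  set I : ℝ := ((pathTriples K x y).card : ℝ) with hIdef
  have hIT : T / 2 ≤ I := by
    have := (abs_le.1 hI).1
    have := mul_le_mul_of_nonneg_right hδ1 hT0.le
    linarith
  have hI0 : 0 < I := by linarith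
  set μ : ℝ := min (d : ℝ) D with hμ
  have hμ0 : 0 < μ := lt_min hd0 hD0
  have hμnat : ((min d (n - 1 - d) : ℕ) : ℝ) = μ := by rw [Nat.cast_min, hDnat]
  set q : ℝ := 2 * m / (d * n) with hq
  have hqε : 2 * ε ≤ q := by
    rw [hq, le_div_iff₀ (by positivity)]; linarith
  have hq0 : 0 < q := by positivity
  have hΩ₁ : ((K.filter (fun e => y ∈ e)).card : ℝ) = d := by
    have := (mem_filter.1 hK).2 y
    exact_mod_cast this
  have hmax : (d : ℝ) * D / μ ≥ n / 4 := by
    rw [ge_iff_le, le_div_iff₀ hμ0]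
    rcases le_total (d : ℝ) D with h | h
    · rw [hμ, min_eq_left h]; nlinarith
    · rw [hμ, min_eq_right h]; nlinarith
  have hTμ : d * D * μ / 4 ≤ T := by
    rw [ge_iff_le, le_div_iff₀ hμ0] at hmax
    rw [hT, le_div_iff₀ hn0]
    have := mul_le_mul_of_nonneg_left hmax (by positivity : 0 ≤ d * D)
    linarith
  have hb := bilinear_concentration K (K.filter (fun e => y ∈ e)) (filter_subset _ _)
    (pathTriples K x y) (fun p => s(p.2.1, p.1)) (fun p => s(y, p.2.2)) ?_ ?_ (μ * D) (μ * 2)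
    (by positivity) (by positivity) ?_ ?_ m (by omega) (by exact_mod_cast hm0) q ?_
    (Nat.cast_pos.1 hI0) τ hτ hτ1 ?_ ?_
  · refine hb.trans ?_
    refine mul_le_mul_of_nonneg_right ?_ (Nat.cast_nonneg _)
    have e1 : τ ^ 2 * ε ^ 2 * d / 64 ≤ τ ^ 2 * (q * I) / (4 * (μ * D)) := by
      rw [le_div_iff₀ (by positivity)]
      have g1 : ε * (d * D * μ / 4) ≤ q * I :=
        le_trans (by linarith [mul_le_mul_of_nonneg_left hTμ hε.le])
          (mul_le_mul hqε hIT (by positivity) hq0.le)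
      have g2 : ε ^ 2 * (d * D * μ) ≤ ε * (d * D * μ) :=
        mul_le_mul_of_nonneg_right (by nlinarith) (by positivity)
      calc _ = τ ^ 2 * (ε ^ 2 * (d * D * μ) / 16) := by ring
        _ ≤ τ ^ 2 * (q * I) := by
          refine mul_le_mul_of_nonneg_left ?_ (sq_nonneg _)
          have : 0 < ε * (d * D * μ) := by positivity
          linarith
    have e2 : τ ^ 2 * ε ^ 2 * d / 64 ≤ τ ^ 2 * (q ^ 2 * I) / (16 * (μ * 2)) := by
      rw [le_div_iff₀ (by positivity)]
      have g0 : (2 * ε) ^ 2 ≤ q ^ 2 := pow_le_pow_left₀ (by positivity) hqε 2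
      have g1 : 2 * ε ^ 2 * (d * D * μ / 4) ≤ q ^ 2 * I :=
        le_trans (by linarith [mul_le_mul_of_nonneg_left hTμ (sq_nonneg ε)])
          (mul_le_mul g0 hIT (by positivity) (by positivity))
      have g2 : ε ^ 2 * (d * μ) * 1 ≤ ε ^ 2 * (d * μ) * D :=
        mul_le_mul_of_nonneg_left hD1 (by positivity)
      calc _ = τ ^ 2 * (ε ^ 2 * (d * μ) / 2) := by ring
        _ ≤ τ ^ 2 * (q ^ 2 * I) := by
          refine mul_le_mul_of_nonneg_left ?_ (sq_nonneg _)
          linarith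
    have f1 := Real.exp_le_exp.2 (neg_le_neg e1)
    have f2 := Real.exp_le_exp.2 (neg_le_neg e2)
    linarith
  · intro p hp
    have hp := (mem_filter.1 hp).2
    refine mem_sdiff.2 ⟨hp.2.1, fun h => ?_⟩
    rcases Sym2.mem_iff.1 (mem_filter.1 h).2 with h | h
    · exact hp.2.2.1.2 (h ▸ hp.2.2.2.1)
    · exact hp.1.2.2 h.symm
  · intro p hp
    have hp := (mem_filter.1 hp).2
    exact mem_filter.2 ⟨hp.2.2.2.1, Sym2.mem_mk_left _ _⟩
  · intro e
    rw [← hμnat, ← hDnat]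
    exact_mod_cast card_fiber_pathTriples_right hK x y e
  · intro e
    rw [← hμnat]
    exact_mod_cast card_fiber_pathTriples_left hK x y e
  · rw [hq, ← hMR, mul_div_mul_left _ _ two_ne_zero]
  · rw [hΩ₁]
    have := mul_le_mul_of_nonneg_left hm hτ.le
    have := mul_le_mul_of_nonneg_left hετ hd0.le
    linarith
  · rw [hΩ₁]
    have := mul_le_mul_of_nonneg_left hnτ hd0.le
    nlinarith

/-- Every pair of vertices that is joined in `K` (unless `d` is bounded away from `n`) has the
expected number of `4`-paths whose `K`-edges lie in `E`, up to a factor `1 ± η`. -/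
def GoodPair (η : ℝ) (d m : ℕ) (K E : Finset (Sym2 (Fin n))) : Prop :=
  ∀ x y : Fin n, x ≠ y → ((n : ℝ) - 10 ^ 3 / η ≤ (d : ℝ) → s(x, y) ∈ K) →
    |(pathCountIn K E x y : ℝ) - (2 * (m : ℝ)) ^ 2 * ((n : ℝ) - 1 - d) ^ 2 / (n : ℝ) ^ 3| ≤
      η * ((2 * (m : ℝ)) ^ 2 * ((n : ℝ) - 1 - d) ^ 2 / (n : ℝ) ^ 3)

lemma abs_sub_le_of_near {η X Q T I : ℝ} (hη : 0 < η) (hη1 : η ≤ 1) (hQ : 0 ≤ Q) (hT : 0 ≤ T)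
    (hI : |I - T| ≤ 6 * (η / 100) * T) (hX : |X - Q * I| ≤ 7 * (η / 28) * (Q * I)) :
    |X - Q * T| ≤ η * (Q * T) := by
  have h1 : |Q * I - Q * T| ≤ 6 * (η / 100) * (Q * T) := by
    rw [← mul_sub, abs_mul, abs_of_nonneg hQ]
    have := mul_le_mul_of_nonneg_left hI hQ
    linarith
  have hQT : 0 ≤ Q * T := mul_nonneg hQ hT
  have h2 := (abs_le.1 h1).2
  have h3 : Q * I ≤ 2 * (Q * T) := by
    have := mul_le_mul_of_nonneg_right hη1 hQT
    linarith
  have h4 := mul_le_mul_of_nonneg_left h3 hη.le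
  have h5 : 0 ≤ η * (Q * T) := mul_nonneg hη.le hQT
  calc |X - Q * T| ≤ |X - Q * I| + |Q * I - Q * T| := abs_sub_le _ _ _
    _ ≤ _ := by linarith

open Finset in
lemma goodPair_of_complete {η : ℝ} {d m : ℕ} {K : Finset (Sym2 (Fin n))}
    (hK : K ∈ regEdges n d) (hd : d + 1 = n) (E : Finset (Sym2 (Fin n))) :
    GoodPair η d m K E := by
  intro x y _ _
  have h0 : (n : ℝ) - 1 - d = 0 := by rw [← hd]; push_cast; ring
  have h1 : pathTriples K x y = ∅ := by
    refine eq_empty_of_forall_notMem fun p hp => ?_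
    have hp := (mem_filter.1 hp).2.1
    have hc := card_filter_nonadj hK x
    have : univ.filter (fun v => x ≠ v ∧ s(x, v) ∉ K) = ∅ := card_eq_zero.1 (by omega)
    exact notMem_empty p.1 (this ▸ mem_filter.2 ⟨mem_univ _, hp.1, hp.2.1⟩)
  simp [pathCountIn, h0, h1]

open Finset in
lemma card_not_goodPair_le {η ε : ℝ} {d m : ℕ} {K : Finset (Sym2 (Fin n))}
    (hη : 0 < η) (hη1 : η ≤ 1) (hε : 0 < ε) (hε1 : ε ≤ 1)
    (hK : K ∈ regEdges n d) (hdn : d + 2 ≤ n) (hd : 1 ≤ η / 100 * d)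
    (hm : ε * d * n ≤ m) (hm2 : 2 * m ≤ d * n)
    (hετ : 1 ≤ η / 28 * (ε * n)) (hnτ : 2 * (1 + η / 28) ≤ η / 28 * n)
    (hdisc : ¬ HasDisc ((η / 100) ^ 5) d K) :
    (((K.powersetCard m).filter (fun E => ¬ GoodPair η d m K E)).card : ℝ) ≤
      (n : ℝ) ^ 2 * (4 * Real.exp (-((η / 28) ^ 2 * ε ^ 2 * d / 64)) * K.card.choose m) := by
  have hdR : (d : ℝ) + 2 ≤ n := by exact_mod_cast hdn
  have hd0 : (0 : ℝ) < d := by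
    by_contra h
    have := mul_nonpos_of_nonneg_of_nonpos (by positivity : 0 ≤ η / 100) (not_lt.1 h)
    linarith
  have hn0 : (0 : ℝ) < n := by linarith
  set q : ℝ := 2 * m / (d * n) with hq
  set Bd : Fin n × Fin n → Finset (Finset (Sym2 (Fin n))) := fun p =>
    (K.powersetCard m).filter (fun E =>
      ¬ |(pathCountIn K E p.1 p.2 : ℝ) - q ^ 2 * (pathTriples K p.1 p.2).card| ≤
        7 * (η / 28) * (q ^ 2 * (pathTriples K p.1 p.2).card)) with hBd
  set V := (univ : Finset (Fin n × Fin n)).filter (fun p =>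
    (n : ℝ) - 10 ^ 3 / η ≤ (d : ℝ) → s(p.1, p.2) ∈ K) with hV
  have hnear : ∀ p ∈ V, |((pathTriples K p.1 p.2).card : ℝ) -
      (d : ℝ) ^ 2 * ((n : ℝ) - 1 - d) ^ 2 / n| ≤
      6 * (η / 100) * ((d : ℝ) ^ 2 * ((n : ℝ) - 1 - d) ^ 2 / n) := by
    intro p hp
    refine card_pathTriples_near hK hdn p.1 p.2 (by positivity) (by linarith) hd ?_
      (fun _ _ => hdisc)
    by_cases h : (n : ℝ) - 10 ^ 3 / η ≤ (d : ℝ)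
    · exact Or.inl ((mem_filter.1 hp).2 h)
    · right
      have h1 : (10 : ℝ) ^ 3 / η - 1 ≤ (n : ℝ) - 1 - d := by linarith [not_le.1 h]
      have h2 := mul_le_mul_of_nonneg_left h1 (by positivity : 0 ≤ η / 100)
      have h3 : η / 100 * (10 ^ 3 / η - 1) = 10 - η / 100 := by
        field_simp; norm_num
      linarith
  have hsub : (K.powersetCard m).filter (fun E => ¬ GoodPair η d m K E) ⊆ V.biUnion Bd := by
    intro E hE
    obtain ⟨h1, h2⟩ := mem_filter.1 hE
    by_contra hcon
    refine h2 fun x y _ hxy => ?_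
    have hp : (x, y) ∈ V := mem_filter.2 ⟨mem_univ _, hxy⟩
    have hX : |(pathCountIn K E x y : ℝ) - q ^ 2 * (pathTriples K x y).card| ≤
        7 * (η / 28) * (q ^ 2 * (pathTriples K x y).card) := by
      by_contra hX
      exact hcon (mem_biUnion.2 ⟨(x, y), hp, mem_filter.2 ⟨h1, hX⟩⟩)
    have := abs_sub_le_of_near hη hη1 (sq_nonneg q) (by positivity) (hnear _ hp) hX
    have e : q ^ 2 * ((d : ℝ) ^ 2 * ((n : ℝ) - 1 - d) ^ 2 / n) =
        (2 * (m : ℝ)) ^ 2 * ((n : ℝ) - 1 - d) ^ 2 / (n : ℝ) ^ 3 := by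
      rw [hq]; field_simp
    rwa [e] at this
  have hone : ∀ p ∈ V, ((Bd p).card : ℝ) ≤
      4 * Real.exp (-((η / 28) ^ 2 * ε ^ 2 * d / 64)) * K.card.choose m := fun p hp =>
    card_pathCountIn_deviation_le hK hdn p.1 p.2 (by linarith : η / 100 ≤ 1 / 100) hε hε1
      (by positivity) (by linarith) hm hm2 (by exact_mod_cast hd0) hετ hnτ (hnear p hp)
  have hVc : (V.card : ℝ) ≤ (n : ℝ) ^ 2 := by
    have := card_le_univ V
    rw [Fintype.card_prod, Fintype.card_fin] at this
    rw [sq]; exact_mod_cast this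
  calc (((K.powersetCard m).filter (fun E => ¬ GoodPair η d m K E)).card : ℝ)
      ≤ ∑ p ∈ V, ((Bd p).card : ℝ) := by
        exact_mod_cast (card_le_card hsub).trans card_biUnion_le
    _ ≤ V.card * _ := by
        rw [← nsmul_eq_mul]; exact sum_le_card_nsmul _ _ _ hone
    _ ≤ _ := mul_le_mul_of_nonneg_right hVc (by positivity)

set_option maxHeartbeats 1000000 in
open Finset Filter in
/-- Almost all pairs `(K, E)`, with `K` a `d`-regular graph and `E` a set of `m` edges of `K`,
are good. -/
lemma sum_card_not_goodPair_le (η ε : ℝ) (hη : 0 < η) (hη1 : η ≤ 1) (hε : 0 < ε) (hε1 : ε ≤ 1) :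
    ∃ C : ℝ, 0 < C ∧ ∀ c : ℝ, 0 < c → ∃ n₀ : ℕ, ∀ n : ℕ, n₀ ≤ n → ∀ d : ℕ,
      C * Real.log n ≤ d → d ≤ n - 1 → Even (d * n) → ∀ m : ℕ, ε * d * n ≤ m → 2 * m ≤ d * n →
        ∑ K ∈ regEdges n d,
          (((K.powersetCard m).filter (fun E => ¬ GoodPair η d m K E)).card : ℝ) ≤
        c / (n : ℝ) ^ 8 * ∑ K ∈ regEdges n d, ((K.powersetCard m).card : ℝ) := by
  set κ : ℝ := (η / 28) ^ 2 * ε ^ 2 / 64 with hκ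
  have hκ0 : 0 < κ := by positivity
  refine ⟨12 / κ, by positivity, fun c hc => ?_⟩
  obtain ⟨N, hN⟩ := card_regEdges_hasDisc_le ((η / 100) ^ 5) (c / 2) (by positivity)
    (pow_le_one₀ (by positivity) (by linarith)) (by positivity)
  have hlin : ∀ a : ℝ, 0 < a → ∀ b : ℝ, ∀ᶠ n : ℕ in atTop, b ≤ a * n := by
    intro a ha b
    have : Tendsto (fun n : ℕ => a * (n : ℝ)) atTop atTop :=
      tendsto_natCast_atTop_atTop.const_mul_atTop ha
    exact this.eventually_ge_atTop b
  have hlog : ∀ᶠ n : ℕ in atTop, 100 / η ≤ 12 / κ * Real.log n :=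
    ((Real.tendsto_log_atTop.comp tendsto_natCast_atTop_atTop).const_mul_atTop
      (by positivity : 0 < 12 / κ)).eventually_ge_atTop _
  obtain ⟨n₀, hn₀⟩ := eventually_atTop.1 (((hlin (η / 28 * ε) (by positivity) 1).and
    (hlin (η / 28) (by positivity) (2 * (1 + η / 28)))).and ((hlog.and (hlin c hc 8)).and
      ((eventually_ge_atTop N).and (eventually_ge_atTop 2))))
  refine ⟨n₀, fun n hn d hCd hd hev m hm hm2 => ?_⟩
  obtain ⟨⟨a1, a2⟩, ⟨a3, a4⟩, a5, a6⟩ := hn₀ n hn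
  have hn1 : (1 : ℝ) ≤ n := by exact_mod_cast (by omega : 1 ≤ n)
  have hn0 : (0 : ℝ) < n := by linarith
  rcases (by omega : d + 1 = n ∨ d + 2 ≤ n) with hdn | hdn
  · have : ∀ K ∈ regEdges n d,
        (((K.powersetCard m).filter (fun E => ¬ GoodPair η d m K E)).card : ℝ) = 0 := by
      intro K hK
      rw [Nat.cast_eq_zero, card_eq_zero, filter_eq_empty_iff]
      exact fun E _ h => h (goodPair_of_complete hK hdn E)
    rw [sum_congr rfl this, sum_const_zero]
    exact mul_nonneg (div_nonneg hc.le (pow_nonneg hn0.le 8))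
      (sum_nonneg fun _ _ => Nat.cast_nonneg _)
  have hexp : (n : ℝ) ^ 2 * (4 * Real.exp (-((η / 28) ^ 2 * ε ^ 2 * d / 64))) ≤
      c / 2 / (n : ℝ) ^ 8 := by
    have e1 : Real.exp (-((η / 28) ^ 2 * ε ^ 2 * d / 64)) ≤ ((n : ℝ) ^ 12)⁻¹ := by
      rw [← Real.exp_log (pow_pos hn0 12), ← Real.exp_neg, Real.log_pow]
      refine Real.exp_le_exp.2 (neg_le_neg ?_)
      have := mul_le_mul_of_nonneg_left hCd hκ0.le
      calc ((12 : ℕ) : ℝ) * Real.log n = κ * (12 / κ * Real.log n) := by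
            push_cast; field_simp
        _ ≤ κ * d := this
        _ = _ := by rw [hκ]; ring
    have e2 := mul_le_mul_of_nonneg_left e1 (by positivity : 0 ≤ (n : ℝ) ^ 2 * 4)
    have e3 : (n : ℝ) ^ 2 * 4 * ((n : ℝ) ^ 12)⁻¹ ≤ c / 2 / (n : ℝ) ^ 8 := by
      rw [le_div_iff₀ (by positivity)]
      have : (n : ℝ) ^ 2 * 4 * ((n : ℝ) ^ 12)⁻¹ * (n : ℝ) ^ 8 = 4 / (n : ℝ) ^ 2 := by
        field_simp
      rw [this, div_le_iff₀ (by positivity)]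
      have := mul_le_mul_of_nonneg_left hn1 (mul_pos hc hn0).le
      nlinarith
    linarith
  have hCh : ∀ K ∈ regEdges n d, K.card.choose m = (d * n / 2).choose m := by
    intro K hK
    have := two_mul_card_of_mem_regEdges hK
    congr 1; omega
  set Ch : ℝ := ((d * n / 2).choose m : ℝ) with hChdef
  have hCh0 : 0 ≤ Ch := Nat.cast_nonneg _
  have hη100 : 1 ≤ η / 100 * d := by
    have := mul_le_mul_of_nonneg_left (a3.trans hCd) (by positivity : 0 ≤ η / 100)
    calc (1 : ℝ) = η / 100 * (100 / η) := by field_simp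
      _ ≤ _ := this
  have hK : ∀ K ∈ regEdges n d,
      (((K.powersetCard m).filter (fun E => ¬ GoodPair η d m K E)).card : ℝ) ≤
      (if HasDisc ((η / 100) ^ 5) d K then Ch else 0) + c / 2 / (n : ℝ) ^ 8 * Ch := by
    intro K hK
    split_ifs with h
    · have h1 : ((K.powersetCard m).filter (fun E => ¬ GoodPair η d m K E)).card ≤
          (d * n / 2).choose m := by
        rw [← hCh K hK, ← card_powersetCard]
        exact card_le_card (filter_subset _ _)
      have h2 : (((K.powersetCard m).filter (fun E => ¬ GoodPair η d m K E)).card : ℝ) ≤ Ch :=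
        Nat.cast_le.2 h1
      have : 0 ≤ c / 2 / (n : ℝ) ^ 8 * Ch := by positivity
      linarith
    · have h1 := card_not_goodPair_le (m := m) hη hη1 hε hε1 hK hdn hη100 hm hm2 (by linarith) a2 h
      rw [hCh K hK, ← mul_assoc] at h1
      have := mul_le_mul_of_nonneg_right hexp hCh0
      linarith
  calc _ ≤ _ := sum_le_sum hK
    _ = ((regEdges n d).filter (HasDisc ((η / 100) ^ 5) d)).card * Ch +
        (regEdges n d).card * (c / 2 / (n : ℝ) ^ 8 * Ch) := by
      rw [sum_add_distrib, ← sum_filter, sum_const, sum_const, nsmul_eq_mul, nsmul_eq_mul]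
    _ ≤ c / 2 / (n : ℝ) ^ 8 * (regEdges n d).card * Ch +
        (regEdges n d).card * (c / 2 / (n : ℝ) ^ 8 * Ch) := by
      have := mul_le_mul_of_nonneg_right (hN n a5 d hd hev) hCh0
      linarith
    _ = c / (n : ℝ) ^ 8 * ((regEdges n d).card * Ch) := by ring
    _ = _ := by
      rw [sum_congr rfl (fun K hK => by rw [card_powersetCard, hCh K hK]), sum_const,
        nsmul_eq_mul]

/-- The edges of `G` as a finset. -/
def edgesOf (G : SimpleGraph (Fin n)) : Finset (Sym2 (Fin n)) :=
  Finset.univ.filter (fun e => e ∈ G.edgeSet)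

lemma mem_edgesOf {G : SimpleGraph (Fin n)} {e : Sym2 (Fin n)} : e ∈ edgesOf G ↔ e ∈ G.edgeSet := by
  simp [edgesOf]

lemma mk_mem_edgesOf {G : SimpleGraph (Fin n)} {u v : Fin n} : s(u, v) ∈ edgesOf G ↔ G.Adj u v := by
  simp [edgesOf]

lemma edgesOf_injective : Function.Injective (edgesOf : SimpleGraph (Fin n) → _) := by
  intro G H h
  ext u v
  rw [← mk_mem_edgesOf, h, mk_mem_edgesOf]

lemma edgeCount_eq_card (G : SimpleGraph (Fin n)) : edgeCount G = (edgesOf G).card := by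
  rw [edgeCount, ← Set.ncard_coe_finset]
  congr 1
  ext e
  simp [edgesOf]

lemma deg_eq_degE (G : SimpleGraph (Fin n)) (v : Fin n) : deg G v = degE (edgesOf G) v := by
  rw [deg, degE_eq_card_neighbors]
  refine Nat.subtype_card _ fun w => ?_
  simp [mk_mem_edgesOf]

lemma edgesOf_subset_allPairs (G : SimpleGraph (Fin n)) : edgesOf G ⊆ allPairs n := by
  intro e he
  exact Finset.mem_filter.2 ⟨Finset.mem_univ _, G.not_isDiag_of_mem_edgeSet (mem_edgesOf.1 he)⟩

lemma edgesOf_mem_regEdges {G : SimpleGraph (Fin n)} {d : ℕ} (h : IsRegularGraph G d) :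
    edgesOf G ∈ regEdges n d :=
  Finset.mem_filter.2 ⟨Finset.mem_powerset.2 (edgesOf_subset_allPairs G),
    fun z => (deg_eq_degE G z).symm.trans (h z)⟩

lemma edgesOf_fromEdgeSet {E : Finset (Sym2 (Fin n))} (hE : E ⊆ allPairs n) :
    edgesOf (SimpleGraph.fromEdgeSet (E : Set (Sym2 (Fin n)))) = E := by
  ext e
  rw [mem_edgesOf, SimpleGraph.edgeSet_fromEdgeSet]
  constructor
  · exact fun h => h.1
  · exact fun h => ⟨h, (Finset.mem_filter.1 (hE h)).2⟩

lemma edgesOf_sdiff (G H : SimpleGraph (Fin n)) : edgesOf (G \ H) = edgesOf G \ edgesOf H := by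
  ext e
  simp [mem_edgesOf, SimpleGraph.edgeSet_sdiff]

lemma edgesOf_subset {G H : SimpleGraph (Fin n)} : edgesOf G ⊆ edgesOf H ↔ G ≤ H := by
  rw [← SimpleGraph.edgeSet_subset_edgeSet]
  exact ⟨fun h e he => mem_edgesOf.1 (h (mem_edgesOf.2 he)),
    fun h e he => mem_edgesOf.2 (h (mem_edgesOf.1 he))⟩

lemma injective_fin_five_iff {α : Type*} (P : Fin 5 → α) : Function.Injective P ↔
    P 0 ≠ P 1 ∧ P 0 ≠ P 2 ∧ P 0 ≠ P 3 ∧ P 0 ≠ P 4 ∧ P 1 ≠ P 2 ∧ P 1 ≠ P 3 ∧ P 1 ≠ P 4 ∧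
      P 2 ≠ P 3 ∧ P 2 ≠ P 4 ∧ P 3 ≠ P 4 := by
  constructor
  · intro h
    refine ⟨?_, ?_, ?_, ?_, ?_, ?_, ?_, ?_, ?_, ?_⟩ <;> exact h.ne (by decide)
  · rintro ⟨h1, h2, h3, h4, h5, h6, h7, h8, h9, h10⟩ i j hij
    fin_cases i <;> fin_cases j <;> simp_all

lemma isAltSeq_four_iff (G₁ G₂ : SimpleGraph (Fin n)) (P : Fin 5 → Fin n) :
    IsAltSeq G₁ G₂ 4 P ↔ Function.Injective P ∧ G₁.Adj (P 0) (P 1) ∧ G₂.Adj (P 1) (P 2) ∧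
      G₁.Adj (P 2) (P 3) ∧ G₂.Adj (P 3) (P 4) := by
  unfold IsAltSeq
  refine and_congr_right fun _ => ?_
  rw [Fin.forall_fin_succ, Fin.forall_fin_succ, Fin.forall_fin_succ, Fin.forall_fin_succ]
  simp

lemma altPathCount_eq_pathCountIn (G F : SimpleGraph (Fin n)) {x y : Fin n} (hxy : x ≠ y) :
    altPathCount Gᶜ (G \ F) 4 x y ∅ = pathCountIn (edgesOf G) (edgesOf (G \ F)) x y := by
  have hc : altPathCount Gᶜ (G \ F) 4 x y ∅ = (Finset.univ.filter (fun P : Fin 5 → Fin n =>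
      IsAltSeq Gᶜ (G \ F) 4 P ∧ P 0 = x ∧ P 4 = y)).card := by
    refine Nat.subtype_card _ fun P => ?_
    simp only [Finset.mem_filter, Finset.mem_univ, true_and, Set.mem_empty_iff_false,
      not_false_eq_true, implies_true, and_true]
    rfl
  rw [hc, pathCountIn]
  refine Finset.card_bij (fun P _ => (P 1, P 2, P 3)) ?_ ?_ ?_
  · intro P hP
    simp only [Finset.mem_filter, Finset.mem_univ, true_and, pathTriples, isAltSeq_four_iff,
      injective_fin_five_iff, mk_mem_edgesOf, SimpleGraph.compl_adj, SimpleGraph.sdiff_adj] at hP ⊢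
    obtain ⟨⟨hi, h1, h2, h3, h4⟩, rfl, rfl⟩ := hP
    have := G.adj_comm (P 1) (P 2)
    have := F.adj_comm (P 1) (P 2)
    have := G.adj_comm (P 3) (P 4)
    have := F.adj_comm (P 3) (P 4)
    have := @ne_comm _ (P 3) (P 0)
    tauto
  · intro P hP Q hQ h
    simp only [Finset.mem_filter, Finset.mem_univ, true_and, Prod.mk.injEq] at hP hQ h
    funext i
    fin_cases i
    · exact hP.2.1.trans hQ.2.1.symm
    · exact h.1
    · exact h.2.1
    · exact h.2.2
    · exact hP.2.2.trans hQ.2.2.symm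
  · rintro ⟨v₁, v₂, v₃⟩ h
    refine ⟨![x, v₁, v₂, v₃, y], ?_, rfl⟩
    simp only [Finset.mem_filter, Finset.mem_univ, true_and, pathTriples, mk_mem_edgesOf,
      SimpleGraph.sdiff_adj] at h
    refine Finset.mem_filter.2 ⟨Finset.mem_univ _, ?_, rfl, rfl⟩
    rw [isAltSeq_four_iff, injective_fin_five_iff]
    change (x ≠ v₁ ∧ x ≠ v₂ ∧ x ≠ v₃ ∧ x ≠ y ∧ v₁ ≠ v₂ ∧ v₁ ≠ v₃ ∧ v₁ ≠ y ∧ v₂ ≠ v₃ ∧ v₂ ≠ y ∧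
      v₃ ≠ y) ∧ Gᶜ.Adj x v₁ ∧ (G \ F).Adj v₁ v₂ ∧ Gᶜ.Adj v₂ v₃ ∧ (G \ F).Adj v₃ y
    simp only [SimpleGraph.compl_adj, SimpleGraph.sdiff_adj]
    obtain ⟨⟨⟨hx1, hx2, hx3⟩, h21, ⟨h4, h5⟩, h6, h7⟩, h8, h9⟩ := h
    have g1 : G.Adj v₁ v₂ := h21.symm
    have g3 : G.Adj v₃ y := h6.symm
    refine ⟨⟨hx1, ?_, h7.symm, hxy, g1.ne, ?_, hx3, h4, ?_, g3.ne⟩, ⟨hx1, hx2⟩,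
      ⟨g1, fun h => h8.2 h.symm⟩, ⟨h4, h5⟩, g3, fun h => h9.2 h.symm⟩
    · rintro rfl; exact hx2 h21
    · rintro rfl; exact h5 h21
    · rintro rfl; exact h5 h6

/-- A bound on the proportion of elements of `S` violating `P` bounds the probability of `P`
from below. -/
lemma ofReal_one_sub_le_prEvent {α : Type*} [Finite α] (ν : PMF α) (S : Set α)
    (hν : IsUniformOn ν S) (P : α → Prop) (r : ℝ) (hr : 0 ≤ r)
    (h : (({a | a ∈ S ∧ ¬ P a}.ncard : ℕ) : ℝ) ≤ r * S.ncard) :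
    ENNReal.ofReal (1 - r) ≤ prEvent ν P := by
  have hfin := Fintype.ofFinite α
  have hadd : prEvent ν P + prEvent ν (fun a => ¬ P a) = 1 := by
    rw [← ν.tsum_coe]
    unfold prEvent
    rw [← ENNReal.tsum_add]
    refine tsum_congr fun a => ?_
    by_cases ha : P a <;> simp [ha]
  have hbad : prEvent ν (fun a => ¬ P a) =
      ({a | a ∈ S ∧ ¬ P a}.ncard : ℝ≥0∞) * (S.ncard : ℝ≥0∞)⁻¹ := by
    unfold prEvent
    have hset : {a | a ∈ S ∧ ¬ P a}.ncard =
        (Finset.univ.filter (fun a => a ∈ S ∧ ¬ P a)).card := by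
      rw [← Set.ncard_coe_finset]
      congr 1; ext a; simp
    rw [tsum_fintype, hset, ← nsmul_eq_mul, ← Finset.sum_const, Finset.sum_filter]
    refine Finset.sum_congr rfl fun a _ => ?_
    rw [hν a]
    by_cases h1 : P a <;> by_cases h2 : a ∈ S <;> simp [h1, h2]
  have hle : prEvent ν (fun a => ¬ P a) ≤ ENNReal.ofReal r := by
    rw [hbad, ← div_eq_mul_inv]
    refine ENNReal.div_le_of_le_mul ?_
    rw [← ENNReal.ofReal_natCast, ← ENNReal.ofReal_natCast, ← ENNReal.ofReal_mul hr]
    exact ENNReal.ofReal_le_ofReal h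
  rw [ENNReal.ofReal_sub _ hr, ENNReal.ofReal_one, ← hadd]
  exact tsub_le_iff_right.2 (add_le_add le_rfl hle)

/-- The pairs `(K, K − E)` with `K` a `d`-regular graph and `E` a set of `m` edges of `K`. -/
def deletionPairs (n d m : ℕ) : Set (SimpleGraph (Fin n) × SimpleGraph (Fin n)) :=
  {w | IsRegularGraph w.1 d ∧ w.2 ≤ w.1 ∧ edgeCount w.1 = edgeCount w.2 + m}

lemma edgesOf_sdiff_mem_powersetCard {d m : ℕ} {w : SimpleGraph (Fin n) × SimpleGraph (Fin n)}
    (hw : w ∈ deletionPairs n d m) :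
    edgesOf (w.1 \ w.2) ∈ (edgesOf w.1).powersetCard m := by
  refine Finset.mem_powersetCard.2 ⟨edgesOf_subset.2 sdiff_le, ?_⟩
  have h1 := Finset.card_sdiff_add_card_eq_card (edgesOf_subset.2 hw.2.1)
  have h2 := hw.2.2
  rw [edgeCount_eq_card, edgeCount_eq_card] at h2
  rw [edgesOf_sdiff]
  omega

lemma sum_card_le_ncard_deletionPairs (d m : ℕ) :
    ∑ K ∈ regEdges n d, (K.powersetCard m).card ≤ (deletionPairs n d m).ncard := by
  rw [← Finset.card_sigma, ← Set.ncard_coe_finset]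
  have hmem : ∀ p ∈ (regEdges n d).sigma (fun K => K.powersetCard m),
      p.1 ⊆ allPairs n ∧ p.2 ⊆ p.1 ∧ p.2.card = m := fun p hp => by
    have hp := Finset.mem_sigma.1 hp
    exact ⟨Finset.mem_powerset.1 (Finset.mem_filter.1 hp.1).1, Finset.mem_powersetCard.1 hp.2⟩
  refine Set.ncard_le_ncard_of_injOn (fun p => (SimpleGraph.fromEdgeSet (p.1 : Set (Sym2 (Fin n))),
    SimpleGraph.fromEdgeSet ((p.1 \ p.2 : Finset _) : Set (Sym2 (Fin n))))) ?_ ?_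
  · intro p hp
    obtain ⟨h1, h2, h3⟩ := hmem p hp
    have h1' : p.1 \ p.2 ⊆ allPairs n := Finset.sdiff_subset.trans h1
    refine ⟨fun v => ?_, ?_, ?_⟩
    · rw [deg_eq_degE, edgesOf_fromEdgeSet h1]
      exact (Finset.mem_filter.1 (Finset.mem_sigma.1 hp).1).2 v
    · rw [← edgesOf_subset, edgesOf_fromEdgeSet h1, edgesOf_fromEdgeSet h1']
      exact Finset.sdiff_subset
    · rw [edgeCount_eq_card, edgeCount_eq_card, edgesOf_fromEdgeSet h1, edgesOf_fromEdgeSet h1',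
        ← h3]
      exact (Finset.card_sdiff_add_card_eq_card h2).symm
  · rintro ⟨K, E⟩ hp ⟨K', E'⟩ hp' h
    obtain ⟨h1, h2, -⟩ := hmem _ hp
    obtain ⟨h1', h2', -⟩ := hmem _ hp'
    dsimp only at h1 h2 h1' h2'
    obtain ⟨e1, e2⟩ := Prod.mk.inj h
    have e1 := congrArg edgesOf e1
    have e2 := congrArg edgesOf e2
    dsimp only at e1 e2
    rw [edgesOf_fromEdgeSet h1, edgesOf_fromEdgeSet h1'] at e1
    rw [edgesOf_fromEdgeSet (Finset.sdiff_subset.trans h1),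
      edgesOf_fromEdgeSet (Finset.sdiff_subset.trans h1')] at e2
    subst e1
    have e3 : E = E' := by
      rw [← Finset.sdiff_sdiff_eq_self h2, e2, Finset.sdiff_sdiff_eq_self h2']
    rw [e3]

lemma ncard_deletionPairs_le (d m : ℕ)
    (P : SimpleGraph (Fin n) × SimpleGraph (Fin n) → Prop)
    (Q : Finset (Sym2 (Fin n)) → Finset (Sym2 (Fin n)) → Prop)
    (hPQ : ∀ w, P w → Q (edgesOf w.1) (edgesOf (w.1 \ w.2))) :
    {w | w ∈ deletionPairs n d m ∧ P w}.ncard ≤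
      ∑ K ∈ regEdges n d, ((K.powersetCard m).filter (Q K)).card := by
  rw [← Finset.card_sigma, ← Set.ncard_coe_finset]
  refine Set.ncard_le_ncard_of_injOn (fun w => ⟨edgesOf w.1, edgesOf (w.1 \ w.2)⟩) ?_ ?_
  · rintro w ⟨hw, hP⟩
    exact Finset.mem_sigma.2 ⟨edgesOf_mem_regEdges hw.1,
      Finset.mem_filter.2 ⟨edgesOf_sdiff_mem_powersetCard hw, hPQ w hP⟩⟩
  · rintro w ⟨hw, -⟩ w' ⟨hw', -⟩ h
    obtain ⟨e1, e2⟩ := Sigma.mk.inj h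
    have e1 := edgesOf_injective e1
    have e2 := edgesOf_injective (eq_of_heq e2)
    have e3 : w.2 = w'.2 := by
      rw [← sdiff_sdiff_eq_self hw.2.1, e2, e1, sdiff_sdiff_eq_self hw'.2.1]
    exact Prod.ext e1 e3

/-- **Concentration for switching paths in the lower part of the sandwich.** For all
`η, ε ∈ (0,1]` there is `C > 0` such that for every `c > 0` and all sufficiently large
`n`: with `C log n ≤ d ≤ n−1`, `dn` even, `ε d n ≤ m ≤ dn/2`, and `(K, F)` distributed so
that `K ~ G_d(n)`, `E` is a uniformly random `m`-subset of `E(K)` and `F = K − E`, with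
probability at least `1 − c n⁻⁸`: for all distinct `x, y` and every `Z ⊆ [n]∖{x,y}` with
`|Z| ≤ 10` such that, if `d ≥ n − 10³/η`, every vertex of `Z ∪ {y}` is adjacent to `x` in
`K`, the number of `(K̄, K∖F)`-alternating `x,y`-paths of length `4` is
`(1 ± η)·(2m)²(n−1−d)²/n³`. -/
theorem lower_switching_concentration :
    ∀ η ε : ℝ, 0 < η → η ≤ 1 → 0 < ε → ε ≤ 1 →
      ∃ C : ℝ, 0 < C ∧
        ∀ c : ℝ, 0 < c →
          ∃ n₀ : ℕ, ∀ n : ℕ, n₀ ≤ n →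
            ∀ d : ℕ, C * Real.log n ≤ (d : ℝ) → d ≤ n - 1 → Even (d * n) →
              ∀ m : ℕ, ε * d * n ≤ (m : ℝ) → 2 * m ≤ d * n →
                ∀ ν : PMF (SimpleGraph (Fin n) × SimpleGraph (Fin n)),
                  IsUniformOn ν {w | IsRegularGraph w.1 d ∧ w.2 ≤ w.1 ∧
                    edgeCount w.1 = edgeCount w.2 + m} →
                  ENNReal.ofReal (1 - c / (n : ℝ) ^ 8) ≤
                    prEvent ν (fun w =>
                      ∀ x y : Fin n, x ≠ y →
                        ∀ Z : Set (Fin n), x ∉ Z → y ∉ Z → Z.ncard ≤ 10 →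
                          ((n : ℝ) - 10 ^ 3 / η ≤ (d : ℝ) →
                            ∀ z : Fin n, z ∈ Z ∪ {y} → w.1.Adj x z) →
                          (1 - η) * (2 * (m : ℝ)) ^ 2 * ((n : ℝ) - 1 - d) ^ 2 /
                                (n : ℝ) ^ 3 ≤
                              (altPathCount w.1ᶜ (w.1 \ w.2) 4 x y ∅ : ℝ) ∧
                            (altPathCount w.1ᶜ (w.1 \ w.2) 4 x y ∅ : ℝ) ≤
                              (1 + η) * (2 * (m : ℝ)) ^ 2 * ((n : ℝ) - 1 - d) ^ 2 /
                                (n : ℝ) ^ 3) := by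
  intro η ε hη hη1 hε hε1
  obtain ⟨C, hC, hmain⟩ := sum_card_not_goodPair_le η ε hη hη1 hε hε1
  refine ⟨C, hC, fun c hc => ?_⟩
  obtain ⟨n₀, hn₀⟩ := hmain c hc
  refine ⟨n₀, fun n hn d hCd hd hev m hm hm2 ν hν => ?_⟩
  have hr : 0 ≤ c / (n : ℝ) ^ 8 := by positivity
  refine ofReal_one_sub_le_prEvent ν (deletionPairs n d m) hν _ _ hr ?_
  have h2 := hn₀ n hn d hCd hd hev m hm hm2
  have h3 : (∑ K ∈ regEdges n d, ((K.powersetCard m).card : ℝ)) ≤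
      (deletionPairs n d m).ncard := by
    exact_mod_cast sum_card_le_ncard_deletionPairs d m
  refine le_trans ?_ (h2.trans (mul_le_mul_of_nonneg_left h3 hr))
  refine (Nat.cast_le.2 (ncard_deletionPairs_le d m _ (fun K E => ¬ GoodPair η d m K E)
    fun w hw hg => hw fun x y hxy Z _ _ _ hadj => ?_)).trans (le_of_eq ?_)
  · rw [Nat.cast_sum]
    refine Finset.sum_congr rfl fun K _ => ?_
    congr!
  · have h := hg x y hxy (fun h => mk_mem_edgesOf.2 (hadj h y (Or.inr rfl)))
    rw [← altPathCount_eq_pathCountIn _ _ hxy] at h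
    have h := abs_le.1 h
    have e : ∀ t : ℝ, t * (2 * (m : ℝ)) ^ 2 * ((n : ℝ) - 1 - d) ^ 2 / (n : ℝ) ^ 3 =
        t * ((2 * (m : ℝ)) ^ 2 * ((n : ℝ) - 1 - d) ^ 2 / (n : ℝ) ^ 3) := fun t => by ring
    rw [e, e]
    constructor <;> linarith

end Sandwich
end
end
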